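/- Let 0 < s < 1, n > 2s, m ≥ 1, and let p > (n+2s)/(n−2s) satisfy p · Γ(n/2 − s/(p−1)) Γ(s + s/(p−1)) / ( Γ(s/(p−1)) Γ((n−2s)/2 − s/(p−1)) ) > Γ((n+2s)/4)² / Γ((n−2s)/4)². Let ψ_1,…,ψ_m be C² functions on the unit sphere S^{n−1} and set u_i(x) = |x|^{−2s/(p−1)} ψ_i(x/|x|). Suppose that for every x ≠ 0 and every i, L_s u_i(x) = |u(x)|^{p−1} u_i(x), and that for all φ_1,…,φ_m ∈ C_c^∞(ℝⁿ ∖ {0}): Σ_i ∫ |u|^{p−1} φ_i² + (p−1) Σ_{i,j} ∫ |u|^{p−3} u_i u_j φ_i φ_j ≤ Σ_i ½ ∬_{ℝⁿ×ℝⁿ} (φ_i(x) − φ_i(y))² / |x−y|^{n+2s} dx dy. Then ψ_i ≡ 0 for every i. -/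

import Mathlib

open MeasureTheory Metric Filter Real Set

noncomputable section

/-- `n`-dimensional Euclidean space. -/
abbrev Euc (n : ℕ) := EuclideanSpace ℝ (Fin n)

/-- Stability (quadratic form) inequality for the fractional Lane–Emden system, tested
against families of smooth compactly supported functions whose supports lie in `S`:
`Σ_i ∫ |u|^{p−1} φ_i² + (p−1) Σ_{i,j} ∫ |u|^{p−3} u_i u_j φ_i φ_j
  ≤ Σ_i ½ ∬ (φ_i(x) − φ_i(y))²/|x−y|^{n+2s}`.
(Since `‖u x‖ ^ (p−3)` is interpreted with `Real.rpow`, the term `|u|^{p−3} u_i u_j`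
vanishes on the set where `u = 0`, for any `p > 1`.) -/
def StableFrac (n m : ℕ) (s p : ℝ) (u : Euc n → EuclideanSpace ℝ (Fin m))
    (S : Set (Euc n)) : Prop :=
  ∀ φ : Fin m → Euc n → ℝ,
    (∀ i, ContDiff ℝ (⊤ : ℕ∞) (φ i)) → (∀ i, HasCompactSupport (φ i)) →
    (∀ i, tsupport (φ i) ⊆ S) →
    (∑ i, ∫ x, ‖u x‖ ^ (p - 1) * (φ i x) ^ 2) +
      (p - 1) * ∑ i, ∑ j, ∫ x, ‖u x‖ ^ (p - 3) * u x i * u x j * φ i x * φ j x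
      ≤ ∑ i, (1 : ℝ) / 2 * ∫ x, ∫ y, (φ i x - φ i y) ^ 2 / ‖x - y‖ ^ ((n : ℝ) + 2 * s)

/-- The (unnormalized) fractional Laplacian of `w` at `x` equals `L`, in the principal
value sense: `lim_{ε→0⁺} ∫_{|x−y|>ε} (w(x) − w(y))/|x−y|^{n+2s} dy = L`. -/
def FracLapEq (n : ℕ) (s : ℝ) (w : Euc n → ℝ) (x : Euc n) (L : ℝ) : Prop :=
  Tendsto (fun ε : ℝ => ∫ y in {y : Euc n | ε < ‖x - y‖}, (w x - w y) / ‖x - y‖ ^ ((n : ℝ) + 2 * s))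
    (nhdsWithin 0 (Set.Ioi 0)) (nhds L)

/-- The kernel `|x - y|^{-(n+2s)}` of the fractional Laplacian. -/
def kern (n : ℕ) (s : ℝ) (x y : Euc n) : ℝ := 1 / ‖x - y‖ ^ ((n : ℝ) + 2 * s)

section Kernel

variable {n : ℕ} {s : ℝ}

lemma kern_nonneg (x y : Euc n) : 0 ≤ kern n s x y := by
  unfold kern; positivity

lemma kern_symm (x y : Euc n) : kern n s x y = kern n s y x := by
  unfold kern; rw [norm_sub_rev]

lemma kern_rot (R : Euc n ≃ₗᵢ[ℝ] Euc n) (x y : Euc n) :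
    kern n s (R x) (R y) = kern n s x y := by
  unfold kern; rw [← map_sub, R.norm_map]

lemma kern_smul {t : ℝ} (ht : 0 < t) (x y : Euc n) :
    kern n s (t • x) (t • y) = t ^ (-((n : ℝ) + 2 * s)) * kern n s x y := by
  unfold kern
  rw [← smul_sub, norm_smul, Real.norm_of_nonneg ht.le, Real.mul_rpow ht.le (norm_nonneg _),
    Real.rpow_neg ht.le, one_div, mul_inv, one_div]

lemma measurable_kern : Measurable fun z : Euc n × Euc n => kern n s z.1 z.2 := by
  unfold kern; fun_prop

lemma measurable_kern_right (x : Euc n) : Measurable fun y : Euc n => kern n s x y := by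
  unfold kern; fun_prop

lemma kern_le {x y : Euc n} {c : ℝ} (hc : 0 < c) (h : c ≤ ‖x - y‖) (hs : 0 < s) :
    kern n s x y ≤ c ^ (-((n : ℝ) + 2 * s)) := by
  unfold kern
  rw [Real.rpow_neg hc.le, one_div]
  gcongr

end Kernel

section Symmetry

variable {n : ℕ}

lemma exists_linearIsometryEquiv_map_eq {x y : Euc n} (h : ‖x‖ = ‖y‖) :
    ∃ R : Euc n ≃ₗᵢ[ℝ] Euc n, R x = y :=
  ⟨_, Submodule.reflection_sub h⟩

lemma integral_rot {Q : Euc n → Euc n → ℝ}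
    (hQ : ∀ (R : Euc n ≃ₗᵢ[ℝ] Euc n) x y, Q (R x) (R y) = Q x y)
    (R : Euc n ≃ₗᵢ[ℝ] Euc n) (x : Euc n) : ∫ y, Q (R x) y = ∫ y, Q x y := by
  have h := R.measurePreserving.integral_comp R.toHomeomorph.measurableEmbedding (Q (R x))
  rw [← h]
  simp [hQ]

lemma integral_scale {Q : Euc n → Euc n → ℝ} {d : ℝ}
    (hQ : ∀ (R : Euc n ≃ₗᵢ[ℝ] Euc n) x y, Q (R x) (R y) = Q x y)
    (hS : ∀ t : ℝ, 0 < t → ∀ x y, Q (t • x) (t • y) = t ^ (-((n : ℝ) + d)) * Q x y)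
    {e : Euc n} (he : ‖e‖ = 1) {x : Euc n} (hx : x ≠ 0) :
    ∫ y, Q x y = ‖x‖ ^ (-d) * ∫ y, Q e y := by
  have hx' : 0 < ‖x‖ := norm_pos_iff.2 hx
  obtain ⟨R, hR⟩ := exists_linearIsometryEquiv_map_eq (x := e) (y := ‖x‖⁻¹ • x) (by
    rw [he, norm_smul, norm_inv, norm_norm, inv_mul_cancel₀ hx'.ne'])
  have hx1 : x = ‖x‖ • R e := by rw [hR, smul_smul, mul_inv_cancel₀ hx'.ne', one_smul]
  have h1 := Measure.integral_comp_smul_of_nonneg (volume : Measure (Euc n))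
    (fun y => Q x y) ‖x‖ (hR := hx'.le)
  have h2 : ∫ y, Q x (‖x‖ • y) = ‖x‖ ^ (-((n : ℝ) + d)) * ∫ y, Q e y := by
    rw [← integral_rot hQ R e, ← integral_const_mul]
    congr 1
    ext y
    rw [← hS _ hx', ← hx1]
  rw [h2, finrank_euclideanSpace_fin, smul_eq_mul] at h1
  have hn : (‖x‖ ^ n) ≠ 0 := by positivity
  have h3 : ∫ y, Q x y = ‖x‖ ^ n * (‖x‖ ^ (-((n : ℝ) + d)) * ∫ y, Q e y) := by
    rw [h1, mul_inv_cancel_left₀ hn]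
  rw [h3, ← mul_assoc, ← Real.rpow_natCast, ← Real.rpow_add hx']
  congr 2
  ring

lemma integrable_scale {Q : Euc n → Euc n → ℝ} {d : ℝ}
    (hQ : ∀ (R : Euc n ≃ₗᵢ[ℝ] Euc n) x y, Q (R x) (R y) = Q x y)
    (hS : ∀ t : ℝ, 0 < t → ∀ x y, Q (t • x) (t • y) = t ^ (-((n : ℝ) + d)) * Q x y)
    {e : Euc n} (he : ‖e‖ = 1) {x : Euc n} (hx : x ≠ 0) (hI : Integrable (Q e)) :
    Integrable (Q x) := by
  have hx' : 0 < ‖x‖ := norm_pos_iff.2 hx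
  obtain ⟨R, hR⟩ := exists_linearIsometryEquiv_map_eq (x := e) (y := ‖x‖⁻¹ • x) (by
    rw [he, norm_smul, norm_inv, norm_norm, inv_mul_cancel₀ hx'.ne'])
  have hx1 : x = ‖x‖ • R e := by rw [hR, smul_smul, mul_inv_cancel₀ hx'.ne', one_smul]
  rw [← integrable_comp_smul_iff volume _ hx'.ne',
    ← R.measurePreserving.integrable_comp_emb R.toHomeomorph.measurableEmbedding]
  have : ((fun y => Q x (‖x‖ • y)) ∘ R) = fun y => ‖x‖ ^ (-((n : ℝ) + d)) * Q e y := by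
    ext y
    rw [← hQ R, ← hS _ hx', ← hx1]
    rfl
  rw [this]
  exact hI.const_mul _

/-- The average of a function over the unit sphere. -/
def sphAvg (N : Euc n → ℝ) : ℝ :=
  (∫ x : sphere (0 : Euc n) 1, N x ∂(volume : Measure (Euc n)).toSphere) /
    (volume : Measure (Euc n)).toSphere.real univ

lemma integral_homogeneous_mul_radial {N : Euc n → ℝ}
    (hN : ∀ t : ℝ, 0 < t → ∀ x, N (t • x) = N x) (hn : 0 < n) (f : ℝ → ℝ) :
    ∫ x, N x * f ‖x‖ = sphAvg N * ∫ x : Euc n, f ‖x‖ := by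
  have : Nonempty (Fin n) := ⟨⟨0, hn⟩⟩
  have : Nontrivial (Euc n) := inferInstance
  have key : ∀ M : Euc n → ℝ, (∀ t : ℝ, 0 < t → ∀ x, M (t • x) = M x) →
      ∫ x, M x * f ‖x‖ = (∫ x : sphere (0 : Euc n) 1, M x ∂(volume : Measure (Euc n)).toSphere) *
        ∫ r : Ioi (0 : ℝ), f r ∂(Measure.volumeIoiPow (Module.finrank ℝ (Euc n) - 1)) := by
    intro M hM
    have h0 : ∫ x, M x * f ‖x‖ =
        ∫ x : ({(0 : Euc n)}ᶜ : Set (Euc n)), M (x : Euc n) * f ‖(x : Euc n)‖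
          ∂(Measure.comap Subtype.val volume) := by
      rw [integral_subtype_comap (measurableSet_singleton _).compl
        (fun x : Euc n => M x * f ‖x‖), restrict_compl_singleton]
    have h1 := (volume : Measure (Euc n)).measurePreserving_homeomorphUnitSphereProd.integral_comp
      (Homeomorph.measurableEmbedding _)
      (fun z : sphere (0 : Euc n) 1 × Ioi (0 : ℝ) => M (z.1 : Euc n) * f z.2)
    rw [integral_prod_mul (fun z : sphere (0 : Euc n) 1 => M z) (fun r : Ioi (0 : ℝ) => f r)] at h1
    rw [h0, ← h1]
    congr 1
    ext x
    have hx : 0 < ‖(x : Euc n)‖ := norm_pos_iff.2 x.2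
    simp [hM _ (inv_pos.2 hx)]
  have hσ : (volume : Measure (Euc n)).toSphere.real univ ≠ 0 := by
    rw [Measure.toSphere_real_apply_univ]
    have : 0 < (volume : Measure (Euc n)).real (ball 0 1) :=
      ENNReal.toReal_pos (measure_ball_pos _ _ one_pos).ne' measure_ball_lt_top.ne
    simp [this.ne', hn.ne']
  have h1 := key N hN
  have h2 := key (fun _ => 1) (fun _ _ _ => rfl)
  simp only [one_mul, integral_const, smul_eq_mul, mul_one] at h2
  rw [h1, h2, sphAvg]
  field_simp

lemma integral_prod_homogeneous_mul {N : Euc n → ℝ} (hN : ∀ t : ℝ, 0 < t → ∀ x, N (t • x) = N x)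
    (hNm : Measurable N) {C : ℝ} (hNC : ∀ x, ‖N x‖ ≤ C) (hn : 0 < n)
    {Q : Euc n → Euc n → ℝ} (hQ : ∀ (R : Euc n ≃ₗᵢ[ℝ] Euc n) x y, Q (R x) (R y) = Q x y)
    (hI : Integrable fun z : Euc n × Euc n => Q z.1 z.2) :
    ∫ z : Euc n × Euc n, N z.1 * Q z.1 z.2 = sphAvg N * ∫ z : Euc n × Euc n, Q z.1 z.2 := by
  have hI2 : Integrable fun z : Euc n × Euc n => N z.1 * Q z.1 z.2 :=
    hI.bdd_mul (hNm.comp measurable_fst).aestronglyMeasurable (Eventually.of_forall fun z => hNC z.1)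
  obtain ⟨e, he⟩ : ∃ e : Euc n, ‖e‖ = 1 := ⟨EuclideanSpace.single ⟨0, hn⟩ 1, by simp⟩
  have hrad : ∀ x, ∫ y, Q x y = (fun r : ℝ => ∫ y, Q (r • e) y) ‖x‖ := by
    intro x
    obtain ⟨R, hR⟩ := exists_linearIsometryEquiv_map_eq (x := ‖x‖ • e) (y := x) (by
      rw [norm_smul, he, norm_norm, mul_one])
    change _ = ∫ y, Q (‖x‖ • e) y
    rw [← integral_rot hQ R (‖x‖ • e), hR]
  rw [Measure.volume_eq_prod, integral_prod _ hI2, integral_prod _ hI]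
  have h1 : ∀ x, ∫ y, N x * Q x y = N x * (fun r : ℝ => ∫ y, Q (r • e) y) ‖x‖ := fun x => by
    rw [integral_const_mul, hrad]
  rw [integral_congr_ae (Eventually.of_forall h1), integral_congr_ae (Eventually.of_forall hrad)]
  exact integral_homogeneous_mul_radial hN hn (fun r : ℝ => ∫ y, Q (r • e) y)

lemma integral_prod_swap_homogeneous_mul {N : Euc n → ℝ}
    (hN : ∀ t : ℝ, 0 < t → ∀ x, N (t • x) = N x)
    (hNm : Measurable N) {C : ℝ} (hNC : ∀ x, ‖N x‖ ≤ C) (hn : 0 < n)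
    {Q : Euc n → Euc n → ℝ} (hQ : ∀ (R : Euc n ≃ₗᵢ[ℝ] Euc n) x y, Q (R x) (R y) = Q x y)
    (hI : Integrable fun z : Euc n × Euc n => Q z.1 z.2) :
    ∫ z : Euc n × Euc n, N z.2 * Q z.1 z.2 = sphAvg N * ∫ z : Euc n × Euc n, Q z.1 z.2 := by
  have h := integral_prod_homogeneous_mul hN hNm hNC hn (Q := fun x y => Q y x)
    (fun R x y => hQ R y x) (Integrable.swap hI)
  rw [Measure.volume_eq_prod] at h ⊢
  rw [← integral_prod_swap (fun z : Euc n × Euc n => N z.2 * Q z.1 z.2),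
    ← integral_prod_swap (fun z : Euc n × Euc n => Q z.1 z.2)]
  exact h

end Symmetry

section Integrability

variable {n : ℕ} {s : ℝ}

lemma integrable_radial (hn : 0 < n) {f : ℝ → ℝ} (hf : Measurable f) {C p₁ p₂ : ℝ}
    (h₁ : -(n : ℝ) < p₁) (h₂ : p₂ < -(n : ℝ)) (b₁ : ∀ r, 0 < r → r ≤ 1 → |f r| ≤ C * r ^ p₁)
    (b₂ : ∀ r, 1 < r → |f r| ≤ C * r ^ p₂) : Integrable fun x : Euc n => f ‖x‖ := by
  have : Nonempty (Fin n) := ⟨⟨0, hn⟩⟩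
  have : Nontrivial (Euc n) := inferInstance
  rw [integrable_fun_norm_addHaar (volume : Measure (Euc n)) (f := f), finrank_euclideanSpace_fin]
  have hpow : ∀ r : ℝ, 0 < r → r ^ (n - 1) = r ^ ((n : ℝ) - 1) := by
    intro r hr
    rw [← Real.rpow_natCast, Nat.cast_sub (by omega), Nat.cast_one]
  rw [← Ioc_union_Ioi_eq_Ioi (zero_le_one' ℝ)]
  refine IntegrableOn.union ?_ ?_
  · have hi : IntegrableOn (fun r : ℝ => C * r ^ ((n : ℝ) - 1 + p₁)) (Ioc 0 1) := by
      refine Integrable.const_mul ?_ _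
      have := intervalIntegral.intervalIntegrable_rpow' (a := 0) (b := 1)
        (r := (n : ℝ) - 1 + p₁) (by linarith)
      rwa [intervalIntegrable_iff_integrableOn_Ioc_of_le zero_le_one] at this
    refine Integrable.mono' hi (by fun_prop) ?_
    refine (ae_restrict_iff' measurableSet_Ioc).2 (Eventually.of_forall fun r hr => ?_)
    rw [smul_eq_mul, hpow r hr.1, norm_mul, Real.norm_of_nonneg (Real.rpow_nonneg hr.1.le _),
      Real.rpow_add hr.1, Real.norm_eq_abs]
    have := mul_le_mul_of_nonneg_left (b₁ r hr.1 hr.2) (Real.rpow_nonneg hr.1.le ((n : ℝ) - 1))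
    linarith
  · have hi : IntegrableOn (fun r : ℝ => C * r ^ ((n : ℝ) - 1 + p₂)) (Ioi 1) :=
      Integrable.const_mul (integrableOn_Ioi_rpow_of_lt (by linarith) one_pos) _
    refine Integrable.mono' hi (by fun_prop) ?_
    refine (ae_restrict_iff' measurableSet_Ioi).2 (Eventually.of_forall fun r hr => ?_)
    have hr0 : 0 < r := one_pos.trans hr
    rw [smul_eq_mul, hpow r hr0, norm_mul, Real.norm_of_nonneg (Real.rpow_nonneg hr0.le _),
      Real.rpow_add hr0, Real.norm_eq_abs]
    have := mul_le_mul_of_nonneg_left (b₂ r hr) (Real.rpow_nonneg hr0.le ((n : ℝ) - 1))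
    linarith

/-- The truncated Lévy kernel `min(|z|², 1) |z|^{-(n+2s)}`. -/
def levy (n : ℕ) (s : ℝ) (z : Euc n) : ℝ := min (‖z‖ ^ 2) 1 / ‖z‖ ^ ((n : ℝ) + 2 * s)

lemma levy_nonneg (z : Euc n) : 0 ≤ levy n s z := by unfold levy; positivity

lemma integrable_levy (hn : 0 < n) (hs0 : 0 < s) (hs1 : s < 1) : Integrable (levy n s) := by
  refine integrable_radial hn (f := fun r => min (r ^ 2) 1 / r ^ ((n : ℝ) + 2 * s)) (by fun_prop)
    (C := 1) (p₁ := 2 - (n + 2 * s)) (p₂ := -(n + 2 * s)) (by linarith) (by linarith) ?_ ?_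
  · intro r hr hr1
    rw [abs_of_nonneg (by positivity), one_mul, Real.rpow_sub hr, Real.rpow_two]
    gcongr
    exact min_le_left _ _
  · intro r hr
    have hr0 : 0 < r := one_pos.trans hr
    rw [abs_of_nonneg (by positivity), one_mul, Real.rpow_neg hr0.le, ← one_div]
    gcongr
    exact min_le_right _ _

/-- A weight with an integrable singularity at the origin and decay at infinity. -/
def decay (n : ℕ) (s a : ℝ) (y : Euc n) : ℝ := ‖y‖ ^ (-a) * (1 + ‖y‖) ^ (-((n : ℝ) + 2 * s))

lemma decay_nonneg (a : ℝ) (y : Euc n) : 0 ≤ decay n s a y := by unfold decay; positivity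

lemma integrable_decay (hn : 0 < n) (hs0 : 0 < s) {a : ℝ} (ha : -(2 * s) < a) (han : a < n) :
    Integrable (decay n s a) := by
  have hq : 0 ≤ (n : ℝ) + 2 * s := by positivity
  refine integrable_radial hn
    (f := fun r => r ^ (-a) * (1 + r) ^ (-((n : ℝ) + 2 * s))) (by fun_prop)
    (C := 1) (p₁ := -a) (p₂ := -(n + 2 * s) - a) (by linarith) (by linarith) ?_ ?_
  · intro r hr hr1
    rw [abs_of_nonneg (by positivity), one_mul]
    refine mul_le_of_le_one_right (by positivity) ?_
    exact Real.rpow_le_one_of_one_le_of_nonpos (by linarith) (by linarith)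
  · intro r hr
    have hr0 : 0 < r := one_pos.trans hr
    rw [abs_of_nonneg (by positivity), one_mul, sub_eq_neg_add, Real.rpow_add hr0]
    gcongr ?_ * ?_
    exact Real.rpow_le_rpow_of_nonpos hr0 (by linarith) (by linarith)

/-- Functions which are `C¹` away from the origin and `O(|x|^{-a})`. -/
structure Tame (a : ℝ) (v : Euc n → ℝ) : Prop where
  smooth : ContDiffOn ℝ 1 v {(0 : Euc n)}ᶜ
  bound : ∃ C, ∀ x, |v x| ≤ C * ‖x‖ ^ (-a)

/-- `C¹` functions with compact support in the complement of the origin. -/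
structure IsTest (φ : Euc n → ℝ) : Prop where
  smooth : ContDiff ℝ 1 φ
  compact : HasCompactSupport φ
  supp : tsupport φ ⊆ {(0 : Euc n)}ᶜ

lemma measurable_of_continuousOn_compl {v : Euc n → ℝ} (h : ContinuousOn v {(0 : Euc n)}ᶜ) :
    Measurable v := by
  refine measurable_of_restrict_of_restrict_compl (measurableSet_singleton (0 : Euc n))
    ?_ ?_
  · exact (Set.subsingleton_coe _ |>.2 subsingleton_singleton).measurable
  · exact (continuousOn_iff_continuous_domRestrict.1 h).measurable

lemma Tame.measurable {a : ℝ} {v : Euc n → ℝ} (hv : Tame a v) : Measurable v :=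
  measurable_of_continuousOn_compl hv.smooth.continuousOn

lemma IsTest.exists_annulus {φ : Euc n → ℝ} (hφ : IsTest φ) :
    ∃ r b : ℝ, 0 < r ∧ ∀ x, φ x ≠ 0 → r ≤ ‖x‖ ∧ ‖x‖ ≤ b := by
  obtain ⟨b, hb⟩ := hφ.compact.isCompact.isBounded.exists_norm_le
  have h0 : (tsupport φ)ᶜ ∈ nhds (0 : Euc n) :=
    (isClosed_tsupport φ).isOpen_compl.mem_nhds fun h => hφ.supp h rfl
  obtain ⟨r, hr, hr'⟩ := Metric.mem_nhds_iff.1 h0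
  refine ⟨r, b, hr, fun x hx => ⟨?_, hb x (subset_tsupport _ hx)⟩⟩
  by_contra! h
  exact hr' (by simpa using h) (subset_tsupport _ hx)

lemma IsTest.exists_lip {φ : Euc n → ℝ} (hφ : IsTest φ) :
    ∃ C, 0 ≤ C ∧ ∀ x y, |φ x - φ y| ≤ C * min ‖x - y‖ 1 := by
  obtain ⟨L, hL⟩ := hφ.smooth.lipschitzWith_of_hasCompactSupport hφ.compact one_ne_zero
  obtain ⟨M, hM⟩ := hφ.compact.exists_bound_of_continuous hφ.smooth.continuous
  have hM0 : 0 ≤ M := (norm_nonneg _).trans (hM 0)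
  refine ⟨L + 2 * M, by positivity, fun x y => ?_⟩
  rcases le_total ‖x - y‖ 1 with h | h
  · rw [min_eq_left h]
    have := hL.dist_le_mul x y
    rw [Real.dist_eq, dist_eq_norm] at this
    nlinarith [norm_nonneg (x - y)]
  · rw [min_eq_right h]
    have h1 := hM x
    have h2 := hM y
    rw [Real.norm_eq_abs] at h1 h2
    have h3 := abs_sub (φ x) (φ y)
    have := L.2
    have h4 : (0 : ℝ) ≤ L := L.2
    linarith

lemma IsTest.tame {φ : Euc n → ℝ} (hφ : IsTest φ) : Tame 0 φ := by
  obtain ⟨M, hM⟩ := hφ.compact.exists_bound_of_continuous hφ.smooth.continuous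
  exact ⟨hφ.smooth.contDiffOn, M, fun x => by simpa using hM x⟩

lemma isCompact_annulus (r b : ℝ) : IsCompact {x : Euc n | r ≤ ‖x‖ ∧ ‖x‖ ≤ b} := by
  refine (isCompact_closedBall (0 : Euc n) b).of_isClosed_subset ?_ fun x hx => by simpa using hx.2
  exact (isClosed_le continuous_const continuous_norm).inter
    (isClosed_le continuous_norm continuous_const)

lemma exists_locally_lipschitz {F : Type*} [NormedAddCommGroup F] [NormedSpace ℝ F]
    {v : Euc n → F} (hv : ContDiffOn ℝ 1 v {(0 : Euc n)}ᶜ) {r : ℝ} (hr : 0 < r) (b : ℝ) :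
    ∃ C, 0 ≤ C ∧ ∀ x, r ≤ ‖x‖ → ‖x‖ ≤ b → ∀ y z, ‖x - y‖ ≤ r / 2 → ‖x - z‖ ≤ r / 2 →
      ‖v y - v z‖ ≤ C * ‖y - z‖ := by
  have hopen : IsOpen ({(0 : Euc n)}ᶜ : Set (Euc n)) := isOpen_compl_singleton
  have hsub : {x : Euc n | r / 2 ≤ ‖x‖ ∧ ‖x‖ ≤ b + r / 2} ⊆ {(0 : Euc n)}ᶜ := by
    rintro x ⟨h1, -⟩ h0
    rw [mem_singleton_iff] at h0
    rw [h0, norm_zero] at h1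
    linarith
  obtain ⟨C, hC⟩ := (isCompact_annulus (n := n) (r / 2) (b + r / 2)).exists_bound_of_continuousOn
    ((hv.continuousOn_fderiv_of_isOpen hopen le_rfl).mono hsub)
  refine ⟨max C 0, le_max_right _ _, fun x hx hxb y z hy hz => ?_⟩
  have hmem : ∀ y ∈ closedBall x (r / 2), y ∈ {x : Euc n | r / 2 ≤ ‖x‖ ∧ ‖x‖ ≤ b + r / 2} := by
    intro y hy
    rw [mem_closedBall, dist_comm, dist_eq_norm] at hy
    have h1 := norm_sub_norm_le x y
    have h2 := norm_sub_norm_le y x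
    rw [norm_sub_rev y x] at h2
    exact ⟨by linarith, by linarith⟩
  refine (convex_closedBall x (r / 2)).norm_image_sub_le_of_norm_fderiv_le (𝕜 := ℝ) (f := v)
    (fun y hy => ?_) (fun y hy => (hC y (hmem y hy)).trans (le_max_left _ _)) ?_ ?_
  · exact (hv.differentiableOn one_ne_zero).differentiableAt (hopen.mem_nhds (hsub (hmem y hy)))
  · rwa [mem_closedBall, dist_comm, dist_eq_norm]
  · rwa [mem_closedBall, dist_comm, dist_eq_norm]

lemma exists_kern_le_decay (hs0 : 0 < s) {r : ℝ} (hr : 0 < r) (b : ℝ) :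
    ∃ C, 0 ≤ C ∧ ∀ x y : Euc n, ‖x‖ ≤ b → r ≤ ‖x - y‖ →
      kern n s x y ≤ C * (1 + ‖y‖) ^ (-((n : ℝ) + 2 * s)) := by
  set κ := (1 + |b|) / r + 1 with hκ
  have hκ0 : 0 < κ := by positivity
  refine ⟨κ ^ ((n : ℝ) + 2 * s), by positivity, fun x y hx hxy => ?_⟩
  have h1 : 1 + ‖y‖ ≤ κ * ‖x - y‖ := by
    have h2 := norm_sub_norm_le y x
    rw [norm_sub_rev y x] at h2
    have h3 : (1 + |b|) ≤ (1 + |b|) / r * ‖x - y‖ := by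
      rw [div_mul_eq_mul_div, le_div_iff₀ hr]
      gcongr
    have := le_abs_self b
    rw [hκ, add_mul]
    linarith
  have hy : 0 < 1 + ‖y‖ := by positivity
  have h2 : (1 + ‖y‖) / κ ≤ ‖x - y‖ := by rw [div_le_iff₀ hκ0]; linarith
  refine (kern_le (by positivity) h2 hs0).trans (le_of_eq ?_)
  rw [Real.div_rpow hy.le hκ0.le, Real.rpow_neg hκ0.le, div_inv_eq_mul, mul_comm]

lemma Tame.exists_majorant {a : ℝ} (hs0 : 0 < s) {v : Euc n → ℝ} (hv : Tame a v)
    {r : ℝ} (hr : 0 < r) (b : ℝ) :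
    ∃ C, 0 ≤ C ∧ ∀ x, r ≤ ‖x‖ → ‖x‖ ≤ b → ∀ y,
      |v x - v y| * min ‖x - y‖ 1 * kern n s x y ≤
        C * (levy n s (x - y) + decay n s a y + decay n s 0 y) := by
  obtain ⟨L, hL0, hL⟩ := exists_locally_lipschitz hv.smooth hr b
  obtain ⟨K, hK0, hK⟩ := exists_kern_le_decay (n := n) hs0 (half_pos hr) b
  obtain ⟨M, hM⟩ := hv.bound
  obtain ⟨V, hV⟩ : ∃ V, ∀ x, r ≤ ‖x‖ → ‖x‖ ≤ b → |v x| ≤ V := by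
    obtain ⟨V, hV⟩ := (isCompact_annulus (n := n) r b).exists_bound_of_continuousOn
      (hv.smooth.continuousOn.mono (by
        rintro x ⟨h1, -⟩ h0
        rw [mem_singleton_iff] at h0
        rw [h0, norm_zero] at h1
        linarith))
    exact ⟨V, fun x h1 h2 => hV x ⟨h1, h2⟩⟩
  refine ⟨L * (1 + r) + |V| * K + |M| * K, by positivity, fun x hx hxb y => ?_⟩
  have l0 := levy_nonneg (s := s) (x - y)
  have d0 := decay_nonneg (s := s) a y
  have d00 := decay_nonneg (s := s) 0 y
  have k0 := kern_nonneg (s := s) x y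
  rcases le_total ‖x - y‖ (r / 2) with h | h
  · have h1 := hL x hx hxb x y (by simp; linarith) h
    rw [Real.norm_eq_abs] at h1
    have h2 : ‖x - y‖ * min ‖x - y‖ 1 ≤ (1 + r) * min (‖x - y‖ ^ 2) 1 := by
      rcases le_total ‖x - y‖ 1 with h' | h'
      · rw [min_eq_left h', min_eq_left (by nlinarith [norm_nonneg (x - y)])]
        nlinarith [norm_nonneg (x - y), sq_nonneg ‖x - y‖]
      · rw [min_eq_right h', min_eq_right (by nlinarith [norm_nonneg (x - y)])]
        linarith
    have hm : (0 : ℝ) ≤ min ‖x - y‖ 1 := by positivity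
    calc |v x - v y| * min ‖x - y‖ 1 * kern n s x y
        ≤ L * ‖x - y‖ * min ‖x - y‖ 1 * kern n s x y := by gcongr
      _ = L * (‖x - y‖ * min ‖x - y‖ 1) * kern n s x y := by ring
      _ ≤ L * ((1 + r) * min (‖x - y‖ ^ 2) 1) * kern n s x y := by gcongr
      _ = L * (1 + r) * levy n s (x - y) := by unfold levy kern; ring
      _ ≤ (L * (1 + r) + |V| * K + |M| * K) * (levy n s (x - y)) := by
          gcongr
          nlinarith [abs_nonneg V, abs_nonneg M, mul_nonneg (abs_nonneg V) hK0,
            mul_nonneg (abs_nonneg M) hK0]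
      _ ≤ _ := by gcongr; linarith
  · have h1 : |v x - v y| ≤ |V| + |M| * ‖y‖ ^ (-a) := by
      have e1 := (hV x hx hxb).trans (le_abs_self V)
      have e2 : |v y| ≤ |M| * ‖y‖ ^ (-a) := (hM y).trans (by gcongr; exact le_abs_self M)
      exact (abs_sub _ _).trans (add_le_add e1 e2)
    have h2 := hK x y hxb h
    have hd : decay n s 0 y = (1 + ‖y‖) ^ (-((n : ℝ) + 2 * s)) := by simp [decay]
    calc |v x - v y| * min ‖x - y‖ 1 * kern n s x y
        ≤ (|V| + |M| * ‖y‖ ^ (-a)) * 1 * (K * (1 + ‖y‖) ^ (-((n : ℝ) + 2 * s))) := by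
          gcongr
          exact min_le_right _ _
      _ = |V| * K * decay n s 0 y + |M| * K * decay n s a y := by rw [hd, decay]; ring
      _ ≤ _ := by
          have := mul_nonneg (abs_nonneg V) hK0
          have := mul_nonneg (abs_nonneg M) hK0
          have : 0 ≤ L * (1 + r) := by positivity
          nlinarith [mul_nonneg (abs_nonneg V) hK0, mul_nonneg (abs_nonneg M) hK0,
            mul_nonneg (mul_nonneg (abs_nonneg V) hK0) l0,
            mul_nonneg (mul_nonneg (abs_nonneg V) hK0) d0,
            mul_nonneg (mul_nonneg (abs_nonneg M) hK0) l0,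
            mul_nonneg (mul_nonneg (abs_nonneg M) hK0) d00,
            mul_nonneg this l0, mul_nonneg this d0, mul_nonneg this d00]

/-- The integrable majorant supported over an annulus in the first variable. -/
def annMajorant (n : ℕ) (s a r b : ℝ) (x y : Euc n) : ℝ :=
  indicator {x : Euc n | r ≤ ‖x‖ ∧ ‖x‖ ≤ b} 1 x *
    (levy n s (x - y) + decay n s a y + decay n s 0 y)

lemma annMajorant_nonneg (a r b : ℝ) (x y : Euc n) : 0 ≤ annMajorant n s a r b x y := by
  unfold annMajorant
  have l0 := levy_nonneg (s := s) (x - y)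
  have d0 := decay_nonneg (s := s) a y
  have d00 := decay_nonneg (s := s) 0 y
  exact mul_nonneg (indicator_nonneg (fun _ _ => zero_le_one) _) (by positivity)

lemma integrable_indicator_annulus (r b : ℝ) :
    Integrable (indicator {x : Euc n | r ≤ ‖x‖ ∧ ‖x‖ ≤ b} (1 : Euc n → ℝ)) :=
  (integrable_indicator_iff (isCompact_annulus r b).measurableSet).2
    (integrableOn_const (isCompact_annulus r b).measure_lt_top.ne)

lemma integrable_annMajorant (hn : 0 < n) (hs0 : 0 < s) (hs1 : s < 1) {a : ℝ} (ha : 0 ≤ a)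
    (han : a < n) (r b : ℝ) :
    Integrable fun z : Euc n × Euc n => annMajorant n s a r b z.1 z.2 := by
  have hA := integrable_indicator_annulus (n := n) r b
  have h1 := (hA.convolution_integrand (ContinuousLinearMap.mul ℝ ℝ)
    (integrable_levy hn hs0 hs1)).swap
  have h2 := hA.mul_prod (integrable_decay (s := s) hn hs0 (a := a) (by linarith) han)
  have h3 := hA.mul_prod (integrable_decay (s := s) hn hs0 (a := 0) (by linarith)
    (by exact_mod_cast hn))
  refine ((h1.add h2).add h3).congr (Eventually.of_forall fun z => ?_)
  have : levy n s (z.2 - z.1) = levy n s (z.1 - z.2) := by unfold levy; rw [norm_sub_rev]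
  simp only [annMajorant, Pi.add_apply, Function.comp, Prod.swap, ContinuousLinearMap.mul_apply',
    this]
  ring

lemma Tame.integrable_form (hn : 0 < n) (hs0 : 0 < s) (hs1 : s < 1) {a : ℝ} (ha : 0 ≤ a)
    (han : a < n) {v φ : Euc n → ℝ} (hv : Tame a v) (hφ : IsTest φ) :
    Integrable fun z : Euc n × Euc n =>
      (v z.1 - v z.2) * (φ z.1 - φ z.2) * kern n s z.1 z.2 := by
  obtain ⟨r, b, hr, hrb⟩ := hφ.exists_annulus
  obtain ⟨L, hL0, hL⟩ := hφ.exists_lip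
  obtain ⟨C, hC0, hC⟩ := hv.exists_majorant hs0 hr b
  have hG := integrable_annMajorant hn hs0 hs1 ha han r b
  have hG' : Integrable fun z : Euc n × Euc n => annMajorant n s a r b z.2 z.1 := hG.swap
  have hvm := hv.measurable
  have hφm := hφ.smooth.continuous.measurable
  refine Integrable.mono' ((hG.add hG').const_mul (L * C)) (Measurable.aestronglyMeasurable ?_)
    (Eventually.of_forall fun z => ?_)
  · exact (((hvm.comp measurable_fst).sub (hvm.comp measurable_snd)).mul
      ((hφm.comp measurable_fst).sub (hφm.comp measurable_snd))).mul measurable_kern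
  · have key : ∀ x y : Euc n, φ x ≠ 0 →
        |v x - v y| * |φ x - φ y| * kern n s x y ≤ L * C * annMajorant n s a r b x y := by
      intro x y hx
      obtain ⟨h1, h2⟩ := hrb x hx
      have h3 := hC x h1 h2 y
      have hmem : x ∈ {x : Euc n | r ≤ ‖x‖ ∧ ‖x‖ ≤ b} := ⟨h1, h2⟩
      rw [annMajorant, indicator_of_mem hmem, Pi.one_apply, one_mul]
      calc |v x - v y| * |φ x - φ y| * kern n s x y
          ≤ |v x - v y| * (L * min ‖x - y‖ 1) * kern n s x y := by
            gcongr
            · exact kern_nonneg _ _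
            · exact hL x y
        _ = L * (|v x - v y| * min ‖x - y‖ 1 * kern n s x y) := by ring
        _ ≤ L * (C * (levy n s (x - y) + decay n s a y + decay n s 0 y)) := by gcongr
        _ = _ := by ring
    rw [norm_mul, norm_mul, Real.norm_eq_abs, Real.norm_eq_abs,
      Real.norm_of_nonneg (kern_nonneg _ _)]
    simp only [Pi.add_apply, mul_add]
    have p1 := mul_nonneg (mul_nonneg hL0 hC0) (annMajorant_nonneg (s := s) a r b z.1 z.2)
    have p2 := mul_nonneg (mul_nonneg hL0 hC0) (annMajorant_nonneg (s := s) a r b z.2 z.1)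
    by_cases h1 : φ z.1 = 0
    · by_cases h2 : φ z.2 = 0
      · simp only [h1, h2, sub_self, abs_zero, mul_zero, zero_mul]
        positivity
      · have := key z.2 z.1 h2
        rw [abs_sub_comm (v z.2), abs_sub_comm (φ z.2), kern_symm] at this
        linarith
    · have := key z.1 z.2 h1
      linarith

end Integrability

section Cone

variable {n : ℕ} {s : ℝ}

/-- The indicator of the pairs of points whose norms are in ratio at most `l`. -/
def sepInd (n : ℕ) (l : ℝ) (x y : Euc n) : ℝ :=
  indicator {z : Euc n × Euc n | ‖z.2‖ ≤ l * ‖z.1‖ ∨ ‖z.1‖ ≤ l * ‖z.2‖} 1 (x, y)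

lemma measurableSet_sep (l : ℝ) :
    MeasurableSet {z : Euc n × Euc n | ‖z.2‖ ≤ l * ‖z.1‖ ∨ ‖z.1‖ ≤ l * ‖z.2‖} :=
  MeasurableSet.union
    (s₁ := {z : Euc n × Euc n | ‖z.2‖ ≤ l * ‖z.1‖}) (s₂ := {z : Euc n × Euc n | ‖z.1‖ ≤ l * ‖z.2‖})
    (measurableSet_le (by fun_prop) (by fun_prop)) (measurableSet_le (by fun_prop) (by fun_prop))

lemma measurable_sepInd (l : ℝ) : Measurable fun z : Euc n × Euc n => sepInd n l z.1 z.2 :=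
  measurable_one.indicator (measurableSet_sep l)

lemma sepInd_of {l : ℝ} {x y : Euc n} (h : ‖y‖ ≤ l * ‖x‖ ∨ ‖x‖ ≤ l * ‖y‖) :
    sepInd n l x y = 1 := indicator_of_mem (s := {z : Euc n × Euc n |
      ‖z.2‖ ≤ l * ‖z.1‖ ∨ ‖z.1‖ ≤ l * ‖z.2‖}) (a := (x, y)) h _

lemma sepInd_of_not {l : ℝ} {x y : Euc n} (h : ¬(‖y‖ ≤ l * ‖x‖ ∨ ‖x‖ ≤ l * ‖y‖)) :
    sepInd n l x y = 0 := indicator_of_notMem (s := {z : Euc n × Euc n |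
      ‖z.2‖ ≤ l * ‖z.1‖ ∨ ‖z.1‖ ≤ l * ‖z.2‖}) (a := (x, y)) h _

lemma sepInd_congr {l : ℝ} {x y x' y' : Euc n}
    (h : (‖y‖ ≤ l * ‖x‖ ∨ ‖x‖ ≤ l * ‖y‖) ↔ (‖y'‖ ≤ l * ‖x'‖ ∨ ‖x'‖ ≤ l * ‖y'‖)) :
    sepInd n l x y = sepInd n l x' y' := by
  by_cases h' : ‖y‖ ≤ l * ‖x‖ ∨ ‖x‖ ≤ l * ‖y‖
  · rw [sepInd_of h', sepInd_of (h.1 h')]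
  · rw [sepInd_of_not h', sepInd_of_not (fun h'' => h' (h.2 h''))]

lemma sepInd_nonneg (l : ℝ) (x y : Euc n) : 0 ≤ sepInd n l x y :=
  indicator_nonneg (fun _ _ => zero_le_one) _

lemma sepInd_le_one (l : ℝ) (x y : Euc n) : sepInd n l x y ≤ 1 :=
  indicator_le' (fun _ _ => le_rfl) (fun _ _ => zero_le_one) _

lemma sepInd_symm (l : ℝ) (x y : Euc n) : sepInd n l x y = sepInd n l y x :=
  sepInd_congr or_comm

/-- The kernel restricted to separated pairs. -/
def sepKern (n : ℕ) (s l : ℝ) (x y : Euc n) : ℝ := sepInd n l x y * kern n s x y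

lemma sepKern_nonneg (l : ℝ) (x y : Euc n) : 0 ≤ sepKern n s l x y :=
  mul_nonneg (sepInd_nonneg _ _ _) (kern_nonneg _ _)

lemma sepKern_symm (l : ℝ) (x y : Euc n) : sepKern n s l x y = sepKern n s l y x := by
  unfold sepKern; rw [sepInd_symm, kern_symm]

lemma measurable_sepKern (l : ℝ) : Measurable fun z : Euc n × Euc n => sepKern n s l z.1 z.2 :=
  (measurable_sepInd l).mul measurable_kern

lemma sepKern_rot (l : ℝ) (R : Euc n ≃ₗᵢ[ℝ] Euc n) (x y : Euc n) :
    sepKern n s l (R x) (R y) = sepKern n s l x y := by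
  unfold sepKern
  rw [kern_rot, sepInd_congr (x' := x) (y' := y) (by simp only [R.norm_map])]

lemma sepKern_smul (l : ℝ) {t : ℝ} (ht : 0 < t) (x y : Euc n) :
    sepKern n s l (t • x) (t • y) = t ^ (-((n : ℝ) + 2 * s)) * sepKern n s l x y := by
  unfold sepKern
  rw [kern_smul ht, sepInd_congr (x' := x) (y' := y), mul_left_comm]
  rw [norm_smul, norm_smul, Real.norm_of_nonneg ht.le, mul_left_comm, mul_left_comm l t,
    mul_le_mul_iff_right₀ ht, mul_le_mul_iff_right₀ ht]

lemma norm_mul_rpow_smul {a d : ℝ} {t : ℝ} (ht : 0 < t) (y : Euc n) {k k' : ℝ}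
    (hk : k' = t ^ (-((n : ℝ) + d)) * k) :
    ‖t • y‖ ^ (-a) * k' = t ^ (-((n : ℝ) + (d + a))) * (‖y‖ ^ (-a) * k) := by
  rw [hk, norm_smul, Real.norm_of_nonneg ht.le, Real.mul_rpow ht.le (norm_nonneg _),
    show -((n : ℝ) + (d + a)) = -a + -((n : ℝ) + d) by ring, Real.rpow_add ht]
  ring

lemma exists_sepKern_le (hs0 : 0 < s) {l : ℝ} (hl0 : 0 < l) (hl : l < 1) {e : Euc n}
    (he : ‖e‖ = 1) :
    ∃ C, 0 ≤ C ∧ ∀ y, sepKern n s l e y ≤ C * (1 + ‖y‖) ^ (-((n : ℝ) + 2 * s)) := by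
  obtain ⟨C, hC0, hC⟩ := exists_kern_le_decay (n := n) hs0 (r := 1 - l) (by linarith) 1
  refine ⟨C, hC0, fun y => ?_⟩
  by_cases h : ‖y‖ ≤ l * ‖e‖ ∨ ‖e‖ ≤ l * ‖y‖
  · rw [sepKern, sepInd_of h, one_mul]
    refine hC e y he.le ?_
    rw [he] at h
    rcases h with h | h
    · have := norm_sub_norm_le e y
      rw [he] at this
      linarith
    · have := norm_sub_norm_le y e
      rw [he, norm_sub_rev] at this
      have : 1 ≤ ‖y‖ := by nlinarith [norm_nonneg y]
      nlinarith
  · rw [sepKern, sepInd_of_not h, zero_mul]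
    positivity

lemma integrable_sepKern_weight (hn : 0 < n) (hs0 : 0 < s) {l : ℝ} (hl0 : 0 < l) (hl : l < 1)
    {e : Euc n} (he : ‖e‖ = 1) {a : ℝ} (ha : 0 ≤ a) (han : a < n) :
    Integrable fun y => ‖y‖ ^ (-a) * sepKern n s l e y := by
  obtain ⟨C, hC0, hC⟩ := exists_sepKern_le (n := n) hs0 hl0 hl he
  have hm : Measurable fun y => sepKern n s l e y := by
    have h2 := (measurable_sepKern (n := n) (s := s) l).comp
      (g := fun z : Euc n × Euc n => sepKern n s l z.1 z.2) (measurable_prodMk_left (x := e))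
    simpa only [Function.comp_def] using h2
  have hi : Integrable fun y => C * decay n s a y :=
    (integrable_decay (s := s) hn hs0 (a := a) (by linarith) han).const_mul C
  have hm2 : AEStronglyMeasurable (fun y : Euc n => ‖y‖ ^ (-a) * sepKern n s l e y) volume :=
    ((measurable_norm.pow_const (-a)).mul hm).aestronglyMeasurable
  refine hi.mono' hm2 (Eventually.of_forall fun y => ?_)
  have hy : 0 ≤ ‖y‖ ^ (-a) := Real.rpow_nonneg (norm_nonneg y) _
  rw [Real.norm_of_nonneg (mul_nonneg hy (sepKern_nonneg l e y)), decay]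
  exact (mul_le_mul_of_nonneg_left (hC y) hy).trans_eq (by ring)

lemma ae_ne_zero (hn : 0 < n) : ∀ᵐ x : Euc n, x ≠ 0 := by
  have : Nonempty (Fin n) := ⟨⟨0, hn⟩⟩
  have : Nontrivial (Euc n) := inferInstance
  exact compl_mem_ae_iff.2 (measure_singleton (0 : Euc n))

lemma integrable_mul_homogeneous (hn : 0 < n) {Q : Euc n → Euc n → ℝ} {d : ℝ}
    (hQ : ∀ (R : Euc n ≃ₗᵢ[ℝ] Euc n) x y, Q (R x) (R y) = Q x y)
    (hS : ∀ t : ℝ, 0 < t → ∀ x y, Q (t • x) (t • y) = t ^ (-((n : ℝ) + d)) * Q x y)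
    (hm : Measurable fun z : Euc n × Euc n => Q z.1 z.2) (h0 : ∀ x y, 0 ≤ Q x y)
    {e : Euc n} (he : ‖e‖ = 1) (hI : Integrable (Q e)) {h : Euc n → ℝ} (hh : Measurable h)
    (hhI : Integrable fun x => ‖x‖ ^ (-d) * h x) :
    Integrable (fun z : Euc n × Euc n => h z.1 * Q z.1 z.2) ∧
      ∫ z : Euc n × Euc n, h z.1 * Q z.1 z.2 = (∫ y, Q e y) * ∫ x, ‖x‖ ^ (-d) * h x := by
  have hmeas : Measurable fun z : Euc n × Euc n => h z.1 * Q z.1 z.2 :=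
    (hh.comp measurable_fst).mul hm
  have hprod : Integrable (fun z : Euc n × Euc n => h z.1 * Q z.1 z.2) := by
    rw [Measure.volume_eq_prod, integrable_prod_iff hmeas.aestronglyMeasurable]
    constructor
    · filter_upwards [ae_ne_zero hn] with x hx
      exact (integrable_scale hQ hS he hx hI).const_mul _
    · refine (hhI.norm.mul_const (∫ y, Q e y)).congr ?_
      filter_upwards [ae_ne_zero hn] with x hx
      simp only [norm_mul, Real.norm_of_nonneg (h0 x _), integral_const_mul]
      rw [integral_scale hQ hS he hx, Real.norm_of_nonneg (Real.rpow_nonneg (norm_nonneg x) _)]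
      ring
  refine ⟨hprod, ?_⟩
  rw [Measure.volume_eq_prod, integral_prod _ hprod, ← integral_const_mul]
  refine integral_congr_ae ?_
  filter_upwards [ae_ne_zero hn] with x hx
  rw [integral_const_mul, integral_scale hQ hS he hx]
  ring

/-- The fractional Laplacian of `|x|^{-a}` at a point `e`, computed over separated pairs. -/
def sepCoeff (n : ℕ) (s a l : ℝ) (e : Euc n) : ℝ :=
  (∫ y, sepKern n s l e y) - ∫ y, ‖y‖ ^ (-a) * sepKern n s l e y

section Coeff

variable {a l : ℝ} {e : Euc n} {h : Euc n → ℝ}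

lemma integrable_sep_fst (hn : 0 < n) (hs0 : 0 < s) (hl0 : 0 < l) (hl : l < 1)
    (he : ‖e‖ = 1) (hh : Measurable h)
    (hhI : Integrable fun x => ‖x‖ ^ (-(2 * s + a)) * h x) :
    Integrable (fun z : Euc n × Euc n => ‖z.1‖ ^ (-a) * h z.1 * sepKern n s l z.1 z.2) ∧
      ∫ z : Euc n × Euc n, ‖z.1‖ ^ (-a) * h z.1 * sepKern n s l z.1 z.2 =
        (∫ y, sepKern n s l e y) * ∫ x, ‖x‖ ^ (-(2 * s + a)) * h x := by
  have hae : (fun x => ‖x‖ ^ (-(2 * s + a)) * h x) =ᵐ[volume]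
      fun x => ‖x‖ ^ (-(2 * s)) * (‖x‖ ^ (-a) * h x) := by
    filter_upwards [ae_ne_zero hn] with x hx
    rw [← mul_assoc, ← Real.rpow_add (norm_pos_iff.2 hx)]
    congr 2
    ring
  have h1 : Integrable (sepKern n s l e) := by
    have := integrable_sepKern_weight hn hs0 hl0 hl he le_rfl (by exact_mod_cast hn)
    simpa using this
  have := integrable_mul_homogeneous hn (Q := sepKern n s l) (d := 2 * s)
    (fun R x y => sepKern_rot l R x y) (fun t ht x y => sepKern_smul l ht x y)
    (measurable_sepKern l) (fun x y => sepKern_nonneg l x y) he h1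
    (h := fun x => ‖x‖ ^ (-a) * h x) (by fun_prop) (hhI.congr hae)
  rw [integral_congr_ae hae]
  exact this

lemma integrable_sep_snd (hn : 0 < n) (hs0 : 0 < s) (hl0 : 0 < l) (hl : l < 1)
    (he : ‖e‖ = 1) (ha : 0 ≤ a) (han : a < n) (hh : Measurable h)
    (hhI : Integrable fun x => ‖x‖ ^ (-(2 * s + a)) * h x) :
    Integrable (fun z : Euc n × Euc n => h z.1 * (‖z.2‖ ^ (-a) * sepKern n s l z.1 z.2)) ∧
      ∫ z : Euc n × Euc n, h z.1 * (‖z.2‖ ^ (-a) * sepKern n s l z.1 z.2) =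
        (∫ y, ‖y‖ ^ (-a) * sepKern n s l e y) * ∫ x, ‖x‖ ^ (-(2 * s + a)) * h x := by
  refine integrable_mul_homogeneous hn (Q := fun x y => ‖y‖ ^ (-a) * sepKern n s l x y)
    (d := 2 * s + a) (fun R x y => ?_) (fun t ht x y => ?_) ?_
    (fun x y => mul_nonneg (by positivity) (sepKern_nonneg l x y)) he
    (integrable_sepKern_weight hn hs0 hl0 hl he ha han) hh hhI
  · rw [sepKern_rot, R.norm_map]
  · exact norm_mul_rpow_smul ht y (sepKern_smul l ht x y)
  · have := measurable_sepKern (n := n) (s := s) l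
    fun_prop

lemma integral_sep_form (hn : 0 < n) (hs0 : 0 < s) (hl0 : 0 < l) (hl : l < 1)
    (he : ‖e‖ = 1) (ha : 0 ≤ a) (han : a < n) (hh : Measurable h)
    (hhI : Integrable fun x => ‖x‖ ^ (-(2 * s + a)) * h x) :
    Integrable (fun z : Euc n × Euc n =>
      (‖z.1‖ ^ (-a) - ‖z.2‖ ^ (-a)) * h z.1 * sepKern n s l z.1 z.2) ∧
    ∫ z : Euc n × Euc n, (‖z.1‖ ^ (-a) - ‖z.2‖ ^ (-a)) * h z.1 * sepKern n s l z.1 z.2 =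
      sepCoeff n s a l e * ∫ x, ‖x‖ ^ (-(2 * s + a)) * h x := by
  obtain ⟨i1, e1⟩ := integrable_sep_fst hn hs0 hl0 hl he hh hhI
  obtain ⟨i2, e2⟩ := integrable_sep_snd hn hs0 hl0 hl he ha han hh hhI
  have heq : (fun z : Euc n × Euc n =>
      (‖z.1‖ ^ (-a) - ‖z.2‖ ^ (-a)) * h z.1 * sepKern n s l z.1 z.2) =
      fun z : Euc n × Euc n => ‖z.1‖ ^ (-a) * h z.1 * sepKern n s l z.1 z.2 -
        h z.1 * (‖z.2‖ ^ (-a) * sepKern n s l z.1 z.2) := by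
    ext z; ring
  rw [heq]
  refine ⟨i1.sub i2, ?_⟩
  rw [integral_sub i1 i2, e1, e2, sepCoeff]
  ring

/-- Symmetrization of a double integral against a symmetric kernel. -/
lemma integral_antisymm_form {v φ : Euc n → ℝ} {k : Euc n → Euc n → ℝ}
    (hk : ∀ x y, k x y = k y x)
    (hI : Integrable fun z : Euc n × Euc n => (v z.1 - v z.2) * φ z.1 * k z.1 z.2) :
    ∫ z : Euc n × Euc n, (v z.1 - v z.2) * (φ z.1 - φ z.2) * k z.1 z.2 =
      2 * ∫ z : Euc n × Euc n, (v z.1 - v z.2) * φ z.1 * k z.1 z.2 := by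
  have hI' : Integrable fun z : Euc n × Euc n => (v z.2 - v z.1) * φ z.2 * k z.2 z.1 := hI.swap
  have heq : (fun z : Euc n × Euc n => (v z.1 - v z.2) * (φ z.1 - φ z.2) * k z.1 z.2) =
      fun z => (v z.1 - v z.2) * φ z.1 * k z.1 z.2 + (v z.2 - v z.1) * φ z.2 * k z.2 z.1 := by
    ext z
    rw [hk z.2 z.1]
    ring
  rw [heq, integral_add hI hI', two_mul]
  congr 1
  exact integral_prod_swap (fun z : Euc n × Euc n => (v z.1 - v z.2) * φ z.1 * k z.1 z.2)

lemma tendsto_integral_sep (hn : 0 < n) {F : Euc n × Euc n → ℝ} (hF : Integrable F)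
    {l : ℕ → ℝ} (hl : Tendsto l atTop (nhds 1)) :
    Tendsto (fun k => ∫ z, sepInd n (l k) z.1 z.2 * F z) atTop (nhds (∫ z, F z)) := by
  have : Nonempty (Fin n) := ⟨⟨0, hn⟩⟩
  have : Nontrivial (Euc n) := inferInstance
  refine tendsto_integral_of_dominated_convergence (fun z => ‖F z‖)
    (fun k => ((measurable_sepInd (l k)).aestronglyMeasurable.mul hF.aestronglyMeasurable))
    hF.norm (fun k => Eventually.of_forall fun z => ?_) ?_
  · rw [norm_mul, Real.norm_of_nonneg (sepInd_nonneg _ _ _)]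
    exact mul_le_of_le_one_left (norm_nonneg _) (sepInd_le_one _ _ _)
  · have hnull : ∀ᵐ z : Euc n × Euc n, ‖z.1‖ ≠ ‖z.2‖ := by
      have hms : MeasurableSet {z : Euc n × Euc n | ‖z.1‖ ≠ ‖z.2‖} :=
        (measurableSet_eq_fun (by fun_prop) (by fun_prop)).compl
      rw [Measure.volume_eq_prod, Measure.ae_prod_iff_ae_ae hms]
      refine Eventually.of_forall fun x => ?_
      have h0 := Measure.addHaar_sphere (volume : Measure (Euc n)) 0 ‖x‖
      refine measure_mono_null (fun y hy => ?_) h0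
      simp only [mem_compl_iff, mem_ofPred_eq, not_not] at hy
      simp [hy]
    filter_upwards [hnull] with z hz
    refine tendsto_const_nhds.congr' ?_
    rcases lt_or_gt_of_ne hz with h | h
    · have h1 : Tendsto (fun k => l k * ‖z.2‖) atTop (nhds (1 * ‖z.2‖)) := hl.mul_const _
      rw [one_mul] at h1
      filter_upwards [h1.eventually_const_lt h] with k hk
      rw [sepInd_of (Or.inr hk.le), one_mul]
    · have h1 : Tendsto (fun k => l k * ‖z.1‖) atTop (nhds (1 * ‖z.1‖)) := hl.mul_const _
      rw [one_mul] at h1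
      filter_upwards [h1.eventually_const_lt h] with k hk
      rw [sepInd_of (Or.inl hk.le), one_mul]

lemma tendsto_sepCoeff_mul (hn : 0 < n) (hs0 : 0 < s) (he : ‖e‖ = 1) (ha : 0 ≤ a) (han : a < n)
    (hh : Measurable h) (hhI : Integrable fun x => ‖x‖ ^ (-(2 * s + a)) * h x)
    (hF : Integrable fun z : Euc n × Euc n =>
      (‖z.1‖ ^ (-a) - ‖z.2‖ ^ (-a)) * (h z.1 - h z.2) * kern n s z.1 z.2)
    {l : ℕ → ℝ} (hl0 : ∀ k, 0 < l k) (hl1 : ∀ k, l k < 1) (hl : Tendsto l atTop (nhds 1)) :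
    Tendsto (fun k => sepCoeff n s a (l k) e * ∫ x, ‖x‖ ^ (-(2 * s + a)) * h x) atTop
      (nhds (1 / 2 * ∫ z : Euc n × Euc n,
        (‖z.1‖ ^ (-a) - ‖z.2‖ ^ (-a)) * (h z.1 - h z.2) * kern n s z.1 z.2)) := by
  have h1 := (tendsto_integral_sep hn hF hl).const_mul (1 / 2)
  refine h1.congr fun k => ?_
  obtain ⟨i1, e1⟩ := integral_sep_form hn hs0 (hl0 k) (hl1 k) he ha han hh hhI
  have h2 := integral_antisymm_form (v := fun x => ‖x‖ ^ (-a)) (φ := h)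
    (k := sepKern n s (l k)) (sepKern_symm _) i1
  rw [← e1]
  have h3 : ∀ z : Euc n × Euc n, sepInd n (l k) z.1 z.2 *
      ((‖z.1‖ ^ (-a) - ‖z.2‖ ^ (-a)) * (h z.1 - h z.2) * kern n s z.1 z.2) =
      (‖z.1‖ ^ (-a) - ‖z.2‖ ^ (-a)) * (h z.1 - h z.2) * sepKern n s (l k) z.1 z.2 := by
    intro z; rw [sepKern]; ring
  rw [integral_congr_ae (Eventually.of_forall h3), h2]
  ring

end Coeff

/-- A sequence of ratios increasing to `1`. -/
def ratio (k : ℕ) : ℝ := 1 - 1 / ((k : ℝ) + 2)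

lemma ratio_pos (k : ℕ) : 0 < ratio k := by
  unfold ratio
  rw [sub_pos, div_lt_one (by positivity)]
  have : (0 : ℝ) ≤ k := k.cast_nonneg
  linarith

lemma ratio_lt_one (k : ℕ) : ratio k < 1 := by
  unfold ratio
  have : 0 < 1 / ((k : ℝ) + 2) := by positivity
  linarith

lemma tendsto_ratio : Tendsto ratio atTop (nhds 1) := by
  have h := (tendsto_one_div_add_atTop_nhds_zero_nat (𝕜 := ℝ)).comp (tendsto_add_atTop_nat 1)
  have h2 := h.const_sub 1
  rw [sub_zero] at h2
  refine h2.congr fun k => ?_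
  simp only [Function.comp, ratio]
  push_cast
  ring_nf

end Cone

section Gauss

variable {n : ℕ} {s : ℝ}

/-- Half the area of the unit sphere. -/
def halfArea (n : ℕ) : ℝ := n * (volume : Measure (Euc n)).real (ball 0 1) / 2

lemma halfArea_pos (hn : 0 < n) : 0 < halfArea n := by
  have h : 0 < (volume : Measure (Euc n)).real (ball 0 1) :=
    ENNReal.toReal_pos (measure_ball_pos volume _ one_pos).ne' measure_ball_lt_top.ne
  have : (0 : ℝ) < n := by exact_mod_cast hn
  unfold halfArea
  positivity

lemma gauss_moment (hn : 0 < n) {q b : ℝ} (hq : q < n) (hb : 0 < b) :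
    Integrable (fun x : Euc n => ‖x‖ ^ (-q) * rexp (-b * ‖x‖ ^ 2)) ∧
      ∫ x : Euc n, ‖x‖ ^ (-q) * rexp (-b * ‖x‖ ^ 2) =
        b ^ (-((n - q) / 2)) * (halfArea n * Real.Gamma ((n - q) / 2)) := by
  have : Nonempty (Fin n) := ⟨⟨0, hn⟩⟩
  have : Nontrivial (Euc n) := inferInstance
  have hfun : ∀ r ∈ Ioi (0 : ℝ), r ^ (n - 1) • (r ^ (-q) * rexp (-b * r ^ 2)) =
      r ^ ((n : ℝ) - 1 - q) * rexp (-b * r ^ (2 : ℝ)) := by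
    intro r hr
    have hr : 0 < r := hr
    rw [← Real.rpow_natCast, Nat.cast_sub (by omega), Nat.cast_one, smul_eq_mul, ← mul_assoc,
      ← Real.rpow_add hr, Real.rpow_two, ← sub_eq_add_neg]
  constructor
  · rw [integrable_fun_norm_addHaar (volume : Measure (Euc n))
      (f := fun r => r ^ (-q) * rexp (-b * r ^ 2)), finrank_euclideanSpace_fin,
      integrableOn_congr_fun hfun measurableSet_Ioi]
    exact integrableOn_rpow_mul_exp_neg_mul_rpow (by linarith) two_pos hb
  · rw [integral_fun_norm_addHaar (volume : Measure (Euc n))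
      (fun r => r ^ (-q) * rexp (-b * r ^ 2)), finrank_euclideanSpace_fin,
      setIntegral_congr_fun measurableSet_Ioi hfun,
      integral_rpow_mul_exp_neg_mul_rpow two_pos (by linarith) hb,
      show (n : ℝ) - 1 - q + 1 = n - q by ring, halfArea, neg_div, nsmul_eq_mul, smul_eq_mul]
    ring

lemma integrable_gauss (hn : 0 < n) {b : ℝ} (hb : 0 < b) (c : Euc n) :
    Integrable fun y : Euc n => rexp (-b * ‖y - c‖ ^ 2) := by
  have h := (gauss_moment (q := 0) hn (by exact_mod_cast hn) hb).1
  simp only [neg_zero, Real.rpow_zero, one_mul] at h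
  exact h.comp_sub_right c

lemma complete_square {t : ℝ} (ht : 0 < t) (x y : Euc n) :
    ‖y‖ ^ 2 + t * ‖x - y‖ ^ 2 =
      (1 + t) * ‖y - (t / (1 + t)) • x‖ ^ 2 + t / (1 + t) * ‖x‖ ^ 2 := by
  rw [norm_sub_sq_real, norm_sub_sq_real, norm_smul, inner_smul_right, mul_pow,
    Real.norm_of_nonneg (by positivity), real_inner_comm]
  field_simp
  ring

lemma gauss_conv (hn : 0 < n) {t : ℝ} (ht : 0 < t) (x : Euc n) :
    Integrable (fun y : Euc n => rexp (-‖y‖ ^ 2) * rexp (-t * ‖x - y‖ ^ 2)) ∧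
      ∫ y : Euc n, rexp (-‖y‖ ^ 2) * rexp (-t * ‖x - y‖ ^ 2) =
        (π / (1 + t)) ^ ((n : ℝ) / 2) * rexp (-(t / (1 + t)) * ‖x‖ ^ 2) := by
  have h : (fun y : Euc n => rexp (-‖y‖ ^ 2) * rexp (-t * ‖x - y‖ ^ 2)) = fun y =>
      rexp (-(1 + t) * ‖y - (t / (1 + t)) • x‖ ^ 2) * rexp (-(t / (1 + t)) * ‖x‖ ^ 2) := by
    ext y
    rw [← Real.exp_add, ← Real.exp_add]
    congr 1
    have := complete_square ht x y
    linarith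
  have h1 : 0 < 1 + t := by positivity
  rw [h]
  refine ⟨(integrable_gauss hn h1 _).mul_const _, ?_⟩
  rw [integral_mul_const, integral_sub_right_eq_self (fun y : Euc n => rexp (-(1 + t) * ‖y‖ ^ 2)),
    GaussianFourier.integral_rexp_neg_mul_sq_norm h1, finrank_euclideanSpace_fin]

lemma integral_gauss_sub {t : ℝ} (ht : 0 < t) (x : Euc n) :
    ∫ y : Euc n, rexp (-t * ‖x - y‖ ^ 2) = (π / t) ^ ((n : ℝ) / 2) := by
  rw [integral_sub_left_eq_self (fun y : Euc n => rexp (-t * ‖y‖ ^ 2)),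
    GaussianFourier.integral_rexp_neg_mul_sq_norm ht, finrank_euclideanSpace_fin]

lemma integral_add_swap {F : Euc n × Euc n → ℝ} (hF : Integrable F) :
    Integrable (fun z : Euc n × Euc n => F z + F (z.2, z.1)) ∧
      ∫ z : Euc n × Euc n, (F z + F (z.2, z.1)) = 2 * ∫ z, F z := by
  have h : Integrable fun z : Euc n × Euc n => F (z.2, z.1) := by
    rw [Measure.volume_eq_prod] at hF ⊢
    exact hF.swap
  have he : ∫ z : Euc n × Euc n, F (z.2, z.1) = ∫ z, F z := by
    rw [Measure.volume_eq_prod]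
    exact integral_prod_swap F
  refine ⟨hF.add h, ?_⟩
  rw [integral_add hF h, he]
  ring

lemma integrable_prod_of_nonneg {f g : Euc n → ℝ} {k : Euc n → Euc n → ℝ}
    (hm : Measurable fun z : Euc n × Euc n => k z.1 z.2) (hf : Measurable f)
    (hk : ∀ x y, 0 ≤ k x y) (hki : ∀ x, Integrable (k x)) (hg : ∀ x, ∫ y, k x y = g x)
    (hI : Integrable fun x => f x * g x) :
    Integrable (fun z : Euc n × Euc n => f z.1 * k z.1 z.2) ∧
      ∫ z : Euc n × Euc n, f z.1 * k z.1 z.2 = ∫ x, f x * g x := by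
  have hmeas : Measurable fun z : Euc n × Euc n => f z.1 * k z.1 z.2 :=
    (hf.comp measurable_fst).mul hm
  have hprod : Integrable (fun z : Euc n × Euc n => f z.1 * k z.1 z.2) := by
    rw [Measure.volume_eq_prod, integrable_prod_iff hmeas.aestronglyMeasurable]
    refine ⟨Eventually.of_forall fun x => (hki x).const_mul (f x), hI.norm.congr ?_⟩
    refine Eventually.of_forall fun x => ?_
    simp only [norm_mul, Real.norm_of_nonneg (hk x _), integral_const_mul, hg]
    rw [Real.norm_of_nonneg (r := g x)]
    rw [← hg]
    exact integral_nonneg (hk x)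
  refine ⟨hprod, ?_⟩
  rw [Measure.volume_eq_prod, integral_prod _ hprod]
  simp only [integral_const_mul, hg]

lemma gauss_form (hn : 0 < n) {a t : ℝ} (han : a < n) (ht : 0 < t) :
    Integrable (fun z : Euc n × Euc n => (‖z.1‖ ^ (-a) - ‖z.2‖ ^ (-a)) *
      (rexp (-‖z.1‖ ^ 2) - rexp (-‖z.2‖ ^ 2)) * rexp (-t * ‖z.1 - z.2‖ ^ 2)) ∧
    ∫ z : Euc n × Euc n, (‖z.1‖ ^ (-a) - ‖z.2‖ ^ (-a)) *
      (rexp (-‖z.1‖ ^ 2) - rexp (-‖z.2‖ ^ 2)) * rexp (-t * ‖z.1 - z.2‖ ^ 2) =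
      2 * (halfArea n * Real.Gamma ((n - a) / 2)) * (π / t) ^ ((n : ℝ) / 2) *
        (1 - (t / (1 + t)) ^ (a / 2)) := by
  have hk : 0 < t / (1 + t) := by positivity
  have hmom := gauss_moment (n := n) hn han hk
  have hmom1 := gauss_moment (n := n) hn han one_pos
  simp only [Real.one_rpow, one_mul, neg_mul] at hmom1 hmom
  obtain ⟨i1, e1⟩ := integrable_prod_of_nonneg (n := n)
    (f := fun x => ‖x‖ ^ (-a) * rexp (-‖x‖ ^ 2)) (g := fun _ => (π / t) ^ ((n : ℝ) / 2))
    (k := fun x y => rexp (-t * ‖x - y‖ ^ 2)) (by fun_prop) (by fun_prop)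
    (fun x y => (Real.exp_pos _).le)
    (fun x => by simpa only [norm_sub_rev x] using integrable_gauss hn ht x)
    (fun x => integral_gauss_sub ht x) (hmom1.1.mul_const _)
  obtain ⟨i2, e2⟩ := integrable_prod_of_nonneg (n := n)
    (f := fun x => ‖x‖ ^ (-a))
    (g := fun x => (π / (1 + t)) ^ ((n : ℝ) / 2) * rexp (-(t / (1 + t)) * ‖x‖ ^ 2))
    (k := fun x y => rexp (-‖y‖ ^ 2) * rexp (-t * ‖x - y‖ ^ 2)) (by fun_prop) (by fun_prop)
    (fun x y => by positivity)
    (fun x => (gauss_conv hn ht x).1)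
    (fun x => (gauss_conv hn ht x).2)
    ((hmom.1.const_mul ((π / (1 + t)) ^ ((n : ℝ) / 2))).congr
      (Eventually.of_forall fun x => by simp only [neg_mul]; ring))
  rw [integral_mul_const, hmom1.2] at e1
  have e2' : ∫ x : Euc n, ‖x‖ ^ (-a) *
      ((π / (1 + t)) ^ ((n : ℝ) / 2) * rexp (-(t / (1 + t)) * ‖x‖ ^ 2)) =
      (π / t) ^ ((n : ℝ) / 2) * (t / (1 + t)) ^ (a / 2) *
        (halfArea n * Real.Gamma ((n - a) / 2)) := by
    have h1 : (π / (1 + t)) ^ ((n : ℝ) / 2) * (t / (1 + t)) ^ (-(((n : ℝ) - a) / 2)) =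
        (π / t) ^ ((n : ℝ) / 2) * (t / (1 + t)) ^ (a / 2) := by
      rw [show -(((n : ℝ) - a) / 2) = a / 2 - n / 2 by ring, Real.rpow_sub hk,
        show π / (1 + t) = (π / t) * (t / (1 + t)) by field_simp,
        Real.mul_rpow (by positivity) hk.le]
      have : (t / (1 + t)) ^ ((n : ℝ) / 2) ≠ 0 := (Real.rpow_pos_of_pos hk _).ne'
      field_simp
    rw [← h1, mul_assoc, ← hmom.2, ← integral_const_mul]
    refine integral_congr_ae (Eventually.of_forall fun x => ?_)
    simp only [neg_mul]
    ring
  rw [e2'] at e2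
  have h := integral_add_swap (i1.sub i2)
  simp only [Pi.sub_apply] at h
  rw [integral_sub i1 i2, e1, e2] at h
  have hfun : ∀ z : Euc n × Euc n, (‖z.1‖ ^ (-a) - ‖z.2‖ ^ (-a)) *
      (rexp (-‖z.1‖ ^ 2) - rexp (-‖z.2‖ ^ 2)) * rexp (-t * ‖z.1 - z.2‖ ^ 2) =
      ‖z.1‖ ^ (-a) * rexp (-‖z.1‖ ^ 2) * rexp (-t * ‖z.1 - z.2‖ ^ 2) -
      ‖z.1‖ ^ (-a) * (rexp (-‖z.2‖ ^ 2) * rexp (-t * ‖z.1 - z.2‖ ^ 2)) +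
      (‖z.2‖ ^ (-a) * rexp (-‖z.2‖ ^ 2) * rexp (-t * ‖z.2 - z.1‖ ^ 2) -
      ‖z.2‖ ^ (-a) * (rexp (-‖z.1‖ ^ 2) * rexp (-t * ‖z.2 - z.1‖ ^ 2))) := by
    intro z
    rw [norm_sub_rev z.2 z.1]
    ring
  simp only [hfun]
  refine ⟨h.1, h.2.trans ?_⟩
  ring

end Gauss

section Beta

variable {s : ℝ}

lemma lintegral_rpow_Ioc {c d r : ℝ} (hc : 0 ≤ c) (hcd : c ≤ d) (hr : 0 < r) :
    ∫⁻ v in Ioc c d, ENNReal.ofReal (v ^ (r - 1)) = ENNReal.ofReal ((d ^ r - c ^ r) / r) := by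
  have h := intervalIntegral.intervalIntegrable_rpow' (a := c) (b := d) (r := r - 1) (by linarith)
  have hi := (intervalIntegrable_iff_integrableOn_Ioc_of_le hcd).1 h
  have he := integral_rpow (a := c) (b := d) (r := r - 1) (Or.inl (by linarith))
  rw [intervalIntegral.integral_of_le hcd, sub_add_cancel] at he
  rw [← he, ofReal_integral_eq_lintegral_ofReal hi]
  refine (ae_restrict_iff' measurableSet_Ioc).2 (Eventually.of_forall fun r hr => ?_)
  exact Real.rpow_nonneg (hc.trans hr.1.le) _

lemma lintegral_rpow_Ioo {c d r : ℝ} (hc : 0 ≤ c) (hcd : c ≤ d) (hr : 0 < r) :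
    ∫⁻ v in Ioo c d, ENNReal.ofReal (v ^ (r - 1)) = ENNReal.ofReal ((d ^ r - c ^ r) / r) := by
  rw [← lintegral_rpow_Ioc hc hcd hr, setLIntegral_congr Ioo_ae_eq_Ioc]

lemma div_one_add_lt_iff {t v : ℝ} (ht : 0 < t) (hv : v < 1) :
    t / (1 + t) < v ↔ t < v / (1 - v) := by
  rw [div_lt_iff₀ (by linarith), lt_div_iff₀ (by linarith)]
  constructor <;> intro h <;> nlinarith

lemma lintegral_one_sub_ratio_rpow (hs0 : 0 < s) (hs1 : s < 1) {b : ℝ} (hb : 0 < b) :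
    ∫⁻ t in Ioi (0 : ℝ), ENNReal.ofReal (t ^ (s - 1) * (1 - (t / (1 + t)) ^ b)) =
      ENNReal.ofReal (Real.Gamma (b + s) * Real.Gamma (1 - s) / (s * Real.Gamma b)) := by
  set S : Set (ℝ × ℝ) := {q | (0 < q.1 ∧ 0 < q.2) ∧ (q.2 < 1 ∧ q.1 / (1 + q.1) < q.2)} with hS
  have hSm : MeasurableSet S := by
    have h1 : Measurable fun q : ℝ × ℝ => q.1 / (1 + q.1) := by fun_prop
    exact ((measurableSet_lt measurable_const measurable_fst).inter
      (measurableSet_lt measurable_const measurable_snd)).inter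
      ((measurableSet_lt measurable_snd measurable_const).inter
      (measurableSet_lt h1 measurable_snd))
  set F : ℝ × ℝ → ENNReal := S.indicator fun q =>
    ENNReal.ofReal (q.1 ^ (s - 1)) * (ENNReal.ofReal b * ENNReal.ofReal (q.2 ^ (b - 1))) with hF
  have hFm : Measurable F := Measurable.indicator (by fun_prop) hSm
  have h1 : ∀ t ∈ Ioi (0 : ℝ), ENNReal.ofReal (t ^ (s - 1) * (1 - (t / (1 + t)) ^ b)) =
      ∫⁻ v, F (t, v) := by
    intro t ht
    have ht : 0 < t := ht
    have hk : 0 < t / (1 + t) := by positivity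
    have hk1 : t / (1 + t) ≤ 1 := by rw [div_le_one (by positivity)]; linarith
    have : (fun v => F (t, v)) = (Ioo (t / (1 + t)) 1).indicator fun v =>
        ENNReal.ofReal (t ^ (s - 1)) * (ENNReal.ofReal b * ENNReal.ofReal (v ^ (b - 1))) := by
      ext v
      by_cases hv : v ∈ Ioo (t / (1 + t)) 1
      · rw [indicator_of_mem hv, hF, indicator_of_mem]
        exact ⟨⟨ht, hk.trans hv.1⟩, hv.2, hv.1⟩
      · rw [indicator_of_notMem hv, hF, indicator_of_notMem]
        exact fun h => hv ⟨h.2.2, h.2.1⟩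
    rw [this, lintegral_indicator measurableSet_Ioo, lintegral_const_mul _ (by fun_prop),
      lintegral_const_mul _ (by fun_prop), lintegral_rpow_Ioo hk.le hk1 hb,
      ← ENNReal.ofReal_mul hb.le, ← ENNReal.ofReal_mul (by positivity), Real.one_rpow,
      mul_div_cancel₀ _ hb.ne']
  have hbeta : 0 < ProbabilityTheory.beta (b + s) (1 - s) :=
    ProbabilityTheory.beta_pos (by linarith) (by linarith)
  have h2 : ∀ v : ℝ, ∫⁻ t, F (t, v) =
      ENNReal.ofReal (b / s * ProbabilityTheory.beta (b + s) (1 - s)) *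
        ProbabilityTheory.betaPDF (b + s) (1 - s) v := by
    intro v
    by_cases hv : 0 < v ∧ v < 1
    · have hv1 : 0 < 1 - v := by linarith [hv.2]
      have : (fun t => F (t, v)) = (Ioo 0 (v / (1 - v))).indicator fun t =>
          (ENNReal.ofReal b * ENNReal.ofReal (v ^ (b - 1))) * ENNReal.ofReal (t ^ (s - 1)) := by
        ext t
        by_cases ht : t ∈ Ioo 0 (v / (1 - v))
        · rw [indicator_of_mem ht, hF, indicator_of_mem, mul_comm]
          exact ⟨⟨ht.1, hv.1⟩, hv.2, (div_one_add_lt_iff ht.1 hv.2).2 ht.2⟩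
        · rw [indicator_of_notMem ht, hF, indicator_of_notMem]
          exact fun h => ht ⟨h.1.1, (div_one_add_lt_iff h.1.1 hv.2).1 h.2.2⟩
      rw [this, lintegral_indicator measurableSet_Ioo, lintegral_const_mul _ (by fun_prop),
        lintegral_rpow_Ioo le_rfl (div_nonneg hv.1.le hv1.le) hs0,
        ProbabilityTheory.betaPDF_of_pos_lt_one hv.1 hv.2, ← ENNReal.ofReal_mul hb.le,
        ← ENNReal.ofReal_mul (by have := hv.1; positivity), ← ENNReal.ofReal_mul (by positivity)]
      congr 1
      rw [Real.zero_rpow hs0.ne', Real.div_rpow hv.1.le hv1.le, sub_zero,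
        show b + s - 1 = (b - 1) + s by ring, Real.rpow_add hv.1,
        show 1 - s - 1 = -s by ring, Real.rpow_neg hv1.le]
      field_simp
    · have : (fun t => F (t, v)) = fun _ => 0 := by
        ext t
        rw [hF, indicator_of_notMem]
        exact fun h => hv ⟨h.1.2, h.2.1⟩
      rw [this, ProbabilityTheory.betaPDF_eq, if_neg hv]
      simp
  have hswap : ∫⁻ t in Ioi (0 : ℝ), ∫⁻ v, F (t, v) = ∫⁻ t, ∫⁻ v, F (t, v) := by
    rw [← lintegral_indicator measurableSet_Ioi]
    congr 1
    ext t
    by_cases ht : t ∈ Ioi (0 : ℝ)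
    · rw [indicator_of_mem ht]
    · rw [indicator_of_notMem ht]
      have : (fun v => F (t, v)) = fun _ => 0 := by
        ext v
        rw [hF, indicator_of_notMem]
        exact fun h => ht h.1.1
      rw [this, lintegral_zero]
  rw [setLIntegral_congr_fun measurableSet_Ioi h1, hswap,
    lintegral_lintegral_swap (f := fun t v => F (t, v)) hFm.aemeasurable]
  simp only [h2]
  have hpm : Measurable (ProbabilityTheory.betaPDF (b + s) (1 - s)) :=
    (ProbabilityTheory.measurable_betaPDFReal _ _).ennreal_ofReal
  rw [lintegral_const_mul _ hpm,
    ProbabilityTheory.lintegral_betaPDF_eq_one (by linarith) (by linarith), mul_one]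
  congr 1
  rw [ProbabilityTheory.beta, show b + s + (1 - s) = b + 1 by ring, Real.Gamma_add_one hb.ne']
  have := (Real.Gamma_pos_of_pos hb).ne'
  field_simp

end Beta

section GammaCoeff

variable {n : ℕ} {s : ℝ}

/-- The constant relating the fractional Laplacian of `|x|^{-a}` to Gamma functions. -/
def fracConst (n : ℕ) (s : ℝ) : ℝ :=
  π ^ ((n : ℝ) / 2) * Real.Gamma (1 - s) / (s * Real.Gamma ((n : ℝ) / 2 + s))

/-- The Gamma function quotient in the fractional Laplacian of `|x|^{-a}`. -/
def gammaCoeff (n : ℕ) (s a : ℝ) : ℝ :=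
  Real.Gamma (((n : ℝ) - a) / 2) * Real.Gamma (s + a / 2) /
    (Real.Gamma (a / 2) * Real.Gamma (((n : ℝ) - (2 * s + a)) / 2))

lemma fracConst_pos (hs0 : 0 < s) (hs1 : s < 1) : 0 < fracConst n s := by
  have h1 := Real.Gamma_pos_of_pos (sub_pos.2 hs1)
  have h2 := Real.Gamma_pos_of_pos (show 0 < (n : ℝ) / 2 + s by positivity)
  unfold fracConst
  positivity

lemma ofReal_mul_kern (hs0 : 0 < s) {D : ℝ} {x y : Euc n} (hD : x = y → D = 0) (hD0 : 0 ≤ D) :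
    ENNReal.ofReal (D * kern n s x y) =
      ∫⁻ t in Ioi (0 : ℝ), ENNReal.ofReal (1 / Real.Gamma ((n : ℝ) / 2 + s)) *
        (ENNReal.ofReal (t ^ ((n : ℝ) / 2 + s - 1)) *
          ENNReal.ofReal (D * rexp (-t * ‖x - y‖ ^ 2))) := by
  have hq : 0 < (n : ℝ) / 2 + s := by positivity
  have hG := Real.Gamma_pos_of_pos hq
  by_cases hxy : x = y
  · simp [hD hxy]
  have hr : 0 < ‖x - y‖ := norm_pos_iff.2 (sub_ne_zero.2 hxy)
  have hr2 : 0 < ‖x - y‖ ^ 2 := by positivity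
  have e := Real.integral_rpow_mul_exp_neg_mul_Ioi hq hr2
  have hi : IntegrableOn (fun t : ℝ => t ^ ((n : ℝ) / 2 + s - 1) * rexp (-(‖x - y‖ ^ 2 * t)))
      (Ioi 0) := by
    have := integrableOn_rpow_mul_exp_neg_mul_rpow (p := 1) (s := (n : ℝ) / 2 + s - 1)
      (by linarith) one_pos hr2
    simpa only [Real.rpow_one, neg_mul] using this
  have hk : kern n s x y = 1 / Real.Gamma ((n : ℝ) / 2 + s) *
      ∫ t in Ioi (0 : ℝ), t ^ ((n : ℝ) / 2 + s - 1) * rexp (-(‖x - y‖ ^ 2 * t)) := by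
    rw [e, kern, one_div, one_div, one_div, Real.inv_rpow hr2.le, ← Real.rpow_natCast_mul hr.le]
    rw [show ((2 : ℕ) : ℝ) * ((n : ℝ) / 2 + s) = n + 2 * s by push_cast; ring]
    field_simp
  rw [hk, ← mul_assoc, mul_comm D, mul_assoc, ← integral_const_mul,
    ENNReal.ofReal_mul (by positivity), lintegral_const_mul _ (by fun_prop),
    ofReal_integral_eq_lintegral_ofReal (hi.const_mul D)]
  · congr 1
    refine setLIntegral_congr_fun measurableSet_Ioi fun t ht => ?_
    have ht : 0 < t := ht
    rw [← ENNReal.ofReal_mul (by positivity)]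
    congr 1
    rw [show -t * ‖x - y‖ ^ 2 = -(‖x - y‖ ^ 2 * t) by ring]
    ring
  · refine (ae_restrict_iff' measurableSet_Ioi).2 (Eventually.of_forall fun t ht => ?_)
    have ht : 0 < t := ht
    have : 0 ≤ t ^ ((n : ℝ) / 2 + s - 1) * rexp (-(‖x - y‖ ^ 2 * t)) := by positivity
    exact mul_nonneg hD0 this

lemma ae_prod_ne_zero (hn : 0 < n) : ∀ᵐ z : Euc n × Euc n, z.1 ≠ 0 ∧ z.2 ≠ 0 := by
  rw [Measure.volume_eq_prod]
  exact (Measure.quasiMeasurePreserving_fst.ae (ae_ne_zero hn)).and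
    (Measure.quasiMeasurePreserving_snd.ae (ae_ne_zero hn))

lemma gauss_weight_nonneg {a : ℝ} (ha : 0 ≤ a) {x y : Euc n} (hx : x ≠ 0) (hy : y ≠ 0) :
    0 ≤ (‖x‖ ^ (-a) - ‖y‖ ^ (-a)) * (rexp (-‖x‖ ^ 2) - rexp (-‖y‖ ^ 2)) := by
  have hx := norm_pos_iff.2 hx
  have hy := norm_pos_iff.2 hy
  rcases le_total ‖x‖ ‖y‖ with h | h
  · refine mul_nonneg (sub_nonneg.2 ?_) (sub_nonneg.2 ?_)
    · exact Real.rpow_le_rpow_of_nonpos hx h (by linarith)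
    · gcongr
  · refine mul_nonneg_of_nonpos_of_nonpos (sub_nonpos.2 ?_) (sub_nonpos.2 ?_)
    · exact Real.rpow_le_rpow_of_nonpos hy h (by linarith)
    · gcongr

lemma gauss_form_kern (hn : 0 < n) (hs0 : 0 < s) (hs1 : s < 1) {a : ℝ} (ha : 0 < a)
    (han : 2 * s + a < n) :
    Integrable (fun z : Euc n × Euc n => (‖z.1‖ ^ (-a) - ‖z.2‖ ^ (-a)) *
      (rexp (-‖z.1‖ ^ 2) - rexp (-‖z.2‖ ^ 2)) * kern n s z.1 z.2) ∧
    1 / 2 * ∫ z : Euc n × Euc n, (‖z.1‖ ^ (-a) - ‖z.2‖ ^ (-a)) *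
      (rexp (-‖z.1‖ ^ 2) - rexp (-‖z.2‖ ^ 2)) * kern n s z.1 z.2 =
      fracConst n s * gammaCoeff n s a * ∫ x : Euc n, ‖x‖ ^ (-(2 * s + a)) * rexp (-‖x‖ ^ 2) := by
  have hq : 0 < (n : ℝ) / 2 + s := by positivity
  have hG := Real.Gamma_pos_of_pos hq
  have hGa := Real.Gamma_pos_of_pos (show 0 < ((n : ℝ) - a) / 2 by linarith)
  have hGb := Real.Gamma_pos_of_pos (show 0 < a / 2 by linarith)
  have hGc := Real.Gamma_pos_of_pos (show 0 < a / 2 + s by linarith)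
  have hGd := Real.Gamma_pos_of_pos (show 0 < 1 - s by linarith)
  have hGe := Real.Gamma_pos_of_pos (show 0 < ((n : ℝ) - (2 * s + a)) / 2 by linarith)
  have hA := halfArea_pos hn
  have hm : Measurable fun z : Euc n × Euc n => (‖z.1‖ ^ (-a) - ‖z.2‖ ^ (-a)) *
      (rexp (-‖z.1‖ ^ 2) - rexp (-‖z.2‖ ^ 2)) := by fun_prop
  have hmk := hm.mul (measurable_kern (n := n) (s := s))
  have h0 : ∀ᵐ z : Euc n × Euc n, 0 ≤ (‖z.1‖ ^ (-a) - ‖z.2‖ ^ (-a)) *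
      (rexp (-‖z.1‖ ^ 2) - rexp (-‖z.2‖ ^ 2)) := by
    filter_upwards [ae_prod_ne_zero hn] with z hz
    exact gauss_weight_nonneg ha.le hz.1 hz.2
  have hl : ∫⁻ z : Euc n × Euc n, ENNReal.ofReal ((‖z.1‖ ^ (-a) - ‖z.2‖ ^ (-a)) *
      (rexp (-‖z.1‖ ^ 2) - rexp (-‖z.2‖ ^ 2)) * kern n s z.1 z.2) =
      ENNReal.ofReal (1 / Real.Gamma ((n : ℝ) / 2 + s) * (2 * (halfArea n *
        Real.Gamma ((n - a) / 2)) * π ^ ((n : ℝ) / 2)) *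
        (Real.Gamma (a / 2 + s) * Real.Gamma (1 - s) / (s * Real.Gamma (a / 2)))) := by
    have e1 : ∫⁻ z : Euc n × Euc n, ENNReal.ofReal ((‖z.1‖ ^ (-a) - ‖z.2‖ ^ (-a)) *
        (rexp (-‖z.1‖ ^ 2) - rexp (-‖z.2‖ ^ 2)) * kern n s z.1 z.2) =
        ∫⁻ z : Euc n × Euc n, ∫⁻ t in Ioi (0 : ℝ),
          ENNReal.ofReal (1 / Real.Gamma ((n : ℝ) / 2 + s)) *
          (ENNReal.ofReal (t ^ ((n : ℝ) / 2 + s - 1)) *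
          ENNReal.ofReal ((‖z.1‖ ^ (-a) - ‖z.2‖ ^ (-a)) *
            (rexp (-‖z.1‖ ^ 2) - rexp (-‖z.2‖ ^ 2)) * rexp (-t * ‖z.1 - z.2‖ ^ 2))) := by
      refine lintegral_congr_ae ?_
      filter_upwards [h0] with z hz
      exact ofReal_mul_kern hs0 (fun h => by rw [h]; simp) hz
    rw [e1, lintegral_lintegral_swap (by fun_prop)]
    have e2 : ∀ t ∈ Ioi (0 : ℝ), ∫⁻ z : Euc n × Euc n,
        ENNReal.ofReal (1 / Real.Gamma ((n : ℝ) / 2 + s)) *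
          (ENNReal.ofReal (t ^ ((n : ℝ) / 2 + s - 1)) *
          ENNReal.ofReal ((‖z.1‖ ^ (-a) - ‖z.2‖ ^ (-a)) *
            (rexp (-‖z.1‖ ^ 2) - rexp (-‖z.2‖ ^ 2)) * rexp (-t * ‖z.1 - z.2‖ ^ 2))) =
        ENNReal.ofReal (1 / Real.Gamma ((n : ℝ) / 2 + s) * (2 * (halfArea n *
          Real.Gamma ((n - a) / 2)) * π ^ ((n : ℝ) / 2))) *
        ENNReal.ofReal (t ^ (s - 1) * (1 - (t / (1 + t)) ^ (a / 2))) := by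
      intro t ht
      have ht : 0 < t := ht
      have hg := gauss_form (n := n) hn (a := a) (by linarith) ht
      rw [lintegral_const_mul _ (by fun_prop), lintegral_const_mul _ (by fun_prop),
        ← ofReal_integral_eq_lintegral_ofReal hg.1, hg.2, ← ENNReal.ofReal_mul (by positivity),
        ← ENNReal.ofReal_mul (by positivity), ← ENNReal.ofReal_mul (by positivity)]
      · congr 1
        rw [Real.div_rpow pi_pos.le ht.le, show (n : ℝ) / 2 + s - 1 = n / 2 + (s - 1) by ring,
          Real.rpow_add ht]
        have : t ^ ((n : ℝ) / 2) ≠ 0 := (Real.rpow_pos_of_pos ht _).ne'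
        field_simp
      · filter_upwards [h0] with z hz
        exact mul_nonneg hz (Real.exp_pos _).le
    rw [setLIntegral_congr_fun measurableSet_Ioi e2, lintegral_const_mul _ (by fun_prop),
      lintegral_one_sub_ratio_rpow hs0 hs1 (by positivity), ← ENNReal.ofReal_mul (by positivity)]
  have h0k : ∀ᵐ z : Euc n × Euc n, 0 ≤ (‖z.1‖ ^ (-a) - ‖z.2‖ ^ (-a)) *
      (rexp (-‖z.1‖ ^ 2) - rexp (-‖z.2‖ ^ 2)) * kern n s z.1 z.2 := by
    filter_upwards [h0] with z hz
    exact mul_nonneg hz (kern_nonneg _ _)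
  constructor
  · refine ⟨hmk.aestronglyMeasurable, ?_⟩
    rw [hasFiniteIntegral_iff_ofReal h0k, hl]
    exact ENNReal.ofReal_lt_top
  · have hmom := (gauss_moment (n := n) hn (q := 2 * s + a) (by linarith) one_pos).2
    simp only [Real.one_rpow, one_mul, neg_mul] at hmom
    rw [integral_eq_lintegral_of_nonneg_ae h0k hmk.aestronglyMeasurable, hl,
      ENNReal.toReal_ofReal (by positivity), hmom, fracConst, gammaCoeff, add_comm s (a / 2)]
    field_simp

lemma tendsto_sepCoeff (hn : 0 < n) (hs0 : 0 < s) (hs1 : s < 1) {a : ℝ} (ha : 0 < a)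
    (han : 2 * s + a < n) {e : Euc n} (he : ‖e‖ = 1) :
    Tendsto (fun k => sepCoeff n s a (ratio k) e) atTop
      (nhds (fracConst n s * gammaCoeff n s a)) := by
  have hmom := gauss_moment (n := n) hn (q := 2 * s + a) han one_pos
  simp only [Real.one_rpow, one_mul, neg_mul] at hmom
  have hpos : 0 < ∫ x : Euc n, ‖x‖ ^ (-(2 * s + a)) * rexp (-‖x‖ ^ 2) := by
    rw [hmom.2]
    exact mul_pos (halfArea_pos hn) (Real.Gamma_pos_of_pos (by linarith))
  have hf := gauss_form_kern hn hs0 hs1 ha han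
  have h := tendsto_sepCoeff_mul (e := e) (l := ratio) hn hs0 he ha.le (by linarith)
    (h := fun x : Euc n => rexp (-‖x‖ ^ 2)) (by fun_prop) hmom.1 hf.1 ratio_pos ratio_lt_one
    tendsto_ratio
  rw [hf.2] at h
  have h2 := h.mul_const (∫ x : Euc n, ‖x‖ ^ (-(2 * s + a)) * rexp (-‖x‖ ^ 2))⁻¹
  simpa only [mul_assoc, mul_inv_cancel₀ hpos.ne', mul_one] using h2

lemma form_eq_gammaCoeff (hn : 0 < n) (hs0 : 0 < s) (hs1 : s < 1) {a : ℝ} (ha : 0 < a)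
    (han : 2 * s + a < n) {h : Euc n → ℝ} (hh : Measurable h)
    (hhI : Integrable fun x => ‖x‖ ^ (-(2 * s + a)) * h x)
    (hF : Integrable fun z : Euc n × Euc n =>
      (‖z.1‖ ^ (-a) - ‖z.2‖ ^ (-a)) * (h z.1 - h z.2) * kern n s z.1 z.2) :
    1 / 2 * ∫ z : Euc n × Euc n, (‖z.1‖ ^ (-a) - ‖z.2‖ ^ (-a)) * (h z.1 - h z.2) *
      kern n s z.1 z.2 = fracConst n s * gammaCoeff n s a * ∫ x, ‖x‖ ^ (-(2 * s + a)) * h x := by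
  have he : ‖(EuclideanSpace.single (⟨0, hn⟩ : Fin n) (1 : ℝ) : Euc n)‖ = 1 := by simp
  refine tendsto_nhds_unique (tendsto_sepCoeff_mul hn hs0 he ha.le (by linarith) hh hhI hF
    ratio_pos ratio_lt_one tendsto_ratio) ?_
  exact (tendsto_sepCoeff hn hs0 hs1 ha han he).mul_const _

end GammaCoeff

section WeakForm

variable {n : ℕ} {s : ℝ}

/-- The kernel truncated near the diagonal. -/
def truncKern (n : ℕ) (s ε : ℝ) (x y : Euc n) : ℝ := if ε < ‖x - y‖ then kern n s x y else 0

lemma truncKern_nonneg (ε : ℝ) (x y : Euc n) : 0 ≤ truncKern n s ε x y := by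
  unfold truncKern
  split_ifs
  exacts [kern_nonneg _ _, le_rfl]

lemma truncKern_le (ε : ℝ) (x y : Euc n) : truncKern n s ε x y ≤ kern n s x y := by
  unfold truncKern
  split_ifs
  exacts [le_rfl, kern_nonneg _ _]

lemma truncKern_symm (ε : ℝ) (x y : Euc n) : truncKern n s ε x y = truncKern n s ε y x := by
  unfold truncKern
  rw [norm_sub_rev, kern_symm]

lemma truncKern_sub (ε : ℝ) (x y : Euc n) :
    truncKern n s ε x y = truncKern n s ε 0 (y - x) := by
  unfold truncKern kern
  rw [zero_sub, norm_neg, norm_sub_rev]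

lemma min_mul_truncKern_le (ε : ℝ) (x y : Euc n) :
    min ε 1 * truncKern n s ε x y ≤ min ‖x - y‖ 1 * kern n s x y := by
  unfold truncKern
  have := kern_nonneg (s := s) x y
  split_ifs with h
  · gcongr
  · rw [mul_zero]
    positivity

lemma measurable_truncKern (ε : ℝ) :
    Measurable fun z : Euc n × Euc n => truncKern n s ε z.1 z.2 :=
  Measurable.ite (p := fun z : Euc n × Euc n => ε < ‖z.1 - z.2‖)
    (measurableSet_lt measurable_const (by fun_prop)) measurable_kern measurable_const

lemma measurable_truncKern_right (ε : ℝ) (x : Euc n) :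
    Measurable fun y => truncKern n s ε x y :=
  Measurable.ite (p := fun y : Euc n => ε < ‖x - y‖)
    (measurableSet_lt measurable_const (by fun_prop)) (measurable_kern_right x) measurable_const

lemma integral_truncKern (ε : ℝ) (v : Euc n → ℝ) (x : Euc n) :
    ∫ y, (v x - v y) * truncKern n s ε x y =
      ∫ y in {y : Euc n | ε < ‖x - y‖}, (v x - v y) / ‖x - y‖ ^ ((n : ℝ) + 2 * s) := by
  rw [← integral_indicator (measurableSet_lt measurable_const (by fun_prop))]
  congr 1
  ext y
  by_cases h : ε < ‖x - y‖
  · rw [indicator_of_mem (show y ∈ {y : Euc n | ε < ‖x - y‖} from h), truncKern, if_pos h, kern,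
      mul_one_div]
  · rw [indicator_of_notMem (show y ∉ {y : Euc n | ε < ‖x - y‖} from h), truncKern, if_neg h,
      mul_zero]

lemma exists_taylor_bound {v : Euc n → ℝ} (hv : ContDiffOn ℝ 2 v {(0 : Euc n)}ᶜ) {r : ℝ}
    (hr : 0 < r) (b : ℝ) :
    ∃ M, 0 ≤ M ∧ ∀ x, r ≤ ‖x‖ → ‖x‖ ≤ b → ∀ y, ‖x - y‖ ≤ r / 2 →
      |v x - v y + fderiv ℝ v x (y - x)| ≤ M * ‖x - y‖ ^ 2 := by
  have hopen : IsOpen ({(0 : Euc n)}ᶜ : Set (Euc n)) := isOpen_compl_singleton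
  have hd : ContDiffOn ℝ 1 (fderiv ℝ v) {(0 : Euc n)}ᶜ :=
    hv.fderiv_of_isOpen hopen (by norm_num)
  obtain ⟨M, hM0, hM⟩ := exists_locally_lipschitz hd hr b
  refine ⟨M, hM0, fun x hx hxb y hy => ?_⟩
  have hball : ∀ z ∈ closedBall x ‖x - y‖, ‖x - z‖ ≤ ‖x - y‖ := fun z hz => by
    rwa [mem_closedBall, dist_eq_norm, norm_sub_rev] at hz
  have h := Convex.norm_image_sub_le_of_norm_fderiv_le' (𝕜 := ℝ) (f := v) (x := x) (y := y)
    (s := closedBall x ‖x - y‖) (φ := fderiv ℝ v x) (C := M * ‖x - y‖) ?_ ?_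
    (convex_closedBall _ _) (mem_closedBall_self (norm_nonneg _))
    (by rw [mem_closedBall, dist_eq_norm, norm_sub_rev])
  · rw [Real.norm_eq_abs, norm_sub_rev y x] at h
    rw [show v x - v y + fderiv ℝ v x (y - x) = -(v y - v x - fderiv ℝ v x (y - x)) by ring,
      abs_neg]
    nlinarith
  · intro z hz
    refine (hv.differentiableOn (by norm_num)).differentiableAt (hopen.mem_nhds fun h0 => ?_)
    have := hball z hz
    rw [mem_singleton_iff] at h0
    rw [h0, sub_zero] at this
    linarith
  · intro z hz
    have h1 := hball z hz
    refine (hM x hx hxb z x (h1.trans hy) (by simp; linarith)).trans ?_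
    rw [norm_sub_rev]
    gcongr

lemma integrable_majorant (hn : 0 < n) (hs0 : 0 < s) (hs1 : s < 1) {a : ℝ} (ha : 0 ≤ a)
    (han : a < n) (x : Euc n) :
    Integrable fun y => levy n s (x - y) + decay n s a y + decay n s 0 y :=
  ((((integrable_levy hn hs0 hs1).comp_sub_left x)).add
    (integrable_decay hn hs0 (by linarith) han)).add
    (integrable_decay hn hs0 (by linarith) (by exact_mod_cast hn))

lemma integral_majorant (hn : 0 < n) (hs0 : 0 < s) (hs1 : s < 1) {a : ℝ} (ha : 0 ≤ a)
    (han : a < n) (x : Euc n) :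
    ∫ y, (levy n s (x - y) + decay n s a y + decay n s 0 y) =
      (∫ y, levy n s y) + (∫ y, decay n s a y) + ∫ y, decay n s 0 y := by
  have h1 := (integrable_levy hn hs0 hs1).comp_sub_left x
  have h2 := integrable_decay (s := s) hn hs0 (a := a) (by linarith) han
  have h3 := integrable_decay (s := s) hn hs0 (a := 0) (by linarith) (by exact_mod_cast hn)
  have h12 : Integrable fun y => levy n s (x - y) + decay n s a y := h1.add h2
  rw [integral_add h12 h3, integral_add h1 h2, integral_sub_left_eq_self]

lemma integrable_truncKern (hn : 0 < n) (hs0 : 0 < s) (hs1 : s < 1) {a : ℝ} (ha : 0 ≤ a)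
    (han : a < n) {v : Euc n → ℝ} (hv : Tame a v) {x : Euc n} (hx : x ≠ 0) {ε : ℝ} (hε : 0 < ε) :
    Integrable fun y => (v x - v y) * truncKern n s ε x y := by
  obtain ⟨C, hC0, hC⟩ := hv.exists_majorant hs0 (norm_pos_iff.2 hx) ‖x‖
  have hm : 0 < min ε 1 := by positivity
  refine ((integrable_majorant (s := s) hn hs0 hs1 ha han x).const_mul (C / min ε 1)).mono'
    (((measurable_const.sub hv.measurable).mul
      (measurable_truncKern_right ε x)).aestronglyMeasurable) (Eventually.of_forall fun y => ?_)
  rw [norm_mul, Real.norm_eq_abs, Real.norm_of_nonneg (truncKern_nonneg _ _ _), div_mul_eq_mul_div,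
    le_div_iff₀ hm]
  calc |v x - v y| * truncKern n s ε x y * min ε 1
      = |v x - v y| * (min ε 1 * truncKern n s ε x y) := by ring
    _ ≤ |v x - v y| * (min ‖x - y‖ 1 * kern n s x y) :=
      mul_le_mul_of_nonneg_left (min_mul_truncKern_le _ _ _) (abs_nonneg _)
    _ ≤ _ := by rw [← mul_assoc]; exact hC x le_rfl le_rfl y

lemma exists_truncKern_bound (hn : 0 < n) (hs0 : 0 < s) (hs1 : s < 1) {a : ℝ} (ha : 0 ≤ a)
    (han : a < n) {v : Euc n → ℝ} (hv : Tame a v) (hv2 : ContDiffOn ℝ 2 v {(0 : Euc n)}ᶜ)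
    {r : ℝ} (hr : 0 < r) (b : ℝ) :
    ∃ B, ∀ ε, 0 < ε → ∀ x, r ≤ ‖x‖ → ‖x‖ ≤ b →
      |∫ y, (v x - v y) * truncKern n s ε x y| ≤ B := by
  obtain ⟨M, hM0, hM⟩ := exists_taylor_bound hv2 hr b
  obtain ⟨C, hC0, hC⟩ := hv.exists_majorant hs0 hr b
  set ρ := min (r / 2) 1 with hρ
  have hρ0 : 0 < ρ := by positivity
  refine ⟨(M + C / ρ) * ((∫ y, levy n s y) + (∫ y, decay n s a y) + ∫ y, decay n s 0 y),
    fun ε hε x hx hxb => ?_⟩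
  have hx0 : x ≠ 0 := norm_pos_iff.1 (hr.trans_le hx)
  set f : Euc n → ℝ := fun z => if ‖z‖ ≤ ρ then fderiv ℝ v x z * truncKern n s ε 0 z else 0
    with hf
  have hfm : Measurable f := Measurable.ite (measurableSet_le (by fun_prop) measurable_const)
    ((fderiv ℝ v x).continuous.measurable.mul (measurable_truncKern_right ε 0)) measurable_const
  have hodd : ∀ z, f (-z) = -f z := by
    intro z
    simp only [hf, norm_neg, map_neg, truncKern, kern, zero_sub]
    split_ifs <;> ring
  have hf0 : ∫ y, f (y - x) = 0 := by
    rw [integral_sub_right_eq_self f]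
    have h1 := integral_neg_eq_self f volume
    simp only [hodd, integral_neg] at h1
    linarith
  have hbound : ∀ y, ‖(v x - v y) * truncKern n s ε x y + f (y - x)‖ ≤
      (M + C / ρ) * (levy n s (x - y) + decay n s a y + decay n s 0 y) := by
    intro y
    have l0 := levy_nonneg (s := s) (x - y)
    have d0 := decay_nonneg (s := s) a y
    have d00 := decay_nonneg (s := s) 0 y
    have k0 := kern_nonneg (s := s) x y
    by_cases h : ‖x - y‖ ≤ ρ
    · have h1 := hM x hx hxb y (h.trans (min_le_left _ _))
      have h2 : ‖x - y‖ ≤ 1 := h.trans (min_le_right _ _)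
      have e : (v x - v y) * truncKern n s ε x y + f (y - x) =
          (v x - v y + fderiv ℝ v x (y - x)) * truncKern n s ε x y := by
        simp only [hf, if_pos (show ‖y - x‖ ≤ ρ by rwa [norm_sub_rev]), ← truncKern_sub]
        ring
      rw [e, norm_mul, Real.norm_eq_abs, Real.norm_of_nonneg (truncKern_nonneg _ _ _)]
      calc _ ≤ M * ‖x - y‖ ^ 2 * kern n s x y := by
            gcongr
            · exact truncKern_nonneg _ _ _
            · exact truncKern_le _ _ _
        _ = M * levy n s (x - y) := by
            rw [levy, min_eq_left (by nlinarith [norm_nonneg (x - y)]), kern]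
            ring
        _ ≤ _ := by
            have : 0 ≤ C / ρ := by positivity
            nlinarith [mul_nonneg this l0, mul_nonneg this d0, mul_nonneg this d00,
              mul_nonneg hM0 d0, mul_nonneg hM0 d00]
    · have e : f (y - x) = 0 := by
        simp only [hf, if_neg (show ¬ ‖y - x‖ ≤ ρ by rwa [norm_sub_rev])]
      rw [e, add_zero, norm_mul, Real.norm_eq_abs, Real.norm_of_nonneg (truncKern_nonneg _ _ _)]
      have h3 := hC x hx hxb y
      have h4 : ρ ≤ min ‖x - y‖ 1 := le_min (not_le.1 h).le (min_le_right _ _)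
      have h5 : |v x - v y| * kern n s x y ≤
          C / ρ * (levy n s (x - y) + decay n s a y + decay n s 0 y) := by
        rw [div_mul_eq_mul_div, le_div_iff₀ hρ0]
        calc |v x - v y| * kern n s x y * ρ = |v x - v y| * ρ * kern n s x y := by ring
          _ ≤ |v x - v y| * min ‖x - y‖ 1 * kern n s x y := by gcongr
          _ ≤ _ := h3
      calc _ ≤ |v x - v y| * kern n s x y := by gcongr; exact truncKern_le _ _ _
        _ ≤ _ := h5
        _ ≤ _ := by gcongr; linarith
  have hmaj := integrable_majorant (s := s) hn hs0 hs1 ha han x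
  have hg := integrable_truncKern (s := s) hn hs0 hs1 ha han hv hx0 hε
  have hsum : Integrable fun y => (v x - v y) * truncKern n s ε x y + f (y - x) :=
    (hmaj.const_mul (M + C / ρ)).mono'
      (hg.aestronglyMeasurable.add (hfm.comp (measurable_id.sub_const x)).aestronglyMeasurable)
      (Eventually.of_forall hbound)
  have hfi : Integrable fun y => f (y - x) := by
    refine (hsum.sub hg).congr (Eventually.of_forall fun y => ?_)
    simp
  have heq : ∫ y, (v x - v y) * truncKern n s ε x y =
      ∫ y, ((v x - v y) * truncKern n s ε x y + f (y - x)) := by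
    rw [integral_add hg hfi, hf0, add_zero]
  rw [heq, ← integral_majorant hn hs0 hs1 ha han x, ← integral_const_mul]
  exact norm_integral_le_of_norm_le (hmaj.const_mul _) (Eventually.of_forall hbound)

lemma weak_form (hn : 0 < n) (hs0 : 0 < s) (hs1 : s < 1) {a : ℝ} (ha : 0 ≤ a)
    (han : a < n) {v : Euc n → ℝ} (hv : Tame a v) (hv2 : ContDiffOn ℝ 2 v {(0 : Euc n)}ᶜ)
    {L : Euc n → ℝ} (hL : ∀ x, x ≠ 0 → FracLapEq n s v x (L x)) {φ : Euc n → ℝ}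
    (hφ : IsTest φ) :
    1 / 2 * ∫ z : Euc n × Euc n, (v z.1 - v z.2) * (φ z.1 - φ z.2) * kern n s z.1 z.2 =
      ∫ x, L x * φ x := by
  obtain ⟨r, b, hr, hrb⟩ := hφ.exists_annulus
  obtain ⟨B, hB⟩ := exists_truncKern_bound (s := s) hn hs0 hs1 ha han hv hv2 hr b
  obtain ⟨C, hC0, hC⟩ := hv.exists_majorant hs0 hr b
  obtain ⟨P, hP⟩ := hφ.compact.exists_bound_of_continuous hφ.smooth.continuous
  have hP0 : 0 ≤ P := (norm_nonneg _).trans (hP 0)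
  have hvm := hv.measurable
  have hφm := hφ.smooth.continuous.measurable
  have hφi : Integrable φ := hφ.smooth.continuous.integrable_of_hasCompactSupport hφ.compact
  set ε : ℕ → ℝ := fun k => 1 / ((k : ℝ) + 1) with hε
  have hε0 : ∀ k, 0 < ε k := fun k => by simp only [hε]; positivity
  have hεt : Tendsto ε atTop (nhds 0) := tendsto_one_div_add_atTop_nhds_zero_nat
  have hεt' : Tendsto ε atTop (nhdsWithin 0 (Ioi 0)) :=
    tendsto_nhdsWithin_iff.2 ⟨hεt, Eventually.of_forall hε0⟩
  have hform := hv.integrable_form hn hs0 hs1 ha han hφ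
  have hprod : ∀ k, Integrable fun z : Euc n × Euc n =>
      (v z.1 - v z.2) * φ z.1 * truncKern n s (ε k) z.1 z.2 := by
    intro k
    have hm : 0 < min (ε k) 1 := lt_min (hε0 k) one_pos
    refine ((integrable_annMajorant hn hs0 hs1 ha han r b).const_mul (P * C / min (ε k) 1)).mono'
      ((((hvm.comp measurable_fst).sub (hvm.comp measurable_snd)).mul
        (hφm.comp measurable_fst)).mul (measurable_truncKern _)).aestronglyMeasurable
      (Eventually.of_forall fun z => ?_)
    rw [norm_mul, norm_mul, Real.norm_eq_abs, Real.norm_of_nonneg (truncKern_nonneg _ _ _)]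
    by_cases h : φ z.1 = 0
    · rw [h, norm_zero, mul_zero, zero_mul]
      have := annMajorant_nonneg (s := s) a r b z.1 z.2
      positivity
    · obtain ⟨h1, h2⟩ := hrb _ h
      have hmem : z.1 ∈ {x : Euc n | r ≤ ‖x‖ ∧ ‖x‖ ≤ b} := ⟨h1, h2⟩
      rw [annMajorant, indicator_of_mem hmem, Pi.one_apply, one_mul, div_mul_eq_mul_div,
        le_div_iff₀ hm]
      calc |v z.1 - v z.2| * ‖φ z.1‖ * truncKern n s (ε k) z.1 z.2 * min (ε k) 1
          = ‖φ z.1‖ * (|v z.1 - v z.2| * (min (ε k) 1 * truncKern n s (ε k) z.1 z.2)) := by ring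
        _ ≤ P * (|v z.1 - v z.2| * (min ‖z.1 - z.2‖ 1 * kern n s z.1 z.2)) := by
          have := truncKern_nonneg (s := s) (ε k) z.1 z.2
          exact mul_le_mul (hP _) (mul_le_mul_of_nonneg_left (min_mul_truncKern_le _ _ _)
            (abs_nonneg _)) (by positivity) hP0
        _ ≤ P * (C * (levy n s (z.1 - z.2) + decay n s a z.2 + decay n s 0 z.2)) := by
          rw [← mul_assoc |v z.1 - v z.2|]
          exact mul_le_mul_of_nonneg_left (hC _ h1 h2 _) hP0
        _ = _ := by ring
  have hseq : ∀ k, 1 / 2 * ∫ z : Euc n × Euc n,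
      (v z.1 - v z.2) * (φ z.1 - φ z.2) * truncKern n s (ε k) z.1 z.2 =
      ∫ x, (∫ y, (v x - v y) * truncKern n s (ε k) x y) * φ x := by
    intro k
    rw [integral_antisymm_form (k := truncKern n s (ε k)) (truncKern_symm (ε k)) (hprod k),
      ← mul_assoc, one_div_mul_cancel two_ne_zero, one_mul]
    have := hprod k
    rw [Measure.volume_eq_prod] at this ⊢
    rw [integral_prod _ this]
    refine integral_congr_ae (Eventually.of_forall fun x => ?_)
    simp only
    rw [← integral_mul_const]
    refine integral_congr_ae (Eventually.of_forall fun y => ?_)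
    simp only
    ring
  have hlhs : Tendsto (fun k => 1 / 2 * ∫ z : Euc n × Euc n,
      (v z.1 - v z.2) * (φ z.1 - φ z.2) * truncKern n s (ε k) z.1 z.2) atTop
      (nhds (1 / 2 * ∫ z : Euc n × Euc n,
        (v z.1 - v z.2) * (φ z.1 - φ z.2) * kern n s z.1 z.2)) := by
    refine Tendsto.const_mul _ (tendsto_integral_of_dominated_convergence _ (fun k => ?_)
      hform.norm (fun k => Eventually.of_forall fun z => ?_) (Eventually.of_forall fun z => ?_))
    · exact ((((hvm.comp measurable_fst).sub (hvm.comp measurable_snd)).mul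
        ((hφm.comp measurable_fst).sub (hφm.comp measurable_snd))).mul
        (measurable_truncKern _)).aestronglyMeasurable
    · rw [norm_mul, norm_mul _ (kern n s z.1 z.2), Real.norm_of_nonneg (truncKern_nonneg _ _ _),
        Real.norm_of_nonneg (kern_nonneg _ _)]
      gcongr
      exact truncKern_le _ _ _
    · by_cases hz : z.1 = z.2
      · simp [hz]
      · refine Tendsto.const_mul _ (tendsto_const_nhds.congr' ?_)
        have hpos : 0 < ‖z.1 - z.2‖ := norm_pos_iff.2 (sub_ne_zero.2 hz)
        filter_upwards [hεt.eventually_lt_const hpos] with k hk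
        rw [truncKern, if_pos hk]
  have hrhs : Tendsto (fun k => ∫ x, (∫ y, (v x - v y) * truncKern n s (ε k) x y) * φ x) atTop
      (nhds (∫ x, L x * φ x)) := by
    refine tendsto_integral_of_dominated_convergence (fun x => B * ‖φ x‖) (fun k => ?_)
      (hφi.norm.const_mul B) (fun k => Eventually.of_forall fun x => ?_) ?_
    · refine AEStronglyMeasurable.mul ?_ hφm.aestronglyMeasurable
      have hm2 : Measurable fun z : Euc n × Euc n =>
          (v z.1 - v z.2) * truncKern n s (ε k) z.1 z.2 :=
        ((hvm.comp measurable_fst).sub (hvm.comp measurable_snd)).mul (measurable_truncKern _)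
      exact hm2.stronglyMeasurable.integral_prod_right.aestronglyMeasurable
    · rw [norm_mul]
      by_cases h : φ x = 0
      · simp [h]
      · gcongr
        exact hB _ (hε0 k) x (hrb x h).1 (hrb x h).2
    · filter_upwards [ae_ne_zero hn] with x hx
      refine Tendsto.mul_const _ ?_
      have := (hL x hx).comp hεt'
      refine this.congr fun k => ?_
      exact (integral_truncKern _ _ _).symm
  exact tendsto_nhds_unique hlhs (hrhs.congr fun k => (hseq k).symm)

end WeakForm

section Mollify

open scoped Convolution

variable {n : ℕ} {s : ℝ}

lemma IsTest.exists_smooth_approx {φ : Euc n → ℝ} (hφ : IsTest φ) :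
    ∃ r b L M : ℝ, 0 < r ∧ 0 ≤ L ∧ 0 ≤ M ∧ ∃ Φ : ℕ → Euc n → ℝ,
      (∀ k, ContDiff ℝ (⊤ : ℕ∞) (Φ k)) ∧ (∀ k, IsTest (Φ k)) ∧
      (∀ k x, Φ k x ≠ 0 → r ≤ ‖x‖ ∧ ‖x‖ ≤ b) ∧
      (∀ k x y, |Φ k x - Φ k y| ≤ L * min ‖x - y‖ 1) ∧ (∀ k x, |Φ k x| ≤ M) ∧
      ∀ x, Tendsto (fun k => Φ k x) atTop (nhds (φ x)) := by
  obtain ⟨r, b, hr, hrb⟩ := hφ.exists_annulus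
  obtain ⟨L, hL0, hL⟩ := hφ.exists_lip
  obtain ⟨M, hM⟩ := hφ.compact.exists_bound_of_continuous hφ.smooth.continuous
  have hM0 : 0 ≤ M := (norm_nonneg _).trans (hM 0)
  have hφc := hφ.smooth.continuous
  set δ : ℕ → ℝ := fun k => min (r / 2) 1 / ((k : ℝ) + 1) with hδ
  have hm : 0 < min (r / 2) 1 := by positivity
  have hδ0 : ∀ k, 0 < δ k := fun k => by positivity
  have hδm : ∀ k, δ k ≤ min (r / 2) 1 := fun k => div_le_self hm.le (by
    have : (0 : ℝ) ≤ k := k.cast_nonneg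
    linarith)
  have hδt : Tendsto δ atTop (nhds 0) := by
    have := (tendsto_one_div_add_atTop_nhds_zero_nat (𝕜 := ℝ)).const_mul (min (r / 2) 1)
    rw [mul_zero] at this
    refine this.congr fun k => ?_
    simp only [hδ]
    ring
  let B : ℕ → ContDiffBump (0 : Euc n) := fun k =>
    ⟨δ k / 2, δ k, half_pos (hδ0 k), half_lt_self (hδ0 k)⟩
  set ρ : ℕ → Euc n → ℝ := fun k => (B k).normed volume with hρ
  have hρ0 : ∀ k t, 0 ≤ ρ k t := fun k t => (B k).nonneg_normed t
  have hρi : ∀ k, Integrable (ρ k) := fun k => (B k).integrable_normed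
  have hρ1 : ∀ k, ∫ t, ρ k t = 1 := fun k => (B k).integral_normed
  have hprod : ∀ k x, Integrable fun t => ρ k t * φ (x - t) := fun k x => by
    refine (hρi k).mul_bdd (c := M) ?_ (Eventually.of_forall fun t => hM _)
    exact (hφc.comp (continuous_const.sub continuous_id)).aestronglyMeasurable
  set Φ : ℕ → Euc n → ℝ := fun k => (ρ k ⋆[ContinuousLinearMap.lsmul ℝ ℝ, volume] φ) with hΦ
  have hΦe : ∀ k x, Φ k x = ∫ t, ρ k t * φ (x - t) := fun k x => by
    simp only [hΦ, convolution_def, ContinuousLinearMap.lsmul_apply, smul_eq_mul]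
  have hsm : ∀ k, ContDiff ℝ (⊤ : ℕ∞) (Φ k) := fun k =>
    (B k).hasCompactSupport_normed.contDiff_convolution_left _ (B k).contDiff_normed
      hφc.locallyIntegrable
  have hsupp : ∀ k x, Φ k x ≠ 0 → r / 2 ≤ ‖x‖ ∧ ‖x‖ ≤ b + 1 := by
    intro k x hx
    obtain ⟨t, ht⟩ : ∃ t, ρ k t * φ (x - t) ≠ 0 := by
      by_contra! h
      rw [hΦe] at hx
      exact hx (by simp [h])
    have h1 : ‖t‖ < δ k := by
      have : t ∈ Function.support (ρ k) := left_ne_zero_of_mul ht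
      rw [hρ, (B k).support_normed_eq] at this
      simpa [B] using this
    obtain ⟨h2, h3⟩ := hrb _ (right_ne_zero_of_mul ht)
    have h4 := (hδm k).trans (min_le_left _ _)
    have h5 := (hδm k).trans (min_le_right _ _)
    have h6 := norm_sub_le x t
    have h7 := norm_sub_norm_le x t
    constructor <;> linarith
  have htsupp : ∀ k, tsupport (Φ k) ⊆ {x : Euc n | r / 2 ≤ ‖x‖ ∧ ‖x‖ ≤ b + 1} := fun k =>
    closure_minimal (fun x hx => hsupp k x hx) (isCompact_annulus _ _).isClosed
  refine ⟨r / 2, b + 1, L, M, half_pos hr, hL0, hM0, Φ, hsm, fun k => ⟨(hsm k).of_le (by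
    exact_mod_cast le_top), ?_, ?_⟩, hsupp, ?_, ?_, fun x => ?_⟩
  · exact (isCompact_annulus _ _).of_isClosed_subset (isClosed_tsupport _) (htsupp k)
  · intro x hx h0
    rw [mem_singleton_iff] at h0
    have := (htsupp k hx).1
    rw [h0, norm_zero] at this
    linarith
  · intro k x y
    rw [hΦe, hΦe, ← integral_sub (hprod k x) (hprod k y), ← Real.norm_eq_abs]
    refine (norm_integral_le_of_norm_le ((hρi k).mul_const (L * min ‖x - y‖ 1))
      (Eventually.of_forall fun t => ?_)).trans_eq ?_
    · rw [← mul_sub, norm_mul, Real.norm_of_nonneg (hρ0 k t)]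
      have := hL (x - t) (y - t)
      rw [sub_sub_sub_cancel_right] at this
      exact mul_le_mul_of_nonneg_left this (hρ0 k t)
    · rw [integral_mul_const, hρ1, one_mul]
  · intro k x
    rw [hΦe, ← Real.norm_eq_abs]
    refine (norm_integral_le_of_norm_le ((hρi k).mul_const M)
      (Eventually.of_forall fun t => ?_)).trans_eq ?_
    · rw [norm_mul, Real.norm_of_nonneg (hρ0 k t)]
      exact mul_le_mul_of_nonneg_left (hM _) (hρ0 k t)
    · rw [integral_mul_const, hρ1, one_mul]
  · exact ContDiffBump.convolution_tendsto_right_of_continuous hδt hφc x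

lemma sq_mul_kern_le {φ : Euc n → ℝ} {r b L : ℝ}
    (hrb : ∀ x, φ x ≠ 0 → r ≤ ‖x‖ ∧ ‖x‖ ≤ b)
    (hL : ∀ x y, |φ x - φ y| ≤ L * min ‖x - y‖ 1) (x y : Euc n) :
    ‖(φ x - φ y) ^ 2 * kern n s x y‖ ≤
      L ^ 2 * (annMajorant n s 0 r b x y + annMajorant n s 0 r b y x) := by
  have k0 := kern_nonneg (s := s) x y
  have a1 := annMajorant_nonneg (s := s) 0 r b x y
  have a2 := annMajorant_nonneg (s := s) 0 r b y x
  have l0 := levy_nonneg (s := s) (x - y)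
  have d1 := decay_nonneg (s := s) 0 y
  have d2 := decay_nonneg (s := s) 0 x
  rw [Real.norm_of_nonneg (by positivity)]
  have h1 : (φ x - φ y) ^ 2 * kern n s x y ≤ L ^ 2 * levy n s (x - y) := by
    have h2 : (φ x - φ y) ^ 2 ≤ (L * min ‖x - y‖ 1) ^ 2 := by
      rw [← sq_abs]
      exact pow_le_pow_left₀ (abs_nonneg _) (hL x y) 2
    have h3 : min ‖x - y‖ 1 ^ 2 ≤ min (‖x - y‖ ^ 2) 1 :=
      le_min (pow_le_pow_left₀ (by positivity) (min_le_left _ _) 2)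
        (pow_le_one₀ (by positivity) (min_le_right _ _))
    calc _ ≤ (L * min ‖x - y‖ 1) ^ 2 * kern n s x y := by gcongr
      _ = L ^ 2 * (min ‖x - y‖ 1 ^ 2 * kern n s x y) := by ring
      _ ≤ L ^ 2 * (min (‖x - y‖ ^ 2) 1 * kern n s x y) := by gcongr
      _ = _ := by rw [levy, kern, mul_one_div]
  by_cases hx : φ x = 0
  · by_cases hy : φ y = 0
    · rw [hx, hy]
      simp only [sub_self, ne_eq, OfNat.ofNat_ne_zero, not_false_eq_true, zero_pow, zero_mul]
      positivity
    · refine h1.trans (mul_le_mul_of_nonneg_left ?_ (sq_nonneg _))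
      have e : annMajorant n s 0 r b y x =
          levy n s (y - x) + decay n s 0 x + decay n s 0 x := by
        rw [annMajorant, indicator_of_mem (show y ∈ {x : Euc n | r ≤ ‖x‖ ∧ ‖x‖ ≤ b} from hrb y hy),
          Pi.one_apply, one_mul]
      have e2 : levy n s (y - x) = levy n s (x - y) := by unfold levy; rw [norm_sub_rev]
      linarith
  · refine h1.trans (mul_le_mul_of_nonneg_left ?_ (sq_nonneg _))
    have e : annMajorant n s 0 r b x y =
        levy n s (x - y) + decay n s 0 y + decay n s 0 y := by
      rw [annMajorant, indicator_of_mem (show x ∈ {x : Euc n | r ≤ ‖x‖ ∧ ‖x‖ ≤ b} from hrb x hx),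
        Pi.one_apply, one_mul]
    linarith

lemma IsTest.integrable_sq (hn : 0 < n) (hs0 : 0 < s) (hs1 : s < 1) {φ : Euc n → ℝ}
    (hφ : IsTest φ) :
    Integrable fun z : Euc n × Euc n => (φ z.1 - φ z.2) ^ 2 * kern n s z.1 z.2 := by
  simp only [sq]
  exact hφ.tame.integrable_form hn hs0 hs1 le_rfl (by exact_mod_cast hn) hφ

lemma tendsto_integral_mul_mul {c φ χ : Euc n → ℝ} (hc : ContinuousOn c {(0 : Euc n)}ᶜ)
    {d : Euc n → ℝ} (hd : Measurable d) (hdc : ∀ x, |d x| ≤ c x)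
    {r b M M' : ℝ} (hr : 0 < r) (hM0 : 0 ≤ M) {Φ Χ : ℕ → Euc n → ℝ}
    (hΦc : ∀ k, Continuous (Φ k)) (hΧc : ∀ k, Continuous (Χ k))
    (hrb : ∀ k x, Φ k x ≠ 0 → r ≤ ‖x‖ ∧ ‖x‖ ≤ b) (hM : ∀ k x, |Φ k x| ≤ M)
    (hM' : ∀ k x, |Χ k x| ≤ M') (hΦ : ∀ x, Tendsto (fun k => Φ k x) atTop (nhds (φ x)))
    (hΧ : ∀ x, Tendsto (fun k => Χ k x) atTop (nhds (χ x))) :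
    Tendsto (fun k => ∫ x, d x * Φ k x * Χ k x) atTop (nhds (∫ x, d x * φ x * χ x)) := by
  obtain ⟨D, hD⟩ := (isCompact_annulus (n := n) r b).exists_bound_of_continuousOn
    (hc.mono (by
      rintro x ⟨h1, -⟩ h0
      rw [mem_singleton_iff] at h0
      rw [h0, norm_zero] at h1
      linarith))
  have hM'0 : 0 ≤ M' := (abs_nonneg _).trans (hM' 0 0)
  refine tendsto_integral_of_dominated_convergence
    (fun x => D * M * M' * indicator {x : Euc n | r ≤ ‖x‖ ∧ ‖x‖ ≤ b} 1 x) (fun k => ?_)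
    ((integrable_indicator_annulus r b).const_mul _) (fun k => Eventually.of_forall fun x => ?_)
    (Eventually.of_forall fun x => ((hΦ x).const_mul _).mul (hΧ x))
  · exact ((hd.mul (hΦc k).measurable).mul (hΧc k).measurable).aestronglyMeasurable
  · by_cases h : Φ k x = 0
    · rw [h, mul_zero, zero_mul, norm_zero]
      by_cases hx : x ∈ {x : Euc n | r ≤ ‖x‖ ∧ ‖x‖ ≤ b}
      · have := (norm_nonneg _).trans (hD x hx)
        rw [indicator_of_mem hx, Pi.one_apply]
        positivity
      · rw [indicator_of_notMem hx, mul_zero]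
    · have hx := hrb k x h
      have h1 := (hdc x).trans ((le_abs_self _).trans (hD x hx))
      have hD0 := (abs_nonneg _).trans h1
      rw [indicator_of_mem (show x ∈ {x : Euc n | r ≤ ‖x‖ ∧ ‖x‖ ≤ b} from hx), Pi.one_apply,
        mul_one, norm_mul, norm_mul]
      simp only [Real.norm_eq_abs]
      gcongr
      exacts [hM k x, hM' k x]

lemma abs_rpow_mul_mul_le {m : ℕ} {p : ℝ} (v : EuclideanSpace ℝ (Fin m)) (i j : Fin m) :
    |‖v‖ ^ (p - 3) * v i * v j| ≤ ‖v‖ ^ (p - 1) := by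
  rcases eq_or_ne v 0 with h | h
  · rw [h]
    simp only [norm_zero, PiLp.zero_apply, mul_zero, abs_zero]
    positivity
  · have hv := norm_pos_iff.2 h
    rw [abs_mul, abs_mul, abs_of_nonneg (by positivity : 0 ≤ ‖v‖ ^ (p - 3)),
      show p - 1 = p - 3 + 1 + 1 by ring, Real.rpow_add_one hv.ne', Real.rpow_add_one hv.ne']
    have h1 := PiLp.norm_apply_le v i
    have h2 := PiLp.norm_apply_le v j
    rw [Real.norm_eq_abs] at h1 h2
    gcongr

lemma StableFrac.of_isTest (hn : 0 < n) (hs0 : 0 < s) (hs1 : s < 1) {m : ℕ} {p : ℝ} (hp : 1 < p)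
    {u : Euc n → EuclideanSpace ℝ (Fin m)} (hu : ContinuousOn u {(0 : Euc n)}ᶜ)
    (hum : Measurable u)
    (hstab : StableFrac n m s p u {(0 : Euc n)}ᶜ) {φ : Fin m → Euc n → ℝ}
    (hφ : ∀ i, IsTest (φ i)) :
    (∑ i, ∫ x, ‖u x‖ ^ (p - 1) * φ i x * φ i x) +
      (p - 1) * ∑ i, ∑ j, ∫ x, ‖u x‖ ^ (p - 3) * u x i * u x j * φ i x * φ j x
      ≤ ∑ i, (1 : ℝ) / 2 *
        ∫ z : Euc n × Euc n, (φ i z.1 - φ i z.2) ^ 2 * kern n s z.1 z.2 := by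
  choose r b L M hr hL0 hM0 Φ hsm hT hrb hL hM hlim using fun i => (hφ i).exists_smooth_approx
  have hc : ContinuousOn (fun x => ‖u x‖ ^ (p - 1)) {(0 : Euc n)}ᶜ :=
    hu.norm.rpow_const fun _ _ => Or.inr (by linarith)
  have hcomp : ∀ i, Measurable fun x => u x i := fun i => by fun_prop
  have hle : ∀ k : ℕ, (∑ i, ∫ x, ‖u x‖ ^ (p - 1) * Φ i k x * Φ i k x) +
      (p - 1) * ∑ i, ∑ j, ∫ x, ‖u x‖ ^ (p - 3) * u x i * u x j * Φ i k x * Φ j k x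
      ≤ ∑ i, (1 : ℝ) / 2 *
        ∫ z : Euc n × Euc n, (Φ i k z.1 - Φ i k z.2) ^ 2 * kern n s z.1 z.2 := by
    intro k
    have h := hstab (fun i => Φ i k) (fun i => hsm i k) (fun i => (hT i k).compact)
      (fun i => (hT i k).supp)
    refine le_of_eq_of_le ?_ (h.trans_eq ?_)
    · congr 1
      refine Finset.sum_congr rfl fun i _ => integral_congr_ae (Eventually.of_forall fun x => ?_)
      simp only
      ring
    · refine Finset.sum_congr rfl fun i _ => ?_
      have hi := (hT i k).integrable_sq hn hs0 hs1
      rw [Measure.volume_eq_prod] at hi ⊢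
      rw [integral_prod _ hi]
      simp only [kern, mul_one_div]
  have h1 : Tendsto (fun k => ∑ i, ∫ x, ‖u x‖ ^ (p - 1) * Φ i k x * Φ i k x) atTop
      (nhds (∑ i, ∫ x, ‖u x‖ ^ (p - 1) * φ i x * φ i x)) :=
    tendsto_finsetSum _ fun i _ =>
      tendsto_integral_mul_mul hc (by fun_prop) (fun x => (abs_of_nonneg (by positivity)).le)
        (hr i) (hM0 i) (fun k => (hsm i k).continuous) (fun k => (hsm i k).continuous) (hrb i)
        (hM i) (hM i) (hlim i) (hlim i)
  have h2 : Tendsto (fun k => ∑ i, ∑ j,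
        ∫ x, ‖u x‖ ^ (p - 3) * u x i * u x j * Φ i k x * Φ j k x) atTop
      (nhds (∑ i, ∑ j, ∫ x, ‖u x‖ ^ (p - 3) * u x i * u x j * φ i x * φ j x)) :=
    tendsto_finsetSum _ fun i _ => tendsto_finsetSum _ fun j _ =>
      tendsto_integral_mul_mul hc (by fun_prop) (fun x => abs_rpow_mul_mul_le _ _ _)
        (hr i) (hM0 i) (fun k => (hsm i k).continuous) (fun k => (hsm j k).continuous) (hrb i)
        (hM i) (hM j) (hlim i) (hlim j)
  refine le_of_tendsto_of_tendsto' (h1.add (h2.const_mul (p - 1)))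
    (tendsto_finsetSum _ fun i _ => Tendsto.const_mul _ ?_) hle
  · have hA := integrable_annMajorant (n := n) hn hs0 hs1 (a := 0) le_rfl (by exact_mod_cast hn)
      (r i) (b i)
    have hA' : Integrable fun z : Euc n × Euc n => annMajorant n s 0 (r i) (b i) z.2 z.1 := hA.swap
    refine tendsto_integral_of_dominated_convergence _ (fun k => ?_)
      ((hA.add hA').const_mul (L i ^ 2)) (fun k => Eventually.of_forall fun z => ?_)
      (Eventually.of_forall fun z => ?_)
    · exact ((hT i k).integrable_sq hn hs0 hs1).aestronglyMeasurable
    · exact sq_mul_kern_le (hrb i k) (hL i k) z.1 z.2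
    · exact (((hlim i z.1).sub (hlim i z.2)).pow 2).mul_const _

end Mollify

section GroundState

variable {n : ℕ} {s : ℝ}

lemma contDiffOn_norm_rpow (c : ℝ) :
    ContDiffOn ℝ 1 (fun x : Euc n => ‖x‖ ^ c) {(0 : Euc n)}ᶜ := fun _ hx =>
  ((contDiffAt_norm ℝ hx).rpow_const_of_ne (norm_ne_zero_iff.2 hx)).contDiffWithinAt

lemma tame_norm_rpow (a : ℝ) : Tame a fun x : Euc n => ‖x‖ ^ (-a) :=
  ⟨contDiffOn_norm_rpow _, 1, fun x => by rw [one_mul, abs_of_nonneg (by positivity)]⟩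

lemma IsTest.apply_zero {φ : Euc n → ℝ} (hφ : IsTest φ) : φ 0 = 0 :=
  image_eq_zero_of_notMem_tsupport fun h => hφ.supp h rfl

lemma IsTest.mul_left {φ v : Euc n → ℝ} (hφ : IsTest φ) (hv : ContDiffOn ℝ 1 v {(0 : Euc n)}ᶜ) :
    IsTest fun x => v x * φ x := by
  refine ⟨contDiff_iff_contDiffAt.2 fun x => ?_, hφ.compact.mul_left,
    (tsupport_mul_subset_right (f := v)).trans hφ.supp⟩
  by_cases hx : x = 0
  · have h0 : x ∉ tsupport φ := fun h => hφ.supp h hx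
    refine (contDiffAt_const (c := (0 : ℝ))).congr_of_eventuallyEq ?_
    filter_upwards [notMem_tsupport_iff_eventuallyEq.1 h0] with y hy
    rw [hy, Pi.zero_apply, mul_zero]
  · exact (hv.contDiffAt (isOpen_compl_singleton.mem_nhds hx)).mul hφ.smooth.contDiffAt

lemma IsTest.integrable_mul {φ c d : Euc n → ℝ} (hφ : IsTest φ)
    (hc : ContinuousOn c {(0 : Euc n)}ᶜ) (hd : Measurable d) (hdc : ∀ x, |d x| ≤ c x) :
    Integrable fun x => d x * φ x := by
  obtain ⟨r, b, hr, hrb⟩ := hφ.exists_annulus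
  obtain ⟨M, hM⟩ := hφ.compact.exists_bound_of_continuous hφ.smooth.continuous
  have hM0 := (norm_nonneg _).trans (hM 0)
  obtain ⟨D, hD⟩ := (isCompact_annulus (n := n) r b).exists_bound_of_continuousOn
    (hc.mono (by
      rintro x ⟨h1, -⟩ h0
      rw [mem_singleton_iff] at h0
      rw [h0, norm_zero] at h1
      linarith))
  refine ((integrable_indicator_annulus (n := n) r b).const_mul (D * M)).mono'
    (hd.mul hφ.smooth.continuous.measurable).aestronglyMeasurable
    (Eventually.of_forall fun x => ?_)
  by_cases hx : x ∈ {x : Euc n | r ≤ ‖x‖ ∧ ‖x‖ ≤ b}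
  · rw [indicator_of_mem hx, Pi.one_apply, mul_one, norm_mul]
    exact mul_le_mul ((hdc x).trans ((le_abs_self _).trans (hD x hx))) (hM x) (norm_nonneg _)
      ((norm_nonneg _).trans (hD x hx))
  · have h0 : φ x = 0 := by
      by_contra h
      exact hx (hrb x h)
    rw [h0, mul_zero, norm_zero, indicator_of_notMem hx, mul_zero]

lemma IsTest.integrable_rpow_mul {φ : Euc n → ℝ} (hφ : IsTest φ) (c : ℝ) :
    Integrable fun x => ‖x‖ ^ c * φ x :=
  hφ.integrable_mul (contDiffOn_norm_rpow c).continuousOn (by fun_prop)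
    fun x => (abs_of_nonneg (by positivity)).le

lemma norm_rpow_neg_mul_rpow_mul {a : ℝ} {ζ : Euc n → ℝ} (hζ : ζ 0 = 0) (x : Euc n) :
    ‖x‖ ^ (-a) * (‖x‖ ^ a * ζ x) = ζ x := by
  by_cases hx : x = 0
  · rw [hx, hζ, mul_zero, mul_zero]
  · rw [← mul_assoc, ← Real.rpow_add (norm_pos_iff.2 hx), neg_add_cancel, Real.rpow_zero, one_mul]

lemma norm_rpow_add_mul_rpow_mul (hn : 0 < n) (a c : ℝ) (f : Euc n → ℝ) :
    (fun x => ‖x‖ ^ (-(c + a)) * (‖x‖ ^ a * f x)) =ᵐ[volume] fun x => ‖x‖ ^ (-c) * f x := by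
  filter_upwards [ae_ne_zero hn] with x hx
  rw [← mul_assoc, ← Real.rpow_add (norm_pos_iff.2 hx)]
  ring_nf

lemma IsTest.sq {ζ : Euc n → ℝ} (hζ : IsTest ζ) : IsTest fun x => ζ x ^ 2 := by
  simp only [pow_two]
  exact hζ.mul_left hζ.smooth.contDiffOn

lemma ground_state (hn : 0 < n) (hs0 : 0 < s) (hs1 : s < 1) {a : ℝ} (ha : 0 < a)
    (han : 2 * s + a < n) {ζ : Euc n → ℝ} (hζ : IsTest ζ) :
    Integrable (fun z : Euc n × Euc n => ‖z.1‖ ^ (-a) * ‖z.2‖ ^ (-a) *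
      (‖z.1‖ ^ a * ζ z.1 - ‖z.2‖ ^ a * ζ z.2) ^ 2 * kern n s z.1 z.2) ∧
    1 / 2 * ∫ z : Euc n × Euc n, (ζ z.1 - ζ z.2) ^ 2 * kern n s z.1 z.2 =
      fracConst n s * gammaCoeff n s a * (∫ x, ‖x‖ ^ (-(2 * s)) * ζ x ^ 2) +
      1 / 2 * ∫ z : Euc n × Euc n, ‖z.1‖ ^ (-a) * ‖z.2‖ ^ (-a) *
        (‖z.1‖ ^ a * ζ z.1 - ‖z.2‖ ^ a * ζ z.2) ^ 2 * kern n s z.1 z.2 := by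
  have hh : IsTest fun x => ‖x‖ ^ a * ζ x ^ 2 := hζ.sq.mul_left (contDiffOn_norm_rpow a)
  have hF := (tame_norm_rpow (n := n) a).integrable_form hn hs0 hs1 ha.le (by linarith) hh
  have hE := hζ.integrable_sq hn hs0 hs1
  have hform := form_eq_gammaCoeff hn hs0 hs1 ha han hh.smooth.continuous.measurable
    (hh.integrable_rpow_mul _) hF
  rw [integral_congr_ae (norm_rpow_add_mul_rpow_mul hn a (2 * s) _)] at hform
  have hid : (fun z : Euc n × Euc n => (ζ z.1 - ζ z.2) ^ 2 * kern n s z.1 z.2 -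
      (‖z.1‖ ^ (-a) - ‖z.2‖ ^ (-a)) * (‖z.1‖ ^ a * ζ z.1 ^ 2 - ‖z.2‖ ^ a * ζ z.2 ^ 2) *
        kern n s z.1 z.2) = fun z => ‖z.1‖ ^ (-a) * ‖z.2‖ ^ (-a) *
      (‖z.1‖ ^ a * ζ z.1 - ‖z.2‖ ^ a * ζ z.2) ^ 2 * kern n s z.1 z.2 := by
    ext z
    have h1 := norm_rpow_neg_mul_rpow_mul (a := a) hζ.apply_zero z.1
    have h2 := norm_rpow_neg_mul_rpow_mul (a := a) hζ.apply_zero z.2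
    set w := ‖z.1‖ ^ (-a)
    set w' := ‖z.2‖ ^ (-a)
    set q := ‖z.1‖ ^ a
    set q' := ‖z.2‖ ^ a
    rw [← sub_mul]
    congr 1
    linear_combination (-ζ z.1 - w' * q * ζ z.1 + 2 * w' * q' * ζ z.2) * h1 +
      (-ζ z.2 - w * q' * ζ z.2 + 2 * ζ z.1) * h2
  have hI := hE.sub hF
  have hI' : Integrable (fun z : Euc n × Euc n => ‖z.1‖ ^ (-a) * ‖z.2‖ ^ (-a) *
      (‖z.1‖ ^ a * ζ z.1 - ‖z.2‖ ^ a * ζ z.2) ^ 2 * kern n s z.1 z.2) := hid ▸ hI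
  refine ⟨hI', ?_⟩
  rw [← hform, ← hid, integral_sub hE hF]
  ring

end GroundState

section LogCutoff

variable {n : ℕ} {s : ℝ}

lemma rpow_neg_mul_log_sq_le {a r : ℝ} (ha : 0 < a) (hr : 0 ≤ r) :
    r ^ (-a) * log r ^ 2 ≤ 2 / a ^ 2 * (1 + r ^ (-(2 * a))) := by
  rcases hr.eq_or_lt with rfl | hr
  · rw [log_zero, zero_pow two_ne_zero, mul_zero]
    positivity
  · have h1 := Real.quadratic_le_exp_of_nonneg (abs_nonneg (a * log r))
    have h2 := abs_nonneg (a * log r)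
    have h3 : exp |a * log r| ≤ r ^ a + r ^ (-a) := by
      rw [Real.rpow_def_of_pos hr, Real.rpow_def_of_pos hr, mul_neg, mul_comm (log r)]
      rcases abs_cases (a * log r) with ⟨h, -⟩ | ⟨h, -⟩ <;> rw [h]
      · linarith [exp_pos (-(a * log r))]
      · linarith [exp_pos (a * log r)]
    have h4 : log r ^ 2 ≤ 2 / a ^ 2 * (r ^ a + r ^ (-a)) := by
      rw [div_mul_eq_mul_div, le_div_iff₀ (by positivity)]
      rw [sq_abs, mul_pow] at h1
      nlinarith
    calc r ^ (-a) * log r ^ 2 ≤ r ^ (-a) * (2 / a ^ 2 * (r ^ a + r ^ (-a))) := by gcongr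
      _ = 2 / a ^ 2 * (r ^ (-a) * r ^ a + r ^ (-a) * r ^ (-a)) := by ring
      _ = _ := by
        rw [← Real.rpow_add hr, ← Real.rpow_add hr, neg_add_cancel, Real.rpow_zero]
        ring_nf

lemma abs_log_le {r : ℝ} (hr : 1 / 2 ≤ r) : |log r| ≤ 2 * |r - 1| := by
  have hr0 : 0 < r := by linarith
  have h1 := log_le_sub_one_of_pos hr0
  have h2 := one_sub_inv_le_log_of_pos hr0
  have h3 : 1 - r⁻¹ = (r - 1) / r := by field_simp
  have h4 : -(2 * |r - 1|) ≤ (r - 1) / r := by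
    rw [le_div_iff₀ hr0]
    nlinarith [abs_nonneg (r - 1), neg_abs_le (r - 1)]
  rw [abs_le]
  constructor
  · linarith
  · linarith [le_abs_self (r - 1), abs_nonneg (r - 1)]

/-- The kernel weighted by a power and by the squared logarithmic distance. -/
def logKern (n : ℕ) (s a : ℝ) (x y : Euc n) : ℝ :=
  ‖y‖ ^ (-a) * (log (‖x‖ / ‖y‖) ^ 2 * kern n s x y)

lemma logKern_nonneg (a : ℝ) (x y : Euc n) : 0 ≤ logKern n s a x y :=
  mul_nonneg (by positivity) (mul_nonneg (by positivity) (kern_nonneg _ _))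

lemma measurable_logKern (a : ℝ) :
    Measurable fun z : Euc n × Euc n => logKern n s a z.1 z.2 := by
  have h1 : Measurable fun z : Euc n × Euc n => ‖z.2‖ ^ (-a) := by fun_prop
  have h2 : Measurable fun z : Euc n × Euc n => log (‖z.1‖ / ‖z.2‖) ^ 2 :=
    (measurable_log.comp (measurable_fst.norm.div measurable_snd.norm)).pow_const 2
  exact h1.mul (h2.mul measurable_kern)

lemma logKern_smul (a : ℝ) {t : ℝ} (ht : 0 < t) (x y : Euc n) :
    logKern n s a (t • x) (t • y) = t ^ (-((n : ℝ) + (2 * s + a))) * logKern n s a x y := by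
  refine norm_mul_rpow_smul ht y ?_
  rw [kern_smul ht, norm_smul, norm_smul, mul_div_mul_left _ _ (norm_ne_zero_iff.2 ht.ne')]
  ring

lemma integrable_logKern (hn : 0 < n) (hs0 : 0 < s) (hs1 : s < 1) {a : ℝ} (ha : 0 < a)
    (han : 2 * a < n) {e : Euc n} (he : ‖e‖ = 1) : Integrable (logKern n s a e) := by
  obtain ⟨K, hK0, hK⟩ := exists_kern_le_decay (n := n) hs0 (half_pos one_pos) 1
  set C := 4 * (1 / 2 : ℝ) ^ (-a) + 2 / a ^ 2 * K with hC
  have hm : Measurable (logKern n s a e) := by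
    have h2 := (measurable_logKern (n := n) (s := s) a).comp
      (g := fun z : Euc n × Euc n => logKern n s a z.1 z.2) (measurable_prodMk_left (x := e))
    simpa only [Function.comp_def] using h2
  refine ((integrable_majorant (s := s) hn hs0 hs1 (a := 2 * a) (by linarith) han e).const_mul
    C).mono' hm.aestronglyMeasurable (Eventually.of_forall fun y => ?_)
  have l0 := levy_nonneg (s := s) (e - y)
  have d1 := decay_nonneg (s := s) (2 * a) y
  have d2 := decay_nonneg (s := s) 0 y
  have k0 := kern_nonneg (s := s) e y
  have hp1 : 0 ≤ 4 * (1 / 2 : ℝ) ^ (-a) := by positivity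
  have hp2 : 0 ≤ 2 / a ^ 2 * K := by positivity
  rw [Real.norm_of_nonneg (logKern_nonneg _ _ _), logKern, he]
  have hlog : log (1 / ‖y‖) ^ 2 = log ‖y‖ ^ 2 := by rw [one_div, log_inv, neg_sq]
  rw [hlog]
  by_cases h : ‖e - y‖ ≤ 1 / 2
  · have h1 : |‖y‖ - 1| ≤ ‖e - y‖ := by
      rw [← he, norm_sub_rev e y]
      exact abs_norm_sub_norm_le y e
    have h2 : 1 / 2 ≤ ‖y‖ := by linarith [neg_abs_le (‖y‖ - 1)]
    have h3 : log ‖y‖ ^ 2 ≤ 4 * ‖e - y‖ ^ 2 := by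
      rw [← sq_abs]
      have := pow_le_pow_left₀ (abs_nonneg _) ((abs_log_le h2).trans
        (mul_le_mul_of_nonneg_left h1 zero_le_two)) 2
      linarith
    have h4 : ‖y‖ ^ (-a) ≤ (1 / 2 : ℝ) ^ (-a) :=
      Real.rpow_le_rpow_of_nonpos (by norm_num) h2 (by linarith)
    calc _ ≤ (1 / 2 : ℝ) ^ (-a) * (4 * ‖e - y‖ ^ 2 * kern n s e y) := by gcongr
      _ = 4 * (1 / 2 : ℝ) ^ (-a) * levy n s (e - y) := by
        rw [levy, min_eq_left (by nlinarith [norm_nonneg (e - y)]), kern]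
        ring
      _ ≤ _ := by
        rw [hC]
        nlinarith [mul_nonneg hp1 d1, mul_nonneg hp1 d2, mul_nonneg hp2 l0, mul_nonneg hp2 d1,
          mul_nonneg hp2 d2]
  · have h1 := hK e y he.le (not_le.1 h).le
    have h2 := rpow_neg_mul_log_sq_le ha (norm_nonneg y)
    calc _ = ‖y‖ ^ (-a) * log ‖y‖ ^ 2 * kern n s e y := by ring
      _ ≤ 2 / a ^ 2 * (1 + ‖y‖ ^ (-(2 * a))) * (K * (1 + ‖y‖) ^ (-((n : ℝ) + 2 * s))) := by
        gcongr
      _ = 2 / a ^ 2 * K * (decay n s (2 * a) y + decay n s 0 y) := by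
        rw [decay, decay, neg_zero, Real.rpow_zero]
        ring
      _ ≤ _ := by
        rw [hC]
        nlinarith [mul_nonneg hp1 d1, mul_nonneg hp1 d2, mul_nonneg hp2 l0, mul_nonneg hp1 l0]

/-- A smooth cutoff on the line, equal to one on `[-1, 1]` and supported in `[-2, 2]`. -/
def lineBump : ContDiffBump (0 : ℝ) := ⟨1, 2, one_pos, one_lt_two⟩

lemma lineBump_eq_one {t : ℝ} (ht : |t| ≤ 1) : lineBump t = 1 :=
  lineBump.one_of_mem_closedBall (by simpa [lineBump] using ht)

lemma lineBump_eq_zero {t : ℝ} (ht : 2 ≤ |t|) : lineBump t = 0 :=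
  lineBump.zero_of_le_dist (by simpa [lineBump] using ht)

lemma exists_lineBump_lip : ∃ L : ℝ, 0 ≤ L ∧ ∀ t t', |lineBump t - lineBump t'| ≤ L * |t - t'| := by
  obtain ⟨L, hL⟩ := (lineBump.contDiff (n := 1)).lipschitzWith_of_hasCompactSupport
    lineBump.hasCompactSupport one_ne_zero
  exact ⟨L, L.2, fun t t' => by simpa [Real.dist_eq] using hL.dist_le_mul t t'⟩

/-- A power of the norm, cut off on a logarithmic scale. -/
def logCutoff (n : ℕ) (a ε : ℝ) (x : Euc n) : ℝ := ‖x‖ ^ (-a) * lineBump (ε * log ‖x‖)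

lemma logCutoff_eq_zero {a ε : ℝ} (ha : a ≠ 0) (hε : 0 < ε) {x : Euc n}
    (hx : ¬(exp (-(2 / ε)) ≤ ‖x‖ ∧ ‖x‖ ≤ exp (2 / ε))) : logCutoff n a ε x = 0 := by
  unfold logCutoff
  by_cases h0 : x = 0
  · rw [h0, norm_zero, Real.zero_rpow (neg_ne_zero.2 ha), zero_mul]
  · have hx0 := norm_pos_iff.2 h0
    rw [lineBump_eq_zero, mul_zero]
    by_contra! h
    apply hx
    rw [abs_mul, abs_of_pos hε, ← lt_div_iff₀' hε, abs_lt] at h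
    rw [← Real.le_log_iff_exp_le hx0, ← Real.log_le_iff_le_exp hx0]
    exact ⟨h.1.le, h.2.le⟩

lemma isTest_logCutoff {a ε : ℝ} (ha : a ≠ 0) (hε : 0 < ε) : IsTest (logCutoff n a ε) := by
  have hsub : tsupport (logCutoff n a ε) ⊆
      {x : Euc n | exp (-(2 / ε)) ≤ ‖x‖ ∧ ‖x‖ ≤ exp (2 / ε)} :=
    closure_minimal (fun x hx => by
      by_contra h
      exact hx (logCutoff_eq_zero ha hε h)) (isCompact_annulus _ _).isClosed
  have hne : tsupport (logCutoff n a ε) ⊆ {(0 : Euc n)}ᶜ := fun x hx h0 => by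
    rw [mem_singleton_iff] at h0
    have := (hsub hx).1
    rw [h0, norm_zero] at this
    exact absurd (exp_pos _) this.not_gt
  refine ⟨contDiff_iff_contDiffAt.2 fun x => ?_,
    (isCompact_annulus _ _).of_isClosed_subset (isClosed_tsupport _) hsub, hne⟩
  by_cases hx : x = 0
  · have h0 : x ∉ tsupport (logCutoff n a ε) := fun h => hne h hx
    exact (contDiffAt_const (c := (0 : ℝ))).congr_of_eventuallyEq
      (notMem_tsupport_iff_eventuallyEq.1 h0)
  · have h1 := contDiffAt_norm ℝ hx (n := 1)
    have hx0 := norm_ne_zero_iff.2 hx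
    exact (h1.rpow_const_of_ne hx0).mul
      (lineBump.contDiff.contDiffAt.comp x (contDiffAt_const.mul (h1.log hx0)))

/-- The indicator of a logarithmic annulus. -/
def logAnnulus (n : ℕ) (R : ℝ) : Set (Euc n) := {x | exp (-R) ≤ ‖x‖ ∧ ‖x‖ ≤ exp R}

lemma integrable_logAnnulus (R c : ℝ) :
    Integrable fun x : Euc n => ‖x‖ ^ c * indicator (logAnnulus n R) 1 x := by
  have h : (fun x : Euc n => ‖x‖ ^ c * indicator (logAnnulus n R) 1 x) =
      indicator (logAnnulus n R) fun x => ‖x‖ ^ c := by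
    ext x
    by_cases hx : x ∈ logAnnulus n R
    · rw [indicator_of_mem hx, indicator_of_mem hx, Pi.one_apply, mul_one]
    · rw [indicator_of_notMem hx, indicator_of_notMem hx, mul_zero]
  have hm : MeasurableSet (logAnnulus n R) := (isCompact_annulus _ _).measurableSet
  rw [h, integrable_indicator_iff hm]
  refine ContinuousOn.integrableOn_compact (isCompact_annulus _ _)
    ((contDiffOn_norm_rpow c).continuousOn.mono ?_)
  rintro x ⟨h1, -⟩ h0
  rw [mem_singleton_iff] at h0
  rw [h0, norm_zero] at h1
  exact absurd (exp_pos _) h1.not_gt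

lemma integral_logAnnulus_comp_smul (R : ℝ) {t : ℝ} (ht : 0 < t) :
    ∫ x : Euc n, ‖x‖ ^ (-(n : ℝ)) * indicator (logAnnulus n R) 1 (t • x) =
      ∫ x : Euc n, ‖x‖ ^ (-(n : ℝ)) * indicator (logAnnulus n R) 1 x := by
  have h := Measure.integral_comp_smul (volume : Measure (Euc n))
    (fun x => ‖x‖ ^ (-(n : ℝ)) * indicator (logAnnulus n R) (1 : Euc n → ℝ) x) t
  have h2 : ∀ x : Euc n, ‖t • x‖ ^ (-(n : ℝ)) * indicator (logAnnulus n R) (1 : Euc n → ℝ) (t • x) =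
      (t ^ n)⁻¹ * (‖x‖ ^ (-(n : ℝ)) * indicator (logAnnulus n R) (1 : Euc n → ℝ) (t • x)) := by
    intro x
    rw [norm_smul, Real.norm_of_nonneg ht.le, Real.mul_rpow ht.le (norm_nonneg _),
      Real.rpow_neg ht.le, Real.rpow_natCast, mul_assoc]
  have ht' : 0 < (t ^ n)⁻¹ := by positivity
  rw [finrank_euclideanSpace_fin, abs_of_pos ht', smul_eq_mul] at h
  simp only [h2] at h
  rw [integral_const_mul] at h
  exact mul_left_cancel₀ ht'.ne' h

lemma integral_logAnnulus_two_mul_le {R : ℝ} (hR : 0 < R) :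
    ∫ x : Euc n, ‖x‖ ^ (-(n : ℝ)) * indicator (logAnnulus n (2 * R)) 1 x ≤
      2 * ∫ x : Euc n, ‖x‖ ^ (-(n : ℝ)) * indicator (logAnnulus n R) 1 x := by
  have hprod : ∀ t : ℝ, 0 < t → Integrable fun x : Euc n =>
      ‖x‖ ^ (-(n : ℝ)) * indicator (logAnnulus n R) 1 (t • x) := by
    intro t ht
    have h1 := ((integrable_logAnnulus (n := n) R (-(n : ℝ))).comp_smul ht.ne').const_mul
      (t ^ (n : ℝ))
    refine h1.congr (Eventually.of_forall fun x => ?_)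
    simp only
    rw [norm_smul, Real.norm_of_nonneg ht.le, Real.mul_rpow ht.le (norm_nonneg _), ← mul_assoc,
      ← mul_assoc, ← Real.rpow_add ht, add_neg_cancel, Real.rpow_zero, one_mul]
  have h1 := hprod _ (exp_pos R)
  have h2 := hprod _ (exp_pos (-R))
  rw [two_mul (∫ x : Euc n, ‖x‖ ^ (-(n : ℝ)) * indicator (logAnnulus n R) 1 x)]
  nth_rewrite 1 [← integral_logAnnulus_comp_smul R (exp_pos R)]
  rw [← integral_logAnnulus_comp_smul R (exp_pos (-R)), ← integral_add h1 h2]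
  refine integral_mono (integrable_logAnnulus _ _) (h1.add h2) fun x => ?_
  simp only
  rw [← mul_add]
  refine mul_le_mul_of_nonneg_left ?_ (by positivity)
  have i1 : 0 ≤ indicator (logAnnulus n R) (1 : Euc n → ℝ) (exp R • x) :=
    indicator_nonneg (fun _ _ => zero_le_one) _
  have i2 : 0 ≤ indicator (logAnnulus n R) (1 : Euc n → ℝ) (exp (-R) • x) :=
    indicator_nonneg (fun _ _ => zero_le_one) _
  by_cases hx : x ∈ logAnnulus n (2 * R)
  · rw [indicator_of_mem hx, Pi.one_apply]
    obtain ⟨hx1, hx2⟩ := hx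
    have e1 : exp (-(2 * R)) = exp (-R) * exp (-R) := by rw [← exp_add]; ring_nf
    have e2 : exp (2 * R) = exp R * exp R := by rw [← exp_add]; ring_nf
    have e3 : exp R * exp (-R) = 1 := by rw [← exp_add, add_neg_cancel, exp_zero]
    have p1 := exp_pos R
    have p2 := exp_pos (-R)
    have p3 : 1 ≤ exp R := one_le_exp hR.le
    rcases le_total ‖x‖ 1 with h | h
    · rw [indicator_of_mem (s := logAnnulus n R) (a := exp R • x), Pi.one_apply]
      · linarith
      · constructor <;> rw [norm_smul, Real.norm_of_nonneg p1.le]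
        · calc exp (-R) = exp R * (exp (-R) * exp (-R)) := by rw [← mul_assoc, e3, one_mul]
            _ ≤ _ := by rw [← e1]; gcongr
        · nlinarith
    · rw [indicator_of_mem (s := logAnnulus n R) (a := exp (-R) • x), Pi.one_apply]
      · linarith
      · constructor <;> rw [norm_smul, Real.norm_of_nonneg p2.le]
        · nlinarith
        · calc _ ≤ exp (-R) * (exp R * exp R) := by rw [← e2]; gcongr
            _ = exp R := by rw [← mul_assoc, mul_comm (exp (-R)), e3, one_mul]
  · rw [indicator_of_notMem hx]
    positivity

lemma integral_logAnnulus_pos (hn : 0 < n) {R : ℝ} (hR : 0 < R) :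
    0 < ∫ x : Euc n, ‖x‖ ^ (-(n : ℝ)) * indicator (logAnnulus n R) 1 x := by
  have i0 : ∀ x : Euc n, 0 ≤ indicator (logAnnulus n R) (1 : Euc n → ℝ) x := fun x =>
    indicator_nonneg (fun _ _ => zero_le_one) _
  rw [integral_pos_iff_support_of_nonneg (fun x => mul_nonneg (by positivity) (i0 x))
    (integrable_logAnnulus _ _)]
  have hopen : IsOpen {x : Euc n | exp (-R) < ‖x‖ ∧ ‖x‖ < exp R} :=
    (isOpen_lt continuous_const continuous_norm).inter (isOpen_lt continuous_norm continuous_const)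
  have hne : {x : Euc n | exp (-R) < ‖x‖ ∧ ‖x‖ < exp R}.Nonempty :=
    ⟨EuclideanSpace.single ⟨0, hn⟩ 1, by simpa using hR⟩
  refine (hopen.measure_pos volume hne).trans_le (measure_mono fun x hx => ?_)
  have hx0 : 0 < ‖x‖ := (exp_pos _).trans hx.1
  rw [Function.mem_support, indicator_of_mem (show x ∈ logAnnulus n R from ⟨hx.1.le, hx.2.le⟩),
    Pi.one_apply, mul_one]
  positivity

end LogCutoff

section Hardy

variable {n : ℕ} {s : ℝ}

lemma norm_rpow_mul_logCutoff {a ε : ℝ} {x : Euc n} (hx : x ≠ 0) :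
    ‖x‖ ^ a * logCutoff n a ε x = lineBump (ε * log ‖x‖) := by
  rw [logCutoff, ← mul_assoc, ← Real.rpow_add (norm_pos_iff.2 hx), add_neg_cancel, Real.rpow_zero,
    one_mul]

lemma lineBump_log_sub_sq_le {L : ℝ} (hL : ∀ t t', |lineBump t - lineBump t'| ≤ L * |t - t'|)
    {ε : ℝ} (hε : 0 < ε) {x y : Euc n} (hx : x ≠ 0) (hy : y ≠ 0) :
    (lineBump (ε * log ‖x‖) - lineBump (ε * log ‖y‖)) ^ 2 ≤
      L ^ 2 * ε ^ 2 * log (‖x‖ / ‖y‖) ^ 2 * (indicator (logAnnulus n (2 / ε)) 1 x +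
        indicator (logAnnulus n (2 / ε)) 1 y) := by
  have hz : ∀ z : Euc n, z ≠ 0 → z ∉ logAnnulus n (2 / ε) → lineBump (ε * log ‖z‖) = 0 := by
    intro z hz h
    have h1 := norm_rpow_mul_logCutoff (a := 1) (ε := ε) hz
    rw [logCutoff_eq_zero one_ne_zero hε h, mul_zero] at h1
    exact h1.symm
  have h1 : (lineBump (ε * log ‖x‖) - lineBump (ε * log ‖y‖)) ^ 2 ≤
      L ^ 2 * ε ^ 2 * log (‖x‖ / ‖y‖) ^ 2 := by
    rw [log_div (norm_ne_zero_iff.2 hx) (norm_ne_zero_iff.2 hy), ← sq_abs]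
    refine (pow_le_pow_left₀ (abs_nonneg _) (hL _ _) 2).trans_eq ?_
    rw [mul_pow, sq_abs]
    ring
  have h2 : 0 ≤ L ^ 2 * ε ^ 2 * log (‖x‖ / ‖y‖) ^ 2 := by positivity
  by_cases hxS : x ∈ logAnnulus n (2 / ε)
  · rw [indicator_of_mem hxS, Pi.one_apply]
    refine h1.trans (le_mul_of_one_le_right h2 ?_)
    have : 0 ≤ indicator (logAnnulus n (2 / ε)) (1 : Euc n → ℝ) y :=
      indicator_nonneg (fun _ _ => zero_le_one) _
    linarith
  · by_cases hyS : y ∈ logAnnulus n (2 / ε)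
    · rw [indicator_of_mem hyS, indicator_of_notMem hxS, Pi.one_apply, zero_add, mul_one]
      exact h1
    · rw [hz x hx hxS, hz y hy hyS, indicator_of_notMem hxS, indicator_of_notMem hyS]
      simp

lemma logKern_symm_mul (a : ℝ) (x y : Euc n) :
    ‖x‖ ^ (-a) * logKern n s a x y = ‖y‖ ^ (-a) * logKern n s a y x := by
  have h : log (‖y‖ / ‖x‖) ^ 2 = log (‖x‖ / ‖y‖) ^ 2 := by rw [← inv_div, log_inv, neg_sq]
  rw [logKern, logKern, h, kern_symm y x]
  ring

lemma exists_isTest_energy_lt (hn : 0 < n) (hs0 : 0 < s) (hs1 : s < 1) (hns : 2 * s < n) {Λ : ℝ}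
    (hΛ : fracConst n s * gammaCoeff n s ((n - 2 * s) / 2) < Λ) :
    ∃ ζ : Euc n → ℝ, IsTest ζ ∧ (∀ (R : Euc n ≃ₗᵢ[ℝ] Euc n) x, ζ (R x) = ζ x) ∧
      1 / 2 * ∫ z : Euc n × Euc n, (ζ z.1 - ζ z.2) ^ 2 * kern n s z.1 z.2 <
        Λ * ∫ x, ‖x‖ ^ (-(2 * s)) * ζ x ^ 2 := by
  obtain ⟨e, he⟩ : ∃ e : Euc n, ‖e‖ = 1 := ⟨EuclideanSpace.single ⟨0, hn⟩ 1, by simp⟩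
  obtain ⟨L, hL0, hL⟩ := exists_lineBump_lip
  set a : ℝ := (n - 2 * s) / 2 with ha
  have ha0 : 0 < a := by rw [ha]; linarith
  have hZi := integrable_logKern (n := n) hn hs0 hs1 ha0 (by rw [ha]; linarith) he
  set Z := ∫ y, logKern n s a e y with hZ
  have hZ0 : 0 ≤ Z := integral_nonneg fun y => logKern_nonneg _ _ _
  set Λ₀ := fracConst n s * gammaCoeff n s a with hΛ₀
  obtain ⟨ε, hε, hεlt⟩ : ∃ ε : ℝ, 0 < ε ∧ 2 * L ^ 2 * Z * ε ^ 2 < Λ - Λ₀ := by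
    have hc : ContinuousAt (fun ε : ℝ => 2 * L ^ 2 * Z * ε ^ 2) 0 := by fun_prop
    have h1 : ∀ᶠ ε : ℝ in nhds 0, 2 * L ^ 2 * Z * ε ^ 2 < Λ - Λ₀ :=
      hc.eventually_lt continuousAt_const (by simpa using hΛ)
    have h2 : ∀ᶠ ε : ℝ in nhdsWithin 0 (Ioi 0), 2 * L ^ 2 * Z * ε ^ 2 < Λ - Λ₀ :=
      h1.filter_mono nhdsWithin_le_nhds
    obtain ⟨ε, h3, h4⟩ := (h2.and self_mem_nhdsWithin).exists
    exact ⟨ε, h4, h3⟩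
  set ζ := logCutoff n a ε with hζ
  have hT : IsTest ζ := isTest_logCutoff ha0.ne' hε
  refine ⟨ζ, hT, fun R x => by simp only [hζ, logCutoff, R.norm_map], ?_⟩
  obtain ⟨hI, hE⟩ := ground_state hn hs0 hs1 ha0 (by rw [ha]; linarith) hT
  rw [hE]
  set V : ℝ → ℝ := fun R => ∫ x : Euc n, ‖x‖ ^ (-(n : ℝ)) * indicator (logAnnulus n R) 1 x with hV
  have hVF : V (1 / ε) ≤ ∫ x, ‖x‖ ^ (-(2 * s)) * ζ x ^ 2 := by
    refine integral_mono (integrable_logAnnulus _ _) (hT.sq.integrable_rpow_mul _) fun x => ?_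
    simp only
    by_cases hx : x ∈ logAnnulus n (1 / ε)
    · have hx0 : 0 < ‖x‖ := (exp_pos _).trans_le hx.1
      have hb : lineBump (ε * log ‖x‖) = 1 := by
        refine lineBump_eq_one ?_
        rw [abs_mul, abs_of_pos hε, ← le_div_iff₀' hε, abs_le]
        exact ⟨(Real.le_log_iff_exp_le hx0).2 hx.1, (Real.log_le_iff_le_exp hx0).2 hx.2⟩
      rw [indicator_of_mem hx, Pi.one_apply, mul_one, hζ, logCutoff, hb, mul_one, pow_two,
        ← Real.rpow_add hx0, ← Real.rpow_add hx0]
      refine le_of_eq ?_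
      congr 1
      rw [ha]
      ring
    · rw [indicator_of_notMem hx, mul_zero]
      positivity
  have hVpos : 0 < V (1 / ε) := integral_logAnnulus_pos hn (by positivity)
  have hVV : V (2 / ε) ≤ 2 * V (1 / ε) := by
    have := integral_logAnnulus_two_mul_le (n := n) (R := 1 / ε) (by positivity)
    rwa [show 2 * (1 / ε) = 2 / ε by ring] at this
  set h : Euc n → ℝ := fun x => ‖x‖ ^ (-a) * indicator (logAnnulus n (2 / ε)) 1 x with hh
  have hSm : MeasurableSet (logAnnulus n (2 / ε)) := (isCompact_annulus _ _).measurableSet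
  have hhm : Measurable h := Measurable.mul (by fun_prop) (measurable_one.indicator hSm)
  have hhe : (fun x => ‖x‖ ^ (-(2 * s + a)) * h x) =ᵐ[volume]
      fun x => ‖x‖ ^ (-(n : ℝ)) * indicator (logAnnulus n (2 / ε)) 1 x := by
    filter_upwards [ae_ne_zero hn] with x hx
    simp only [hh]
    rw [← mul_assoc, ← Real.rpow_add (norm_pos_iff.2 hx)]
    congr 2
    rw [ha]
    ring
  obtain ⟨hQi, hQe⟩ := integrable_mul_homogeneous hn (Q := logKern n s a) (d := 2 * s + a)
    (fun R x y => by simp only [logKern, R.norm_map, kern_rot])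
    (fun t ht x y => logKern_smul a ht x y) (measurable_logKern a) (logKern_nonneg a) he hZi
    hhm ((integrable_congr hhe).2 (integrable_logAnnulus _ _))
  rw [integral_congr_ae hhe] at hQe
  obtain ⟨hSi, hSe⟩ := integral_add_swap hQi
  have hrem : ∫ z : Euc n × Euc n, ‖z.1‖ ^ (-a) * ‖z.2‖ ^ (-a) *
        (‖z.1‖ ^ a * ζ z.1 - ‖z.2‖ ^ a * ζ z.2) ^ 2 * kern n s z.1 z.2 ≤
      L ^ 2 * ε ^ 2 * (2 * (Z * V (2 / ε))) := by
    rw [← hQe, ← hSe, ← integral_const_mul]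
    refine integral_mono hI (hSi.const_mul _) fun z => ?_
    simp only
    have hz0 : ∀ x : Euc n, x = 0 → ‖x‖ ^ (-a) = 0 := fun x hx => by
      rw [hx, norm_zero, Real.zero_rpow (neg_ne_zero.2 ha0.ne')]
    by_cases h1 : z.1 = 0
    · have e1 := hz0 _ h1
      have e2 : h z.2 * logKern n s a z.2 z.1 = 0 := by rw [logKern, e1]; ring
      rw [e2]
      simp only [hh]
      rw [e1]
      simp
    by_cases h2 : z.2 = 0
    · have e1 := hz0 _ h2
      have e2 : h z.1 * logKern n s a z.1 z.2 = 0 := by rw [logKern, e1]; ring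
      rw [e2]
      simp only [hh]
      rw [e1]
      simp
    have hb := lineBump_log_sub_sq_le hL hε h1 h2
    rw [norm_rpow_mul_logCutoff h1, norm_rpow_mul_logCutoff h2]
    have k0 := kern_nonneg (s := s) z.1 z.2
    calc _ ≤ ‖z.1‖ ^ (-a) * ‖z.2‖ ^ (-a) * (L ^ 2 * ε ^ 2 * log (‖z.1‖ / ‖z.2‖) ^ 2 *
          (indicator (logAnnulus n (2 / ε)) 1 z.1 + indicator (logAnnulus n (2 / ε)) 1 z.2)) *
          kern n s z.1 z.2 := by gcongr
      _ = L ^ 2 * ε ^ 2 * (indicator (logAnnulus n (2 / ε)) 1 z.1 *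
            (‖z.1‖ ^ (-a) * logKern n s a z.1 z.2) +
          indicator (logAnnulus n (2 / ε)) 1 z.2 * (‖z.1‖ ^ (-a) * logKern n s a z.1 z.2)) := by
        rw [logKern]
        ring
      _ = _ := by
        nth_rewrite 2 [logKern_symm_mul]
        simp only [hh]
        ring
  have hF := hVpos.trans_le hVF
  set F := ∫ x, ‖x‖ ^ (-(2 * s)) * ζ x ^ 2
  have h1 : L ^ 2 * ε ^ 2 * (Z * V (2 / ε)) ≤ L ^ 2 * ε ^ 2 * (Z * (2 * F)) := by
    gcongr
    linarith
  nlinarith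

end Hardy

section Homogeneous

variable {n m : ℕ} {s a p : ℝ} {u : Euc n → EuclideanSpace ℝ (Fin m)}

lemma homogeneous_apply_zero (ha : 0 < a)
    (hhom : ∀ t : ℝ, 0 < t → ∀ x : Euc n, u (t • x) = t ^ (-a) • u x) : u 0 = 0 := by
  have h := hhom 2 two_pos 0
  rw [smul_zero] at h
  have h2 : (2 : ℝ) ^ (-a) < 1 := Real.rpow_lt_one_of_one_lt_of_neg one_lt_two (by linarith)
  have h3 : ((1 : ℝ) - 2 ^ (-a)) • u 0 = 0 := by rw [sub_smul, one_smul, ← h, sub_self]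
  exact (smul_eq_zero.1 h3).resolve_left (by linarith)

lemma exists_norm_le_of_homogeneous (ha : 0 < a) (hu : ContinuousOn u {(0 : Euc n)}ᶜ)
    (hhom : ∀ t : ℝ, 0 < t → ∀ x : Euc n, u (t • x) = t ^ (-a) • u x) :
    ∃ C, ∀ x, ‖u x‖ ≤ C * ‖x‖ ^ (-a) := by
  obtain ⟨C, hC⟩ := (isCompact_sphere (0 : Euc n) 1).exists_bound_of_continuousOn
    (hu.mono fun x hx h0 => by
      rw [mem_singleton_iff] at h0
      rw [h0, mem_sphere, dist_self] at hx
      exact zero_ne_one hx)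
  refine ⟨C, fun x => ?_⟩
  by_cases hx : x = 0
  · rw [hx, homogeneous_apply_zero ha hhom, norm_zero, norm_zero,
      Real.zero_rpow (by linarith), mul_zero]
  · have hx' := norm_pos_iff.2 hx
    have h := hhom ‖x‖ hx' (‖x‖⁻¹ • x)
    rw [smul_smul, mul_inv_cancel₀ hx'.ne', one_smul] at h
    rw [h, norm_smul, Real.norm_of_nonneg (by positivity), mul_comm]
    gcongr
    refine hC _ ?_
    rw [mem_sphere_zero_iff_norm, norm_smul, norm_inv, norm_norm, inv_mul_cancel₀ hx'.ne']

lemma tame_of_homogeneous (ha : 0 < a) (hu : ContDiffOn ℝ 1 u {(0 : Euc n)}ᶜ)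
    (hhom : ∀ t : ℝ, 0 < t → ∀ x : Euc n, u (t • x) = t ^ (-a) • u x) (i : Fin m) :
    Tame a fun x => u x i := by
  obtain ⟨C, hC⟩ := exists_norm_le_of_homogeneous ha hu.continuousOn hhom
  refine ⟨contDiffOn_euclidean.1 hu i, C, fun x => ?_⟩
  exact (PiLp.norm_apply_le (u x) i).trans (hC x)

/-- The squared angular part of a vector field that is homogeneous of degree `-a`. -/
def angularSq (a : ℝ) (u : Euc n → EuclideanSpace ℝ (Fin m)) (x : Euc n) : ℝ :=
  ‖u x‖ ^ 2 * ‖x‖ ^ (2 * a)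

lemma angularSq_nonneg (x : Euc n) : 0 ≤ angularSq a u x := by
  unfold angularSq; positivity

lemma angularSq_smul (hhom : ∀ t : ℝ, 0 < t → ∀ x : Euc n, u (t • x) = t ^ (-a) • u x)
    (t : ℝ) (ht : 0 < t) (x : Euc n) : angularSq a u (t • x) = angularSq a u x := by
  unfold angularSq
  rw [hhom t ht, norm_smul, norm_smul, Real.norm_of_nonneg (by positivity),
    Real.norm_of_nonneg ht.le, Real.mul_rpow ht.le (norm_nonneg _), mul_pow,
    ← Real.rpow_natCast (t ^ (-a)) 2, ← Real.rpow_mul ht.le]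
  have h : t ^ (-a * ((2 : ℕ) : ℝ)) * t ^ (2 * a) = 1 := by
    rw [← Real.rpow_add ht]
    convert Real.rpow_zero t using 2
    push_cast; ring
  linear_combination (‖u x‖ ^ 2 * ‖x‖ ^ (2 * a)) * h

lemma measurable_angularSq (hum : Measurable u) : Measurable (angularSq a u) := by
  unfold angularSq; fun_prop

lemma norm_sq_eq_angularSq_mul (ha : 0 < a)
    (hhom : ∀ t : ℝ, 0 < t → ∀ x : Euc n, u (t • x) = t ^ (-a) • u x) (x : Euc n) :
    ‖u x‖ ^ 2 = angularSq a u x * (‖x‖ ^ (-a)) ^ 2 := by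
  unfold angularSq
  by_cases hx : x = 0
  · rw [hx, homogeneous_apply_zero ha hhom, norm_zero]; ring
  · have hx' := norm_pos_iff.2 hx
    have h : ‖x‖ ^ (2 * a) * (‖x‖ ^ (-a)) ^ 2 = 1 := by
      rw [← Real.rpow_natCast, ← Real.rpow_mul hx'.le, ← Real.rpow_add hx']
      convert Real.rpow_zero ‖x‖ using 2
      push_cast; ring
    linear_combination (-‖u x‖ ^ 2) * h

lemma exists_angularSq_le (ha : 0 < a) (hu : ContinuousOn u {(0 : Euc n)}ᶜ)
    (hhom : ∀ t : ℝ, 0 < t → ∀ x : Euc n, u (t • x) = t ^ (-a) • u x) :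
    ∃ C, ∀ x, ‖angularSq a u x‖ ≤ C := by
  obtain ⟨C, hC⟩ := exists_norm_le_of_homogeneous ha hu hhom
  refine ⟨C ^ 2, fun x => ?_⟩
  rw [Real.norm_of_nonneg (angularSq_nonneg x)]
  by_cases hx : x = 0
  · rw [angularSq, hx, norm_zero, Real.zero_rpow (by linarith), mul_zero]
    positivity
  · have hx' := norm_pos_iff.2 hx
    have h1 := norm_sq_eq_angularSq_mul ha hhom x
    have h2 : ‖u x‖ ^ 2 ≤ (C * ‖x‖ ^ (-a)) ^ 2 := pow_le_pow_left₀ (norm_nonneg _) (hC x) 2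
    rw [h1, mul_pow] at h2
    exact le_of_mul_le_mul_right h2 (by positivity)

lemma sum_mul_le_angularSq (ha : 0 < a)
    (hhom : ∀ t : ℝ, 0 < t → ∀ x : Euc n, u (t • x) = t ^ (-a) • u x) (x y : Euc n) :
    ∑ i, u x i * u y i ≤
      1 / 2 * (angularSq a u x + angularSq a u y) * (‖x‖ ^ (-a) * ‖y‖ ^ (-a)) := by
  have hx := norm_sq_eq_angularSq_mul ha hhom x
  have hy := norm_sq_eq_angularSq_mul ha hhom y
  have h1 : ∑ i, u x i * u y i ≤ ‖u x‖ * ‖u y‖ := by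
    have := real_inner_le_norm (u y) (u x)
    rw [PiLp.inner_apply] at this
    simpa [mul_comm] using this
  have hM := Real.sq_sqrt (angularSq_nonneg (a := a) (u := u) x)
  have hN := Real.sq_sqrt (angularSq_nonneg (a := a) (u := u) y)
  set M := √(angularSq a u x)
  set N := √(angularSq a u y)
  have hw : 0 ≤ ‖x‖ ^ (-a) := by positivity
  have hw' : 0 ≤ ‖y‖ ^ (-a) := by positivity
  have e1 : ‖u x‖ = M * ‖x‖ ^ (-a) := by
    rw [← hM, ← mul_pow] at hx
    exact (pow_left_inj₀ (norm_nonneg _) (mul_nonneg (Real.sqrt_nonneg _) hw) two_ne_zero).1 hx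
  have e2 : ‖u y‖ = N * ‖y‖ ^ (-a) := by
    rw [← hN, ← mul_pow] at hy
    exact (pow_left_inj₀ (norm_nonneg _) (mul_nonneg (Real.sqrt_nonneg _) hw') two_ne_zero).1 hy
  rw [e1, e2] at h1
  rw [← hM, ← hN]
  nlinarith [mul_nonneg (mul_nonneg hw hw') (sq_nonneg (M - N))]

lemma sphAvg_angularSq_pos (ha : 0 < a) (hn : 0 < n) (hu : ContinuousOn u {(0 : Euc n)}ᶜ)
    (hhom : ∀ t : ℝ, 0 < t → ∀ x : Euc n, u (t • x) = t ^ (-a) • u x) {x : Euc n} (hx : x ≠ 0)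
    (hux : u x ≠ 0) : 0 < sphAvg (angularSq a u) := by
  have : Nonempty (Fin n) := ⟨⟨0, hn⟩⟩
  have hx' := norm_pos_iff.2 hx
  have hmem : ‖x‖⁻¹ • x ∈ sphere (0 : Euc n) 1 := by
    rw [mem_sphere_zero_iff_norm, norm_smul, norm_inv, norm_norm, inv_mul_cancel₀ hx'.ne']
  have hc : Continuous fun y : sphere (0 : Euc n) 1 => angularSq a u y := by
    have h1 : Continuous fun y : sphere (0 : Euc n) 1 => u y :=
      hu.comp_continuous continuous_subtype_val fun y h0 => by
        have := y.2
        rw [mem_singleton_iff.1 h0, mem_sphere, dist_self] at this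
        exact zero_ne_one this
    exact (h1.norm.pow 2).mul (continuous_subtype_val.norm.rpow_const fun _ => Or.inr (by positivity))
  have hne : (fun y : sphere (0 : Euc n) 1 => angularSq a u y) ⟨_, hmem⟩ ≠ 0 := by
    show angularSq a u (‖x‖⁻¹ • x) ≠ 0
    rw [angularSq_smul hhom _ (by positivity)]
    unfold angularSq
    have := norm_pos_iff.2 hux
    positivity
  have hpos := hc.integral_pos_of_hasCompactSupport_nonneg_nonzero
    (μ := (volume : Measure (Euc n)).toSphere) (HasCompactSupport.of_compactSpace _)
    (fun y => angularSq_nonneg _) hne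
  have hne0 : (volume : Measure (Euc n)).toSphere ≠ 0 := by
    intro h0
    rw [h0, integral_zero_measure] at hpos
    exact lt_irrefl _ hpos
  refine div_pos hpos ?_
  rw [measureReal_def]
  refine ENNReal.toReal_pos (fun h => hne0 (Measure.measure_univ_eq_zero.1 h)) (measure_ne_top _ _)

end Homogeneous

section Energy

variable {n m : ℕ} {s a p : ℝ} {u : Euc n → EuclideanSpace ℝ (Fin m)} {g : Euc n → ℝ}

lemma sum_rpow_mul_sq (v : EuclideanSpace ℝ (Fin m)) (i : Fin m) :
    ∑ j, ‖v‖ ^ (p - 3) * v i * v j * v i * v j = ‖v‖ ^ (p - 1) * v i * v i := by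
  by_cases hv : v = 0
  · simp [hv]
  · have hv' := norm_pos_iff.2 hv
    have h1 : ‖v‖ ^ (p - 1) = ‖v‖ ^ (p - 3) * ‖v‖ ^ 2 := by
      rw [← Real.rpow_natCast, ← Real.rpow_add hv']
      congr 1
      push_cast; ring
    rw [h1, EuclideanSpace.real_norm_sq_eq, Finset.mul_sum, Finset.sum_mul, Finset.sum_mul]
    exact Finset.sum_congr rfl fun j _ => by ring

lemma StableFrac.mul_le (hn : 0 < n) (hs0 : 0 < s) (hs1 : s < 1) (hp : 1 < p)
    (hu : ContDiffOn ℝ 1 u {(0 : Euc n)}ᶜ) (hum : Measurable u)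
    (hstab : StableFrac n m s p u {(0 : Euc n)}ᶜ) (hg : IsTest g) :
    p * ∑ i, ∫ x, ‖u x‖ ^ (p - 1) * u x i * (u x i * g x ^ 2) ≤
      ∑ i, (1 : ℝ) / 2 *
        ∫ z : Euc n × Euc n, (u z.1 i * g z.1 - u z.2 i * g z.2) ^ 2 * kern n s z.1 z.2 := by
  have hui : ∀ i, ContDiffOn ℝ 1 (fun x => u x i) {(0 : Euc n)}ᶜ := contDiffOn_euclidean.1 hu
  have h := hstab.of_isTest hn hs0 hs1 hp hu.continuousOn hum fun i => hg.mul_left (hui i)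
  have h1 : (∑ i, ∫ x, ‖u x‖ ^ (p - 1) * (u x i * g x) * (u x i * g x)) =
      ∑ i, ∫ x, ‖u x‖ ^ (p - 1) * u x i * (u x i * g x ^ 2) :=
    Finset.sum_congr rfl fun i _ => integral_congr_ae (Eventually.of_forall fun x => by ring)
  have h2 : (∑ i, ∑ j, ∫ x, ‖u x‖ ^ (p - 3) * u x i * u x j * (u x i * g x) * (u x j * g x)) =
      ∑ i, ∫ x, ‖u x‖ ^ (p - 1) * u x i * (u x i * g x ^ 2) := by
    refine Finset.sum_congr rfl fun i _ => ?_
    rw [← integral_finsetSum]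
    · refine integral_congr_ae (Eventually.of_forall fun x => ?_)
      have := sum_rpow_mul_sq (p := p) (u x) i
      calc ∑ j, ‖u x‖ ^ (p - 3) * u x i * u x j * (u x i * g x) * (u x j * g x)
          = (∑ j, ‖u x‖ ^ (p - 3) * u x i * u x j * u x i * u x j) * g x ^ 2 := by
            rw [Finset.sum_mul]
            exact Finset.sum_congr rfl fun j _ => by ring
        _ = ‖u x‖ ^ (p - 1) * u x i * (u x i * g x ^ 2) := by rw [this]; ring
    · intro j _
      have hm : ∀ k, Measurable fun x => u x k := fun k => by fun_prop
      have ht : IsTest fun x => (u x i * g x) * (u x j * g x) :=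
        (hg.mul_left (hui j)).mul_left (hg.mul_left (hui i)).smooth.contDiffOn
      have := ht.integrable_mul
        (hu.continuousOn.norm.rpow_const fun x _ => Or.inr (by linarith : (0 : ℝ) ≤ p - 1))
        (((hum.norm.pow_const (p - 3)).mul (hm i)).mul (hm j))
        fun x => abs_rpow_mul_mul_le (u x) i j
      refine this.congr (Eventually.of_forall fun x => ?_)
      simp only [Pi.mul_apply]
      ring
  rw [h1, h2] at h
  linarith

lemma le_sphAvg_mul_form (hn : 0 < n) (hs0 : 0 < s) (hs1 : s < 1) (ha : 0 < a)
    (han : 2 * s + a < n) (hu : ContDiffOn ℝ 1 u {(0 : Euc n)}ᶜ) (hum : Measurable u)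
    (hhom : ∀ t : ℝ, 0 < t → ∀ x : Euc n, u (t • x) = t ^ (-a) • u x) {ζ : Euc n → ℝ}
    (hζ : IsTest ζ) (hζr : ∀ (R : Euc n ≃ₗᵢ[ℝ] Euc n) x, ζ (R x) = ζ x) :
    (∑ i, (1 : ℝ) / 2 * ∫ z : Euc n × Euc n, (u z.1 i * (‖z.1‖ ^ a * ζ z.1) -
        u z.2 i * (‖z.2‖ ^ a * ζ z.2)) ^ 2 * kern n s z.1 z.2) -
      (∑ i, (1 : ℝ) / 2 * ∫ z : Euc n × Euc n, (u z.1 i - u z.2 i) *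
        (u z.1 i * (‖z.1‖ ^ a * ζ z.1) ^ 2 - u z.2 i * (‖z.2‖ ^ a * ζ z.2) ^ 2) *
          kern n s z.1 z.2) ≤
      sphAvg (angularSq a u) * (1 / 2 * ∫ z : Euc n × Euc n, ‖z.1‖ ^ (-a) * ‖z.2‖ ^ (-a) *
        (‖z.1‖ ^ a * ζ z.1 - ‖z.2‖ ^ a * ζ z.2) ^ 2 * kern n s z.1 z.2) := by
  obtain ⟨C, hC⟩ := exists_angularSq_le ha hu.continuousOn hhom
  have hg : IsTest fun x => ‖x‖ ^ a * ζ x := hζ.mul_left (contDiffOn_norm_rpow a)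
  have hui : ∀ i, ContDiffOn ℝ 1 (fun x => u x i) {(0 : Euc n)}ᶜ := contDiffOn_euclidean.1 hu
  obtain ⟨hQ, -⟩ := ground_state hn hs0 hs1 ha han hζ
  have hN := measurable_angularSq (a := a) hum
  set N := angularSq a u with hNdef
  have hI1 : ∀ i, Integrable fun z : Euc n × Euc n => (u z.1 i * (‖z.1‖ ^ a * ζ z.1) -
      u z.2 i * (‖z.2‖ ^ a * ζ z.2)) ^ 2 * kern n s z.1 z.2 := fun i =>
    (hg.mul_left (hui i)).integrable_sq hn hs0 hs1
  have hI2 : ∀ i, Integrable fun z : Euc n × Euc n => (u z.1 i - u z.2 i) *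
      (u z.1 i * (‖z.1‖ ^ a * ζ z.1) ^ 2 - u z.2 i * (‖z.2‖ ^ a * ζ z.2) ^ 2) *
        kern n s z.1 z.2 := fun i =>
    (tame_of_homogeneous ha hu hhom i).integrable_form hn hs0 hs1 ha.le (by linarith)
      (hg.sq.mul_left (hui i))
  set Q : Euc n → Euc n → ℝ := fun x y => ‖x‖ ^ (-a) * ‖y‖ ^ (-a) *
    (‖x‖ ^ a * ζ x - ‖y‖ ^ a * ζ y) ^ 2 * kern n s x y with hQdef
  have hQr : ∀ (R : Euc n ≃ₗᵢ[ℝ] Euc n) x y, Q (R x) (R y) = Q x y := fun R x y => by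
    simp only [hQdef, R.norm_map, hζr, kern_rot]
  have e1 := integral_prod_homogeneous_mul (angularSq_smul hhom) hN hC hn hQr hQ
  have e2 := integral_prod_swap_homogeneous_mul (angularSq_smul hhom) hN hC hn hQr hQ
  have i1 : Integrable fun z : Euc n × Euc n => N z.1 * Q z.1 z.2 :=
    hQ.bdd_mul (c := C) (hN.comp measurable_fst).aestronglyMeasurable
      (Eventually.of_forall fun z => hC z.1)
  have i2 : Integrable fun z : Euc n × Euc n => N z.2 * Q z.1 z.2 :=
    hQ.bdd_mul (c := C) (hN.comp measurable_snd).aestronglyMeasurable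
      (Eventually.of_forall fun z => hC z.2)
  rw [← Finset.mul_sum, ← Finset.mul_sum, ← integral_finsetSum _ fun i _ => hI1 i,
    ← integral_finsetSum _ fun i _ => hI2 i, ← mul_sub, ← integral_sub
      (integrable_finsetSum _ fun i _ => hI1 i) (integrable_finsetSum _ fun i _ => hI2 i)]
  have e3 : ∫ z : Euc n × Euc n, 1 / 2 * (N z.1 * Q z.1 z.2 + N z.2 * Q z.1 z.2) =
      sphAvg N * ∫ z : Euc n × Euc n, Q z.1 z.2 := by
    rw [integral_const_mul, integral_add i1 i2, e1, e2]; ring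
  have hle := integral_mono (μ := (volume : Measure (Euc n × Euc n)))
    ((integrable_finsetSum Finset.univ fun i _ => hI1 i).sub
      (integrable_finsetSum Finset.univ fun i _ => hI2 i))
    ((i1.add i2).const_mul (1 / 2)) fun z => by
      have h := sum_mul_le_angularSq ha hhom z.1 z.2
      have hk : 0 ≤ (‖z.1‖ ^ a * ζ z.1 - ‖z.2‖ ^ a * ζ z.2) ^ 2 * kern n s z.1 z.2 :=
        mul_nonneg (sq_nonneg _) (kern_nonneg _ _)
      have h2 := mul_le_mul_of_nonneg_right h hk
      simp only [Pi.sub_apply, Pi.add_apply, hQdef]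
      rw [← Finset.sum_sub_distrib]
      refine le_trans (le_of_eq ?_) (h2.trans (le_of_eq ?_))
      · rw [Finset.sum_mul]
        exact Finset.sum_congr rfl fun i _ => by ring
      · rw [hNdef]; ring
  have hle' := hle.trans_eq e3
  have := mul_le_mul_of_nonneg_left hle' (by norm_num : (0 : ℝ) ≤ 1 / 2)
  refine this.trans (le_of_eq ?_)
  ring

lemma sphAvg_mul_le_form (hn : 0 < n) (hs0 : 0 < s) (hs1 : s < 1) (ha : 0 < a)
    (han : 2 * s + a < n) (hu : ContDiffOn ℝ 1 u {(0 : Euc n)}ᶜ) (hum : Measurable u)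
    (hhom : ∀ t : ℝ, 0 < t → ∀ x : Euc n, u (t • x) = t ^ (-a) • u x) {ζ : Euc n → ℝ}
    (hζ : IsTest ζ) (hζr : ∀ (R : Euc n ≃ₗᵢ[ℝ] Euc n) x, ζ (R x) = ζ x) :
    sphAvg (angularSq a u) *
        (fracConst n s * gammaCoeff n s a * ∫ x, ‖x‖ ^ (-(2 * s)) * ζ x ^ 2) ≤
      ∑ i, (1 : ℝ) / 2 * ∫ z : Euc n × Euc n, (u z.1 i - u z.2 i) *
        (u z.1 i * (‖z.1‖ ^ a * ζ z.1) ^ 2 - u z.2 i * (‖z.2‖ ^ a * ζ z.2) ^ 2) *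
          kern n s z.1 z.2 := by
  have : Nonempty (Fin n) := ⟨⟨0, hn⟩⟩
  obtain ⟨e, he⟩ := exists_norm_eq (Euc n) zero_le_one
  obtain ⟨C, hC⟩ := exists_angularSq_le ha hu.continuousOn hhom
  have hg : IsTest fun x => ‖x‖ ^ a * ζ x := hζ.mul_left (contDiffOn_norm_rpow a)
  have hh : IsTest fun x => ‖x‖ ^ a * ζ x ^ 2 := hζ.sq.mul_left (contDiffOn_norm_rpow a)
  have hui : ∀ i, ContDiffOn ℝ 1 (fun x => u x i) {(0 : Euc n)}ᶜ := contDiffOn_euclidean.1 hu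
  have hN := measurable_angularSq (a := a) hum
  set N := angularSq a u with hNdef
  set h : Euc n → ℝ := fun x => ‖x‖ ^ a * ζ x ^ 2 with hhdef
  have hgh : ∀ x, ‖x‖ ^ (-a) * (‖x‖ ^ a * ζ x) ^ 2 = h x := fun x => by
    rw [hhdef]
    linear_combination (‖x‖ ^ a * ζ x) * norm_rpow_neg_mul_rpow_mul (a := a) hζ.apply_zero x
  have hI2 : ∀ i, Integrable fun z : Euc n × Euc n => (u z.1 i - u z.2 i) *
      (u z.1 i * (‖z.1‖ ^ a * ζ z.1) ^ 2 - u z.2 i * (‖z.2‖ ^ a * ζ z.2) ^ 2) *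
        kern n s z.1 z.2 := fun i =>
    (tame_of_homogeneous ha hu hhom i).integrable_form hn hs0 hs1 ha.le (by linarith)
      (hg.sq.mul_left (hui i))
  have hIs := integrable_finsetSum Finset.univ fun i _ => hI2 i
  rw [← Finset.mul_sum, ← integral_finsetSum _ fun i _ => hI2 i]
  have hF : ∫ x, ‖x‖ ^ (-(2 * s + a)) * h x = ∫ x, ‖x‖ ^ (-(2 * s)) * ζ x ^ 2 :=
    integral_congr_ae (norm_rpow_add_mul_rpow_mul hn a (2 * s) _)
  rw [← hF]
  have hl1 := (tendsto_integral_sep hn hIs tendsto_ratio).const_mul (1 / 2)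
  have hl2 := ((tendsto_sepCoeff hn hs0 hs1 ha han he).mul_const
    (∫ x, ‖x‖ ^ (-(2 * s + a)) * h x)).const_mul (sphAvg N)
  refine le_of_tendsto_of_tendsto' hl2 hl1 fun k => ?_
  have hhI : Integrable fun x => ‖x‖ ^ (-(2 * s + a)) * h x := hh.integrable_rpow_mul _
  have hhm : Measurable h := hh.smooth.continuous.measurable
  have hlk := ratio_pos k
  have hlk1 := ratio_lt_one k
  obtain ⟨j2, -⟩ := integrable_sep_snd hn hs0 hlk hlk1 he ha.le (by linarith) hhm hhI
  obtain ⟨j3, e3⟩ := integral_sep_form hn hs0 hlk hlk1 he ha.le (by linarith) hhm hhI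
  set l := ratio k
  set T : Euc n → Euc n → ℝ := fun x y => h x * (‖y‖ ^ (-a) * sepKern n s l x y) with hT
  replace j2 : Integrable fun z : Euc n × Euc n => T z.1 z.2 := j2
  have j2s : Integrable fun z : Euc n × Euc n => T z.2 z.1 := Integrable.swap j2
  have e2s : ∫ z : Euc n × Euc n, T z.2 z.1 = ∫ z : Euc n × Euc n, T z.1 z.2 := by
    rw [Measure.volume_eq_prod]
    exact integral_prod_swap fun z : Euc n × Euc n => T z.1 z.2
  have j4 : Integrable fun z : Euc n × Euc n => 1 / 2 * (T z.1 z.2 - T z.2 z.1) :=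
    (j2.sub j2s).const_mul (1 / 2)
  set Q : Euc n → Euc n → ℝ := fun x y => (‖x‖ ^ (-a) - ‖y‖ ^ (-a)) * h x * sepKern n s l x y +
    1 / 2 * (T x y - T y x) with hQdef
  have hQ : Integrable fun z : Euc n × Euc n => Q z.1 z.2 :=
    j3.add j4
  have hQe : ∫ z : Euc n × Euc n, Q z.1 z.2 =
      sepCoeff n s a l e * ∫ x, ‖x‖ ^ (-(2 * s + a)) * h x := by
    simp only [hQdef]
    rw [integral_add j3 j4, e3, integral_const_mul, integral_sub j2 j2s, e2s, sub_self, mul_zero, add_zero]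
  have hQr : ∀ (R : Euc n ≃ₗᵢ[ℝ] Euc n) x y, Q (R x) (R y) = Q x y := fun R x y => by
    simp only [hQdef, hT, hhdef, R.norm_map, hζr, sepKern_rot]
  have e1 := integral_prod_homogeneous_mul (angularSq_smul hhom) hN hC hn hQr hQ
  have i1 : Integrable fun z : Euc n × Euc n => N z.1 * Q z.1 z.2 :=
    hQ.bdd_mul (c := C) (hN.comp measurable_fst).aestronglyMeasurable
      (Eventually.of_forall fun z => hC z.1)
  obtain ⟨i4, e4⟩ := integral_add_swap i1
  rw [e1, hQe] at e4
  have hIk : Integrable fun z : Euc n × Euc n => sepInd n l z.1 z.2 *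
      ∑ i, (u z.1 i - u z.2 i) *
      (u z.1 i * (‖z.1‖ ^ a * ζ z.1) ^ 2 - u z.2 i * (‖z.2‖ ^ a * ζ z.2) ^ 2) *
        kern n s z.1 z.2 :=
    hIs.bdd_mul (c := 1) (measurable_sepInd l).aestronglyMeasurable
      (Eventually.of_forall fun z => by
        rw [Real.norm_of_nonneg (sepInd_nonneg _ _ _)]
        exact sepInd_le_one _ _ _)
  have hle := integral_mono i4 hIk fun z => by
    have hsum := sum_mul_le_angularSq ha hhom z.1 z.2
    have hx := norm_sq_eq_angularSq_mul ha hhom z.1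
    have hy := norm_sq_eq_angularSq_mul ha hhom z.2
    have hgx := hgh z.1
    have hgy := hgh z.2
    have hsk := sepKern_symm (n := n) (s := s) l z.2 z.1
    have hk := sepKern_nonneg (n := n) (s := s) l z.1 z.2
    have hsplit : sepInd n l z.1 z.2 * ∑ i, (u z.1 i - u z.2 i) *
        (u z.1 i * (‖z.1‖ ^ a * ζ z.1) ^ 2 - u z.2 i * (‖z.2‖ ^ a * ζ z.2) ^ 2) *
          kern n s z.1 z.2 = (‖u z.1‖ ^ 2 * (‖z.1‖ ^ a * ζ z.1) ^ 2 +
            ‖u z.2‖ ^ 2 * (‖z.2‖ ^ a * ζ z.2) ^ 2 - (∑ i, u z.1 i * u z.2 i) *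
            ((‖z.1‖ ^ a * ζ z.1) ^ 2 + (‖z.2‖ ^ a * ζ z.2) ^ 2)) * sepKern n s l z.1 z.2 := by
      rw [EuclideanSpace.real_norm_sq_eq, EuclideanSpace.real_norm_sq_eq, Finset.sum_mul,
        Finset.sum_mul, Finset.sum_mul, ← Finset.sum_add_distrib, ← Finset.sum_sub_distrib,
        Finset.sum_mul, Finset.mul_sum]
      exact Finset.sum_congr rfl fun i _ => by unfold sepKern; ring
    simp only [hQdef, hT]
    rw [hsplit, hsk, hx, hy, ← hgx, ← hgy]
    have h3 := mul_le_mul_of_nonneg_right hsum (mul_nonneg (add_nonneg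
      (sq_nonneg (‖z.1‖ ^ a * ζ z.1)) (sq_nonneg (‖z.2‖ ^ a * ζ z.2))) hk)
    rw [← hNdef] at h3 ⊢
    linarith
  linarith

end Energy

lemma gammaCoeff_hardy (n : ℕ) (s : ℝ) :
    gammaCoeff n s (((n : ℝ) - 2 * s) / 2) =
      Real.Gamma (((n : ℝ) + 2 * s) / 4) ^ 2 / Real.Gamma (((n : ℝ) - 2 * s) / 4) ^ 2 := by
  unfold gammaCoeff
  have h1 : ((n : ℝ) - ((n : ℝ) - 2 * s) / 2) / 2 = ((n : ℝ) + 2 * s) / 4 := by ring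
  have h2 : s + ((n : ℝ) - 2 * s) / 2 / 2 = ((n : ℝ) + 2 * s) / 4 := by ring
  have h3 : ((n : ℝ) - 2 * s) / 2 / 2 = ((n : ℝ) - 2 * s) / 4 := by ring
  have h4 : ((n : ℝ) - (2 * s + ((n : ℝ) - 2 * s) / 2)) / 2 = ((n : ℝ) - 2 * s) / 4 := by ring
  rw [h1, h2, h3, h4, pow_two, pow_two]

/-- Theorem 4.1 for `0 < s < 1`: classification of stable homogeneous solutions of the
fractional Lane–Emden system.  A homogeneous map `u_i(x) = |x|^{−2s/(p−1)} ψ_i(x/|x|)`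
(with `ψ = (ψ_i)` of class `C²` on the sphere, encoded by `u` being `C²` away from the
origin and homogeneous of degree `−2s/(p−1)`) which solves `(−Δ)^s u_i = |u|^{p−1} u_i`
on `ℝⁿ∖{0}` and is stable with respect to test functions in `C_c^∞(ℝⁿ∖{0})` must vanish,
provided `p > (n+2s)/(n−2s)` and
`p Γ(n/2−s/(p−1)) Γ(s+s/(p−1)) / ( Γ(s/(p−1)) Γ((n−2s)/2−s/(p−1)) )
  > Γ((n+2s)/4)² / Γ((n−2s)/4)²`. -/
theorem statement17 (n m : ℕ) (hm : 1 ≤ m) (s p : ℝ) (hs0 : 0 < s) (hs1 : s < 1)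
    (hns : 2 * s < (n : ℝ))
    (hp : ((n : ℝ) + 2 * s) / ((n : ℝ) - 2 * s) < p)
    (hgamma :
      Real.Gamma (((n : ℝ) + 2 * s) / 4) ^ 2 / Real.Gamma (((n : ℝ) - 2 * s) / 4) ^ 2 <
        p * (Real.Gamma ((n : ℝ) / 2 - s / (p - 1)) * Real.Gamma (s + s / (p - 1))) /
          (Real.Gamma (s / (p - 1)) * Real.Gamma (((n : ℝ) - 2 * s) / 2 - s / (p - 1))))
    (u : Euc n → EuclideanSpace ℝ (Fin m))
    (hreg : ContDiffOn ℝ 2 u {(0 : Euc n)}ᶜ)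
    (hhom : ∀ t : ℝ, 0 < t → ∀ x : Euc n, u (t • x) = t ^ (-(2 * s / (p - 1))) • u x)
    (hsol : ∀ (i : Fin m), ∀ x : Euc n, x ≠ 0 →
      FracLapEq n s (fun z => u z i) x (‖u x‖ ^ (p - 1) * u x i))
    (hstab : StableFrac n m s p u {(0 : Euc n)}ᶜ) :
    ∀ x : Euc n, x ≠ 0 → u x = 0 := by
  have hn : 0 < n := by
    have : (0 : ℝ) < n := by linarith
    exact_mod_cast this
  have hns' : (0 : ℝ) < n - 2 * s := by linarith
  rw [div_lt_iff₀ hns'] at hp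
  have hp1 : 1 < p := by
    by_contra! h
    nlinarith
  have hp0 : 0 < p - 1 := by linarith
  set a := 2 * s / (p - 1) with ha_def
  have ha : 0 < a := by positivity
  have hap : a * (p - 1) = 2 * s := div_mul_cancel₀ _ hp0.ne'
  have han : 2 * s + a < n := by
    have : 2 * a < n - 2 * s := by
      by_contra! h
      nlinarith
    linarith
  have hsp : s / (p - 1) = a / 2 := by rw [ha_def]; ring
  have hu1 : ContDiffOn ℝ 1 u {(0 : Euc n)}ᶜ := hreg.of_le (by norm_num)
  have hum : Measurable u := by
    have hi : ∀ i, Measurable fun x => u x i := fun i =>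
      (tame_of_homogeneous ha hu1 hhom i).measurable
    exact (WithLp.measurable_toLp 2 (Fin m → ℝ)).comp (measurable_pi_iff.2 hi)
  have hui : ∀ i, ContDiffOn ℝ 2 (fun x => u x i) {(0 : Euc n)}ᶜ := contDiffOn_euclidean.1 hreg
  have hΛ : fracConst n s * gammaCoeff n s (((n : ℝ) - 2 * s) / 2) <
      p * (fracConst n s * gammaCoeff n s a) := by
    have h : gammaCoeff n s (((n : ℝ) - 2 * s) / 2) < p * gammaCoeff n s a := by
      rw [gammaCoeff_hardy]
      refine hgamma.trans_eq ?_
      rw [hsp, mul_div_assoc]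
      unfold gammaCoeff
      congr 5 <;> ring
    have := mul_lt_mul_of_pos_left h (fracConst_pos (n := n) hs0 hs1)
    linarith
  obtain ⟨ζ, hζ, hζr, hE⟩ := exists_isTest_energy_lt hn hs0 hs1 hns hΛ
  have hg : IsTest fun x => ‖x‖ ^ a * ζ x := hζ.mul_left (contDiffOn_norm_rpow a)
  have h1 := hstab.mul_le hn hs0 hs1 hp1 hu1 hum hg
  have h2 := le_sphAvg_mul_form hn hs0 hs1 ha han hu1 hum hhom hζ hζr
  have h3 := sphAvg_mul_le_form hn hs0 hs1 ha han hu1 hum hhom hζ hζr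
  obtain ⟨-, h4⟩ := ground_state hn hs0 hs1 ha han hζ
  have h5 : ∑ i, (1 : ℝ) / 2 * ∫ z : Euc n × Euc n, (u z.1 i - u z.2 i) *
        (u z.1 i * (‖z.1‖ ^ a * ζ z.1) ^ 2 - u z.2 i * (‖z.2‖ ^ a * ζ z.2) ^ 2) *
          kern n s z.1 z.2 =
      ∑ i, ∫ x, ‖u x‖ ^ (p - 1) * u x i * (u x i * (‖x‖ ^ a * ζ x) ^ 2) :=
    Finset.sum_congr rfl fun i _ => weak_form hn hs0 hs1 ha.le (by linarith)
      (tame_of_homogeneous ha hu1 hhom i) (hui i) (hsol i)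
      (hg.sq.mul_left ((hui i).of_le (by norm_num)))
  intro x hx
  by_contra hux
  have hpos := sphAvg_angularSq_pos ha hn hu1.continuousOn hhom hx hux
  rw [h5] at h2 h3
  have h6 := mul_le_mul_of_nonneg_left h3 hp0.le
  have h7 := mul_lt_mul_of_pos_left hE hpos
  rw [h4] at h7
  nlinarith
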